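/- Let T(x) be the number of products pqr ≤ x with 3 ≤ p < q < r odd primes satisfying r < ((p-1)/(p-2))(q-1) and r ≡ q ≡ ±1 (mod p) (i.e. both q and r are congruent to 1 mod p or both to -1 mod p). Then |T(x)| = C₁·x/(log x)² + O(x·log log x/(log x)³) as x → ∞, where C₁ = 4·Σ_{p odd prime} (1/(p(p-1)²))·log((p-1)/(p-2)). -/

import Mathlib

open Real Filter

/-- The constant `C₁ = 4 Σ_{p odd prime} (1/(p(p-1)²)) log((p-1)/(p-2))`. -/
noncomputable def C1 : ℝ :=
  4 * ∑' p : {p : ℕ // p.Prime ∧ 3 ≤ p},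
    (1 / ((p.1 : ℝ) * ((p.1 : ℝ) - 1) ^ 2)) * Real.log (((p.1 : ℝ) - 1) / ((p.1 : ℝ) - 2))

/-- The number of products `pqr ≤ x` with `3 ≤ p < q < r` odd primes,
`r < ((p-1)/(p-2))(q-1)` and `r ≡ q ≡ ±1 (mod p)`. -/
noncomputable def Tcount (x : ℝ) : ℕ :=
  {n : ℕ | ∃ p q r : ℕ, p.Prime ∧ q.Prime ∧ r.Prime ∧
    3 ≤ p ∧ p < q ∧ q < r ∧ n = p * q * r ∧ (n : ℝ) ≤ x ∧
    (r : ℝ) < (((p : ℝ) - 1) / ((p : ℝ) - 2)) * ((q : ℝ) - 1) ∧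
    ((q % p = 1 ∧ r % p = 1) ∨ (q % p = p - 1 ∧ r % p = p - 1))}.ncard

namespace TA

lemma cpow_diff_bound {n : ℕ} (hn : 1 ≤ n) {s : ℂ} (hs : 0 < s.re) :
    ∀ u ∈ Set.Icc (n : ℝ) (n + 1), ‖(u : ℂ) ^ (-s) - (n : ℂ) ^ (-s)‖ ≤ ‖s‖ * (n : ℝ) ^ (-s.re - 1) := by
  intro u hu
  have hn' : (1 : ℝ) ≤ n := by exact_mod_cast hn
  have key := Convex.norm_image_sub_le_of_norm_hasDerivWithin_le (𝕜 := ℝ)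
    (f := fun u : ℝ => (u : ℂ) ^ (-s)) (f' := fun u : ℝ => -s * (u : ℂ) ^ (-s - 1))
    (s := Set.Icc (n : ℝ) (n + 1)) (C := ‖s‖ * (n : ℝ) ^ (-s.re - 1)) (x := n) (y := u) ?_ ?_
    (convex_Icc _ _) ⟨le_rfl, by linarith⟩ hu
  · refine key.trans ?_
    have : ‖u - (n : ℝ)‖ ≤ 1 := by
      rw [Real.norm_eq_abs, abs_le]; constructor <;> linarith [hu.1, hu.2]
    calc _ ≤ ‖s‖ * (n : ℝ) ^ (-s.re - 1) * 1 := by gcongr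
      _ = _ := mul_one _
  · intro v hv
    have hv0 : 0 < v := by linarith [hv.1]
    refine (hasDerivAt_ofReal_cpow_const hv0.ne' ?_ |>.hasDerivWithinAt).congr_deriv ?_ |>.congr_of_mem (fun _ _ => rfl) hv
    · intro h; rw [neg_eq_zero] at h; rw [h] at hs; simp at hs
    · rfl
  · intro v hv
    have hv0 : 0 < v := by linarith [hv.1]
    rw [norm_mul, norm_neg, Complex.norm_cpow_eq_rpow_re_of_pos hv0]
    gcongr
    simp only [Complex.sub_re, Complex.neg_re, Complex.one_re]
    exact Real.rpow_le_rpow_of_nonpos (by linarith) hv.1 (by linarith)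

/-- tail sum bound -/
lemma tail_rpow (N : ℕ) (hN : 1 ≤ N) {σ : ℝ} (hσ : 0 < σ) :
    Summable (fun n : ℕ => ((N + 1 + n : ℕ) : ℝ) ^ (-σ - 1)) ∧
    ∑' n : ℕ, ((N + 1 + n : ℕ) : ℝ) ^ (-σ - 1) ≤ (N : ℝ) ^ (-σ) / σ := by
  have hN' : (1 : ℝ) ≤ N := by exact_mod_cast hN
  have h1 : ∀ n : ℕ, ((N + 1 + n : ℕ) : ℝ) ^ (-σ - 1) ≤
      (((N + n : ℕ) : ℝ) ^ (-σ) - ((N + (n + 1) : ℕ) : ℝ) ^ (-σ)) / σ := by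
    intro n
    set m : ℝ := ((N + n : ℕ) : ℝ) with hm
    have hm1 : 1 ≤ m := by rw [hm]; push_cast; have : (0:ℝ) ≤ n := by positivity
                           linarith
    have e1 : ((N + 1 + n : ℕ) : ℝ) = m + 1 := by rw [hm]; push_cast; ring
    have e2 : ((N + (n + 1) : ℕ) : ℝ) = m + 1 := by rw [hm]; push_cast; ring
    rw [e1, e2, le_div_iff₀ hσ]
    obtain ⟨c, hc, hc'⟩ := exists_hasDerivAt_eq_slope (fun u : ℝ => u ^ (-σ)) (fun u => -σ * u ^ (-σ - 1))
      (show m < m + 1 by linarith)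
      (by apply ContinuousOn.rpow_const continuousOn_id
          intro x hx; left; have := hx.1; simp; linarith)
      (by intro x hx; exact Real.hasDerivAt_rpow_const (Or.inl (by have := hx.1; linarith)))
    have : (m + 1) ^ (-σ - 1) ≤ c ^ (-σ - 1) :=
      Real.rpow_le_rpow_of_nonpos (by linarith [hc.1]) hc.2.le (by linarith)
    have hh : m ^ (-σ) - (m + 1) ^ (-σ) = σ * c ^ (-σ - 1) := by
      have : m + 1 - m = 1 := by ring
      rw [this, div_one] at hc'
      linarith
    rw [hh]; nlinarith
  have hpart : ∀ M : ℕ, ∑ n ∈ Finset.range M, ((N + 1 + n : ℕ) : ℝ) ^ (-σ - 1) ≤ (N : ℝ) ^ (-σ) / σ := by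
    intro M
    refine (Finset.sum_le_sum fun n _ => h1 n).trans ?_
    rw [← Finset.sum_div, Finset.sum_range_sub' (fun n => ((N + n : ℕ) : ℝ) ^ (-σ))]
    gcongr
    have : (0 : ℝ) ≤ ((N + M : ℕ) : ℝ) ^ (-σ) := by positivity
    simpa using this
  have hs := summable_of_sum_range_le (f := fun n : ℕ => ((N + 1 + n : ℕ) : ℝ) ^ (-σ - 1))
    (fun n => by positivity) hpart
  exact ⟨hs, hs.tsum_le_of_sum_range_le hpart⟩

/-- partial sums from N+1 -/
noncomputable def PS (c : ℕ → ℂ) (N m : ℕ) : ℂ := ∑ k ∈ Finset.range m, c (N + 1 + k)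

noncomputable def tailT (c : ℕ → ℂ) (N : ℕ) (s : ℂ) (n : ℕ) : ℂ :=
  PS c N (n + 1) * (((N + 1 + n : ℕ) : ℂ) ^ (-s) - ((N + 1 + n + 1 : ℕ) : ℂ) ^ (-s))

lemma tailT_bound {c : ℕ → ℂ} {N : ℕ} {Q : ℝ} (hQ : ∀ m, ‖PS c N m‖ ≤ Q) {s : ℂ} (hs : 0 < s.re) (n : ℕ) :
    ‖tailT c N s n‖ ≤ Q * ‖s‖ * ((N + 1 + n : ℕ) : ℝ) ^ (-s.re - 1) := by
  unfold tailT
  rw [norm_mul, mul_assoc]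
  have := cpow_diff_bound (n := N + 1 + n) (by omega) hs (((N + 1 + n : ℕ) : ℝ) + 1) ⟨by linarith, le_rfl⟩
  rw [norm_sub_rev] at this
  gcongr
  · exact (norm_nonneg _).trans (hQ 0)
  · exact hQ _
  · have e : ((N + 1 + n + 1 : ℕ) : ℂ) = ((((N + 1 + n : ℕ) : ℝ) + 1 : ℝ) : ℂ) := by push_cast; ring
    rw [e]; exact this

lemma tail_tsum_bound {c : ℕ → ℂ} {N : ℕ} (hN : 1 ≤ N) {Q : ℝ} (hQ : ∀ m, ‖PS c N m‖ ≤ Q) {s : ℂ} (hs : 0 < s.re) :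
    ‖∑' n, tailT c N s n‖ ≤ Q * ‖s‖ * ((N : ℝ) ^ (-s.re) / s.re) := by
  obtain ⟨h1, h2⟩ := tail_rpow N hN hs
  have hQ0 : 0 ≤ Q := (norm_nonneg _).trans (hQ 0)
  refine (tsum_of_norm_bounded (h1.mul_left (Q * ‖s‖)).hasSum (tailT_bound hQ hs)).trans ?_
  rw [tsum_mul_left]
  gcongr

lemma tail_differentiableOn {c : ℕ → ℂ} {N : ℕ} (hN : 1 ≤ N) {Q : ℝ} (hQ : ∀ m, ‖PS c N m‖ ≤ Q) :
    DifferentiableOn ℂ (fun s => ∑' n, tailT c N s n) {s : ℂ | 0 < s.re} := by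
  have hQ0 : 0 ≤ Q := (norm_nonneg _).trans (hQ 0)
  intro s0 hs0
  have hs0' : 0 < s0.re := hs0
  set U : Set ℂ := {s : ℂ | s0.re / 2 < s.re} ∩ Metric.ball 0 (‖s0‖ + 1)
  have hU : IsOpen U := (isOpen_lt continuous_const Complex.continuous_re).inter Metric.isOpen_ball
  have hmem : s0 ∈ U := ⟨by simp; linarith, by simp⟩
  have key : DifferentiableOn ℂ (fun s => ∑' n, tailT c N s n) U := by
    apply Complex.differentiableOn_tsum_of_summable_norm
      (u := fun n : ℕ => Q * (‖s0‖ + 1) * ((N + 1 + n : ℕ) : ℝ) ^ (-(s0.re/2) - 1))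
    · exact (tail_rpow N hN (by linarith : 0 < s0.re/2)).1.mul_left _
    · intro n
      unfold tailT
      have h1 : ((N + 1 + n : ℕ) : ℂ) ≠ 0 := by norm_cast; omega
      have h2 : ((N + 1 + n + 1 : ℕ) : ℂ) ≠ 0 := by norm_cast
      intro s hs
      refine DifferentiableAt.differentiableWithinAt ?_
      refine DifferentiableAt.const_mul (DifferentiableAt.sub ?_ ?_) _
      · exact (differentiableAt_id.neg).const_cpow (Or.inl h1)
      · exact (differentiableAt_id.neg).const_cpow (Or.inl h2)
    · exact hU
    · intro n s hs
      have h1 : s0.re / 2 < s.re := hs.1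
      have h2 : ‖s‖ < ‖s0‖ + 1 := by simpa using hs.2
      refine (tailT_bound hQ (by linarith) n).trans ?_
      have h3 : (1 : ℝ) ≤ ((N + 1 + n : ℕ) : ℝ) := by norm_cast; omega
      gcongr
  exact (key.differentiableAt (hU.mem_nhds hmem)).differentiableWithinAt

lemma abel_partial (c : ℕ → ℂ) (N M : ℕ) (s : ℂ) :
    ∑ k ∈ Finset.range M, c (N + 1 + k) * ((N + 1 + k : ℕ) : ℂ) ^ (-s) =
      PS c N M * ((N + 1 + M : ℕ) : ℂ) ^ (-s) + ∑ k ∈ Finset.range M, tailT c N s k := by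
  induction M with
  | zero => simp [PS]
  | succ M ih =>
    rw [Finset.sum_range_succ, ih, Finset.sum_range_succ]
    have : PS c N (M + 1) = PS c N M + c (N + 1 + M) := by simp [PS, Finset.sum_range_succ]
    unfold tailT
    rw [this]
    rw [show N + 1 + (M + 1) = N + 1 + M + 1 by ring]
    ring

lemma tail_hasSum {c : ℕ → ℂ} {N : ℕ} (hN : 1 ≤ N) {Q : ℝ} (hQ : ∀ m, ‖PS c N m‖ ≤ Q) {s : ℂ} (hs : 0 < s.re) :
    Tendsto (fun M => ∑ k ∈ Finset.range M, c (N + 1 + k) * ((N + 1 + k : ℕ) : ℂ) ^ (-s)) atTop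
      (nhds (∑' n, tailT c N s n)) := by
  have hsum : Summable (tailT c N s) :=
    Summable.of_norm_bounded ((tail_rpow N hN hs).1.mul_left _) (tailT_bound hQ hs)
  simp_rw [abel_partial]
  rw [← zero_add (∑' n, tailT c N s n)]
  refine Tendsto.add ?_ hsum.hasSum.tendsto_sum_nat
  have h0 : Tendsto (fun M : ℕ => ((N + 1 + M : ℕ) : ℝ) ^ (-s.re)) atTop (nhds 0) := by
    refine (tendsto_rpow_neg_atTop hs).comp (tendsto_natCast_atTop_atTop.comp ?_)
    exact tendsto_atTop_mono (fun n => (by omega : n ≤ N + 1 + n)) tendsto_id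
  refine squeeze_zero_norm (a := fun M : ℕ => Q * ((N + 1 + M : ℕ) : ℝ) ^ (-s.re)) ?_ (by simpa using h0.const_mul Q)
  intro M
  rw [norm_mul, Complex.norm_natCast_cpow_of_pos (by omega)]
  simp only [Complex.neg_re]
  gcongr
  exact hQ M

end TA

namespace TA

lemma rpow_one_sub_le {N : ℕ} (hN : 2 ≤ Real.log N) {σ : ℝ} (h1 : 1 - 1 / Real.log N ≤ σ) {m : ℝ}
    (hm1 : 1 ≤ m) (hm2 : m ≤ N) : m ^ (1 - σ) ≤ 3 := by
  have hl0 : 0 ≤ Real.log m := Real.log_nonneg hm1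
  have hl : Real.log m ≤ Real.log N := Real.log_le_log (by linarith) hm2
  have h2 : (1 - σ) * Real.log m ≤ 1 := by
    have : (1 - σ) ≤ 1 / Real.log N := by linarith
    calc (1 - σ) * Real.log m ≤ 1 / Real.log N * Real.log m := by gcongr
      _ ≤ 1 / Real.log N * Real.log N := by gcongr
      _ = 1 := by field_simp
  rw [Real.rpow_def_of_pos (by linarith)]
  calc Real.exp (Real.log m * (1 - σ)) ≤ Real.exp 1 := by
        apply Real.exp_le_exp.mpr; linarith
    _ ≤ 3 := by have := Real.exp_one_lt_d9; linarith

lemma head_bound {N : ℕ} (hN : 2 ≤ Real.log N) {s : ℂ} (h1 : 1 - 1 / Real.log N ≤ s.re)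
    (c : ℕ → ℂ) (hc : ∀ n, ‖c n‖ ≤ 1) :
    ‖∑ n ∈ Finset.range N, c (n + 1) * ((n + 1 : ℕ) : ℂ) ^ (-s)‖ ≤ 3 * (1 + Real.log N) := by
  refine (norm_sum_le _ _).trans ?_
  have hb : ∀ n ∈ Finset.range N, ‖c (n + 1) * ((n + 1 : ℕ) : ℂ) ^ (-s)‖ ≤ 3 * ((n + 1 : ℕ) : ℝ)⁻¹ := by
    intro n hn
    rw [norm_mul, Complex.norm_natCast_cpow_of_pos (by omega)]
    have hpos : (0 : ℝ) < ((n + 1 : ℕ) : ℝ) := by positivity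
    have h3 := rpow_one_sub_le hN h1 (m := ((n + 1 : ℕ) : ℝ)) (by norm_cast; omega)
      (by norm_cast; have := Finset.mem_range.mp hn; omega)
    have e : ((n + 1 : ℕ) : ℝ) ^ (-s).re = ((n + 1 : ℕ) : ℝ) ^ (1 - s.re) * ((n + 1 : ℕ) : ℝ)⁻¹ := by
      rw [← Real.rpow_neg_one, ← Real.rpow_add hpos]
      congr 1
      simp only [Complex.neg_re]; ring
    rw [e]
    calc _ ≤ 1 * (3 * ((n + 1 : ℕ) : ℝ)⁻¹) := by gcongr; exact hc _
      _ = _ := one_mul _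
  refine (Finset.sum_le_sum hb).trans ?_
  rw [← Finset.mul_sum]
  gcongr
  have := harmonic_le_one_add_log N
  rw [harmonic] at this
  push_cast at this ⊢
  exact this

lemma char_sum_period {q : ℕ} [NeZero q] {χ : DirichletCharacter ℂ q} (hχ : χ ≠ 1) (N : ℕ) :
    ∑ k ∈ Finset.range q, χ ((N + 1 + k : ℕ) : ZMod q) = 0 := by
  have h1 : ∑ a : ZMod q, χ a = 0 := MulChar.sum_eq_zero_of_ne_one hχ
  rw [← h1, ← Equiv.sum_comp (Equiv.addLeft ((N + 1 : ℕ) : ZMod q))]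
  refine Finset.sum_nbij' (fun k => (k : ZMod q)) (fun a => a.val) ?_ ?_ ?_ ?_ ?_
  · intro a _; exact Finset.mem_univ _
  · intro a _; exact Finset.mem_range.mpr (ZMod.val_lt a)
  · intro a ha; exact ZMod.val_cast_of_lt (Finset.mem_range.mp ha)
  · intro a _; exact ZMod.natCast_zmod_val a
  · intro a _; simp [add_assoc]

lemma PS_period {q : ℕ} [NeZero q] {χ : DirichletCharacter ℂ q} (hχ : χ ≠ 1) (N m : ℕ) :
    PS (fun n => χ (n : ZMod q)) N (q + m) = PS (fun n => χ (n : ZMod q)) N m := by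
  unfold PS
  rw [Finset.sum_range_add, char_sum_period hχ, zero_add]
  refine Finset.sum_congr rfl fun k _ => ?_
  have : ((N + 1 + (q + k) : ℕ) : ZMod q) = ((N + 1 + k : ℕ) : ZMod q) := by
    push_cast; rw [ZMod.natCast_self]; ring
  simp only [this]

lemma PS_char_le {q : ℕ} [NeZero q] {χ : DirichletCharacter ℂ q} (hχ : χ ≠ 1) (N : ℕ) (m : ℕ) :
    ‖PS (fun n => χ (n : ZMod q)) N m‖ ≤ q := by
  induction m using Nat.strong_induction_on with
  | _ m ih =>
    rcases lt_or_ge m q with h | h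
    · unfold PS
      refine (norm_sum_le _ _).trans ?_
      calc ∑ k ∈ Finset.range m, ‖χ ((N + 1 + k : ℕ) : ZMod q)‖ ≤ ∑ k ∈ Finset.range m, (1 : ℝ) :=
            Finset.sum_le_sum fun k _ => χ.norm_le_one _
        _ = m := by simp
        _ ≤ q := by exact_mod_cast h.le
    · obtain ⟨d, rfl⟩ := Nat.exists_eq_add_of_le h
      rw [PS_period hχ]
      exact ih d (by have := NeZero.pos q; omega)

lemma analyticOnNhd_of_differentiableOn_half {f : ℂ → ℂ} (h : DifferentiableOn ℂ f {s : ℂ | 0 < s.re}) :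
    AnalyticOnNhd ℂ f {s : ℂ | 0 < s.re} :=
  h.analyticOnNhd (isOpen_lt continuous_const Complex.continuous_re)

lemma eqOn_half {f g : ℂ → ℂ} (hf : DifferentiableOn ℂ f {s : ℂ | 0 < s.re})
    (hg : DifferentiableOn ℂ g {s : ℂ | 0 < s.re}) (h : ∀ s : ℂ, 1 < s.re → f s = g s) :
    ∀ s : ℂ, 0 < s.re → f s = g s := by
  intro s hs
  refine (analyticOnNhd_of_differentiableOn_half hf).eqOn_of_preconnected_of_eventuallyEq
    (analyticOnNhd_of_differentiableOn_half hg) (convex_halfSpace_re_gt 0).isPreconnected (z₀ := 2) (by simp) ?_ hs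
  have : {s : ℂ | 1 < s.re} ∈ nhds (2 : ℂ) :=
    (isOpen_lt continuous_const Complex.continuous_re).mem_nhds (by simp)
  filter_upwards [this] with z hz using h z hz

lemma LFunction_formula {q : ℕ} [NeZero q] {χ : DirichletCharacter ℂ q} (hχ : χ ≠ 1) {N : ℕ} (hN : 1 ≤ N)
    {s : ℂ} (hs : 0 < s.re) :
    χ.LFunction s = ∑ n ∈ Finset.range N, χ ((n + 1 : ℕ) : ZMod q) * ((n + 1 : ℕ) : ℂ) ^ (-s) +
      ∑' n, tailT (fun n => χ (n : ZMod q)) N s n := by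
  refine eqOn_half (g := fun s => ∑ n ∈ Finset.range N, χ ((n + 1 : ℕ) : ZMod q) * ((n + 1 : ℕ) : ℂ) ^ (-s) +
      ∑' n, tailT (fun n => χ (n : ZMod q)) N s n) (DirichletCharacter.differentiable_LFunction hχ).differentiableOn ?_ ?_ s hs
  all_goals clear hs s
  · refine DifferentiableOn.add ?_ (tail_differentiableOn hN (PS_char_le hχ N))
    refine DifferentiableOn.fun_sum fun n _ => Differentiable.differentiableOn ?_
    intro s
    refine DifferentiableAt.const_mul ?_ _
    exact (differentiableAt_id.neg).const_cpow (Or.inl (by norm_cast))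
  · intro s hs
    rw [DirichletCharacter.LFunction_eq_LSeries χ hs]
    have h1 := (χ.LSeriesSummable_of_one_lt_re hs).hasSum.tendsto_sum_nat
    have h2 := (tail_hasSum hN (PS_char_le hχ N) (s := s) (by linarith)).const_add
      (∑ n ∈ Finset.range N, χ ((n + 1 : ℕ) : ZMod q) * ((n + 1 : ℕ) : ℂ) ^ (-s))
    refine tendsto_nhds_unique (h1.comp (tendsto_add_atTop_nat (N + 1))) (h2.congr ?_)
    intro M
    simp only [Function.comp]
    rw [show M + (N + 1) = (N + 1) + M by ring, Finset.sum_range_add, Finset.sum_range_succ']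
    simp only [LSeries.term_zero, add_zero]
    congr 1
    · refine Finset.sum_congr rfl fun n _ => ?_
      rw [LSeries.term_of_ne_zero (by omega), Complex.cpow_neg, div_eq_mul_inv]
    · refine Finset.sum_congr rfl fun n _ => ?_
      rw [LSeries.term_of_ne_zero (by omega), Complex.cpow_neg, div_eq_mul_inv]

lemma tail_aux {N : ℕ} (hN : 2 ≤ Real.log N) {s : ℂ} (h1 : 1 - 1 / Real.log N ≤ s.re) (h3 : s.re ≤ 3)
    {Q : ℝ} (hQ : 0 ≤ Q) (hq : Q * (|s.im| + 3) ≤ N) :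
    0 < s.re ∧ Q * ‖s‖ * ((N : ℝ) ^ (-s.re) / s.re) ≤ 6 := by
  have hNpos : (0 : ℝ) < N := by
    rcases Nat.eq_zero_or_pos N with h | h
    · subst h; simp at hN; linarith
    · exact_mod_cast h
  have hN1 : (1 : ℝ) ≤ N := by
    have : 0 < N := by exact_mod_cast hNpos
    exact_mod_cast this
  have hre : 1 / 2 ≤ s.re := by
    have : 1 / Real.log N ≤ 1 / 2 := by gcongr
    linarith
  refine ⟨by linarith, ?_⟩
  have hns : ‖s‖ ≤ |s.im| + 3 := by
    have := Complex.norm_le_abs_re_add_abs_im s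
    rw [abs_of_pos (by linarith : 0 < s.re)] at this
    linarith
  have h4 := rpow_one_sub_le hN h1 (m := N) hN1 le_rfl
  have e : (N : ℝ) ^ (1 - s.re) = N * (N : ℝ) ^ (-s.re) := by
    rw [sub_eq_add_neg, Real.rpow_add hNpos, Real.rpow_one]
  rw [e] at h4
  have h5 : Q * ‖s‖ ≤ N := (mul_le_mul_of_nonneg_left hns hQ).trans hq
  rw [← mul_div_assoc, div_le_iff₀ (by linarith)]
  have : 0 ≤ (N : ℝ) ^ (-s.re) := by positivity
  nlinarith

lemma LFunction_bound {q : ℕ} [NeZero q] {χ : DirichletCharacter ℂ q} (hχ : χ ≠ 1) {N : ℕ}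
    (hN : 2 ≤ Real.log N) {s : ℂ} (h1 : 1 - 1 / Real.log N ≤ s.re) (h3 : s.re ≤ 3)
    (hq : (q : ℝ) * (|s.im| + 3) ≤ N) : ‖χ.LFunction s‖ ≤ 20 * Real.log N := by
  obtain ⟨hs, h2⟩ := tail_aux hN h1 h3 (by positivity) hq
  have hN1 : 1 ≤ N := by
    rcases Nat.eq_zero_or_pos N with h | h
    · subst h; simp at hN; linarith
    · exact h
  rw [LFunction_formula hχ hN1 hs]
  refine (norm_add_le _ _).trans ?_
  have h4 := head_bound hN h1 (fun n => χ (n : ZMod q)) (fun n => χ.norm_le_one _)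
  have h5 := tail_tsum_bound hN1 (PS_char_le hχ N) hs
  linarith

/-! zeta -/

noncomputable def hz (N : ℕ) (s : ℂ) (n : ℕ) : ℂ :=
  (s - 1) * ((N + 1 + n : ℕ) : ℂ) ^ (-s) + (((N + 1 + n + 1 : ℕ) : ℂ) ^ (1 - s) - ((N + 1 + n : ℕ) : ℂ) ^ (1 - s))

lemma hz_bound (N : ℕ) {s : ℂ} (hs : 0 < s.re) (n : ℕ) :
    ‖hz N s n‖ ≤ ‖s - 1‖ * ‖s‖ * ((N + 1 + n : ℕ) : ℝ) ^ (-s.re - 1) := by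
  by_cases hs1 : s = 1
  · subst hs1; simp [hz]
  obtain ⟨m, hmd⟩ : ∃ m : ℕ, m = N + 1 + n := ⟨_, rfl⟩
  unfold hz
  rw [← hmd]
  have hm : 1 ≤ m := by omega
  have hm' : (1 : ℝ) ≤ m := by exact_mod_cast hm
  have key := Convex.norm_image_sub_le_of_norm_hasDerivWithin_le (𝕜 := ℝ)
    (f := fun u : ℝ => (u : ℂ) ^ (1 - s) - (1 - s) * (m : ℂ) ^ (-s) * u)
    (f' := fun u : ℝ => (1 - s) * ((u : ℂ) ^ (-s) - (m : ℂ) ^ (-s)))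
    (s := Set.Icc (m : ℝ) (m + 1)) (C := ‖s - 1‖ * ‖s‖ * (m : ℝ) ^ (-s.re - 1)) (x := m) (y := m + 1) ?_ ?_
    (convex_Icc _ _) ⟨le_rfl, by linarith⟩ ⟨by linarith, le_rfl⟩
  · simp only [add_sub_cancel_left, norm_one, mul_one] at key
    refine le_trans (le_of_eq ?_) key
    apply congrArg
    push_cast
    ring
  · intro v hv
    have hv0 : 0 < v := by linarith [hv.1]
    refine HasDerivAt.hasDerivWithinAt ?_
    have d1 := hasDerivAt_ofReal_cpow_const hv0.ne' (r := 1 - s) (sub_ne_zero.mpr (Ne.symm hs1))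
    have d2 := ((hasDerivAt_id v).ofReal_comp).const_mul ((1 - s) * (m : ℂ) ^ (-s))
    refine (d1.sub d2).congr_deriv ?_
    rw [show 1 - s - 1 = -s by ring]
    simp; ring
  · intro v hv
    rw [norm_mul, norm_sub_rev, mul_assoc]
    gcongr
    exact cpow_diff_bound hm hs v hv

lemma hz_diff {N : ℕ} (hN : 1 ≤ N) :
    DifferentiableOn ℂ (fun s => ∑' n, hz N s n) {s : ℂ | 0 < s.re} := by
  intro s0 hs0
  have hs0' : 0 < s0.re := hs0
  set U : Set ℂ := {s : ℂ | s0.re / 2 < s.re} ∩ Metric.ball 0 (‖s0‖ + 1)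
  have hU : IsOpen U := (isOpen_lt continuous_const Complex.continuous_re).inter Metric.isOpen_ball
  have hmem : s0 ∈ U := ⟨by simp; linarith, by simp⟩
  have key : DifferentiableOn ℂ (fun s => ∑' n, hz N s n) U := by
    apply Complex.differentiableOn_tsum_of_summable_norm
      (u := fun n : ℕ => (‖s0‖ + 2) * (‖s0‖ + 1) * ((N + 1 + n : ℕ) : ℝ) ^ (-(s0.re/2) - 1))
    · exact (tail_rpow N hN (by linarith : 0 < s0.re/2)).1.mul_left _
    · intro n
      unfold hz
      have h1 : ((N + 1 + n : ℕ) : ℂ) ≠ 0 := by norm_cast; omega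
      have h2 : ((N + 1 + n + 1 : ℕ) : ℂ) ≠ 0 := by norm_cast
      refine Differentiable.differentiableOn ?_
      intro s
      refine DifferentiableAt.add (DifferentiableAt.mul (by fun_prop) ?_) (DifferentiableAt.sub ?_ ?_)
      · exact (differentiableAt_id.neg).const_cpow (Or.inl h1)
      · exact (differentiableAt_id.const_sub 1).const_cpow (Or.inl h2)
      · exact (differentiableAt_id.const_sub 1).const_cpow (Or.inl h1)
    · exact hU
    · intro n s hs
      have h1 : s0.re / 2 < s.re := hs.1
      have h2 : ‖s‖ < ‖s0‖ + 1 := by simpa using hs.2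
      have h4 : ‖s - 1‖ ≤ ‖s0‖ + 2 := by
        refine (norm_sub_le _ _).trans ?_
        simp; linarith
      refine (hz_bound N (by linarith) n).trans ?_
      have h3 : (1 : ℝ) ≤ ((N + 1 + n : ℕ) : ℝ) := by norm_cast; omega
      gcongr
  exact (key.differentiableAt (hU.mem_nhds hmem)).differentiableWithinAt

lemma zeta_formula {N : ℕ} (hN : 1 ≤ N) {s : ℂ} (hs : 0 < s.re) :
    riemannZeta₁ s = (s - 1) * ∑ n ∈ Finset.range N, ((n + 1 : ℕ) : ℂ) ^ (-s) + ((N + 1 : ℕ) : ℂ) ^ (1 - s) +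
      ∑' n, hz N s n := by
  refine eqOn_half (g := fun s => (s - 1) * ∑ n ∈ Finset.range N, ((n + 1 : ℕ) : ℂ) ^ (-s) + ((N + 1 : ℕ) : ℂ) ^ (1 - s) +
      ∑' n, hz N s n) differentiable_riemannZeta₁.differentiableOn ?_ ?_ s hs
  all_goals clear hs s
  · refine DifferentiableOn.add ?_ (hz_diff hN)
    refine Differentiable.differentiableOn ?_
    intro s
    refine DifferentiableAt.add (DifferentiableAt.mul (by fun_prop) ?_) ?_
    · refine DifferentiableAt.fun_sum fun n _ => ?_
      exact (differentiableAt_id.neg).const_cpow (Or.inl (by norm_cast))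
    · exact (differentiableAt_id.const_sub 1).const_cpow (Or.inl (by norm_cast))
  · intro s hs
    have hs1 : s ≠ 1 := by intro h; rw [h] at hs; simp at hs
    have hz1 : riemannZeta₁ s = (s - 1) * riemannZeta s := by
      rw [riemannZeta_eq_inv_sub_mul hs1]
      field_simp [sub_ne_zero.mpr hs1]
    have hsum : Summable (hz N s) :=
      Summable.of_norm_bounded ((tail_rpow N hN (by linarith : 0 < s.re)).1.mul_left _) (hz_bound N (by linarith))
    have h1 := (LSeriesSummable_one_iff.mpr hs).hasSum.tendsto_sum_nat
    have h1' : Tendsto (fun M => (s - 1) * ∑ n ∈ Finset.range (M + (N + 1)), LSeries.term 1 s n) atTop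
        (nhds ((s - 1) * riemannZeta s)) := by
      refine Tendsto.const_mul _ ?_
      rw [← LSeries_one_eq_riemannZeta hs]
      exact h1.comp (tendsto_add_atTop_nat (N + 1))
    have h0 : Tendsto (fun M : ℕ => ((N + 1 + M : ℕ) : ℂ) ^ (1 - s)) atTop (nhds 0) := by
      rw [tendsto_zero_iff_norm_tendsto_zero]
      have : Tendsto (fun M : ℕ => ((N + 1 + M : ℕ) : ℝ) ^ (-(s.re - 1))) atTop (nhds 0) := by
        refine (tendsto_rpow_neg_atTop (by linarith)).comp (tendsto_natCast_atTop_atTop.comp ?_)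
        exact tendsto_atTop_mono (fun n => (by omega : n ≤ N + 1 + n)) tendsto_id
      refine this.congr fun M => ?_
      rw [Complex.norm_natCast_cpow_of_pos (by omega)]
      congr 1; simp
    have h2 := (hsum.hasSum.tendsto_sum_nat.sub h0).const_add
      ((s - 1) * ∑ n ∈ Finset.range N, ((n + 1 : ℕ) : ℂ) ^ (-s) + ((N + 1 : ℕ) : ℂ) ^ (1 - s))
    rw [hz1]
    rw [sub_zero] at h2
    refine tendsto_nhds_unique h1' (h2.congr ?_)
    intro M
    have tel : ∑ k ∈ Finset.range M, hz N s k = (s - 1) * ∑ k ∈ Finset.range M, ((N + 1 + k : ℕ) : ℂ) ^ (-s) +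
        (((N + 1 + M : ℕ) : ℂ) ^ (1 - s) - ((N + 1 : ℕ) : ℂ) ^ (1 - s)) := by
      unfold hz
      rw [Finset.sum_add_distrib, Finset.mul_sum]
      congr 1
      exact Finset.sum_range_sub (fun k => ((N + 1 + k : ℕ) : ℂ) ^ (1 - s)) M
    rw [show M + (N + 1) = (N + 1) + M by ring, Finset.sum_range_add, Finset.sum_range_succ', tel]
    simp only [LSeries.term_zero, add_zero]
    have e1 : ∑ k ∈ Finset.range N, LSeries.term 1 s (k + 1) = ∑ n ∈ Finset.range N, ((n + 1 : ℕ) : ℂ) ^ (-s) := by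
      refine Finset.sum_congr rfl fun n _ => ?_
      rw [LSeries.term_of_ne_zero (by omega), Complex.cpow_neg]; simp
    have e2 : ∑ k ∈ Finset.range M, LSeries.term 1 s (N + 1 + k) = ∑ k ∈ Finset.range M, ((N + 1 + k : ℕ) : ℂ) ^ (-s) := by
      refine Finset.sum_congr rfl fun n _ => ?_
      rw [LSeries.term_of_ne_zero (by omega), Complex.cpow_neg]; simp
    rw [e1, e2]
    ring

lemma zeta₁_bound {N : ℕ} (hN : 2 ≤ Real.log N) {s : ℂ} (h1 : 1 - 1 / Real.log N ≤ s.re) (h3 : s.re ≤ 3)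
    (hq : |s.im| + 3 ≤ N) : ‖riemannZeta₁ s‖ ≤ ‖s - 1‖ * (8 * Real.log N) + 9 := by
  obtain ⟨hs, h2⟩ := tail_aux hN h1 h3 (Q := 1) (by positivity) (by simpa using hq)
  have hN1 : 1 ≤ N := by
    rcases Nat.eq_zero_or_pos N with h | h
    · subst h; simp at hN; linarith
    · exact h
  have hN1' : (1 : ℝ) ≤ N := by exact_mod_cast hN1
  rw [zeta_formula hN1 hs]
  have h4 := head_bound hN h1 (fun n => 1) (fun n => by simp)
  simp only [one_mul] at h4
  have h5 : ‖∑' n, hz N s n‖ ≤ ‖s - 1‖ * 6 := by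
    obtain ⟨g1, g2⟩ := tail_rpow N hN1 hs
    refine (tsum_of_norm_bounded (g1.mul_left (‖s - 1‖ * ‖s‖)).hasSum (hz_bound N hs)).trans ?_
    rw [tsum_mul_left, mul_assoc]
    gcongr
    refine le_trans ?_ h2
    rw [one_mul]
    gcongr
  have h6 : ‖((N + 1 : ℕ) : ℂ) ^ (1 - s)‖ ≤ 9 := by
    rw [Complex.norm_natCast_cpow_of_pos (by omega)]
    simp only [Complex.sub_re, Complex.one_re]
    have a1 := rpow_one_sub_le hN h1 (m := N) hN1' le_rfl
    rcases le_or_gt 0 (1 - s.re) with h | h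
    · have hl : (2 : ℝ) ≤ N := by
        by_contra hcon
        push Not at hcon
        have : Real.log N ≤ Real.log 2 := Real.log_le_log (by linarith) hcon.le
        have := Real.log_two_lt_d9
        linarith
      calc ((N + 1 : ℕ) : ℝ) ^ (1 - s.re) ≤ ((N : ℝ) * N) ^ (1 - s.re) := by
            apply Real.rpow_le_rpow (by positivity) _ h
            push_cast; nlinarith
        _ = (N : ℝ) ^ (1 - s.re) * (N : ℝ) ^ (1 - s.re) := Real.mul_rpow (by positivity) (by positivity)
        _ ≤ 3 * 3 := by gcongr
        _ = 9 := by norm_num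
    · have : ((N + 1 : ℕ) : ℝ) ^ (1 - s.re) ≤ 1 :=
        Real.rpow_le_one_of_one_le_of_nonpos (by norm_cast; omega) h.le
      linarith
  calc _ ≤ ‖(s - 1) * ∑ n ∈ Finset.range N, ((n + 1 : ℕ) : ℂ) ^ (-s)‖ + ‖((N + 1 : ℕ) : ℂ) ^ (1 - s)‖ + ‖∑' n, hz N s n‖ :=
        norm_add₃_le
    _ ≤ ‖s - 1‖ * (3 * (1 + Real.log N)) + 9 + ‖s - 1‖ * 6 := by
        rw [norm_mul]; gcongr
    _ ≤ _ := by nlinarith [norm_nonneg (s - 1)]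

end TA

namespace TA

noncomputable def el (q : ℕ) (t : ℝ) : ℝ := Real.log (q * (|t| + 9))

lemma two_le_el {q : ℕ} (hq : 1 ≤ q) (t : ℝ) : 2 ≤ el q t := by
  unfold el
  have hq' : (1 : ℝ) ≤ q := by exact_mod_cast hq
  rw [Real.le_log_iff_exp_le (by positivity)]
  have h1 : Real.exp 2 ≤ 9 := by
    have := Real.exp_one_lt_d9
    rw [show (2 : ℝ) = 1 + 1 by norm_num, Real.exp_add]
    nlinarith [Real.exp_pos 1]
  nlinarith [abs_nonneg t]

lemma el_two_mul {q : ℕ} (hq : 1 ≤ q) (t : ℝ) : el q (2 * t) ≤ 2 * el q t := by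
  have h2 := two_le_el hq t
  have hq' : (1 : ℝ) ≤ q := by exact_mod_cast hq
  have h3 : el q (2 * t) ≤ Real.log (2 * (q * (|t| + 9))) := by
    unfold el
    apply Real.log_le_log (by positivity)
    rw [abs_mul, abs_two]; nlinarith [abs_nonneg t]
  rw [Real.log_mul (by norm_num) (by positivity)] at h3
  have := Real.log_two_lt_d9
  unfold el at *
  linarith

lemma el_mono {q r : ℕ} (hq : 1 ≤ q) (h : q ≤ r) (t : ℝ) : el q t ≤ el r t := by
  unfold el
  have hq' : (1 : ℝ) ≤ q := by exact_mod_cast hq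
  have h' : (q : ℝ) ≤ r := by exact_mod_cast h
  apply Real.log_le_log (by positivity)
  gcongr

lemma exists_N {q : ℕ} (hq : 1 ≤ q) (t : ℝ) : ∃ N : ℕ, 2 ≤ Real.log N ∧ Real.log N ≤ el q t ∧ (q : ℝ) * (|t| + 4) ≤ N := by
  have hq' : (1 : ℝ) ≤ q := by exact_mod_cast hq
  have hp : 0 ≤ (q : ℝ) * (|t| + 8) := by positivity
  have h1 := Nat.le_ceil ((q : ℝ) * (|t| + 8))
  have h2 := Nat.ceil_lt_add_one hp
  refine ⟨⌈(q : ℝ) * (|t| + 8)⌉₊, ?_, ?_, ?_⟩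
  · have h8 : (8 : ℝ) ≤ (⌈(q : ℝ) * (|t| + 8)⌉₊ : ℝ) := by nlinarith [abs_nonneg t]
    have h3 : Real.log 8 ≤ Real.log (⌈(q : ℝ) * (|t| + 8)⌉₊ : ℝ) := Real.log_le_log (by norm_num) h8
    have h4 : Real.log 8 = 3 * Real.log 2 := by
      rw [show (8 : ℝ) = 2 ^ (3 : ℕ) by norm_num, Real.log_pow]; norm_num
    have := Real.log_two_gt_d9
    linarith
  · unfold el
    apply Real.log_le_log
    · nlinarith [abs_nonneg t]
    · nlinarith [abs_nonneg t]
  · nlinarith [abs_nonneg t]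

lemma L_bound {q : ℕ} [NeZero q] {χ : DirichletCharacter ℂ q} (hχ : χ ≠ 1) {t : ℝ} {s : ℂ}
    (h1 : 1 - 1 / el q t ≤ s.re) (h3 : s.re ≤ 3) (ht : |s.im| ≤ |t| + 1) :
    ‖DirichletCharacter.LFunction χ s‖ ≤ 20 * el q t := by
  have hq : 1 ≤ q := NeZero.pos q
  obtain ⟨N, a1, a2, a3⟩ := exists_N hq t
  have h5 : 1 / el q t ≤ 1 / Real.log N := one_div_le_one_div_of_le (by linarith) a2
  have := LFunction_bound hχ a1 (s := s) (by linarith) h3 (le_trans (mul_le_mul_of_nonneg_left (by linarith) (by positivity)) a3)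
  linarith

lemma Z1_bound {t : ℝ} {s : ℂ}
    (h1 : 1 - 1 / el 1 t ≤ s.re) (h3 : s.re ≤ 3) (ht : |s.im| ≤ |t| + 1) :
    ‖riemannZeta₁ s‖ ≤ ‖s - 1‖ * (8 * el 1 t) + 9 := by
  obtain ⟨N, a1, a2, a3⟩ := exists_N le_rfl t
  have h5 : 1 / el 1 t ≤ 1 / Real.log N := one_div_le_one_div_of_le (by linarith) a2
  have := zeta₁_bound a1 (s := s) (by linarith) h3 (le_trans (by push_cast; linarith) a3)
  refine this.trans ?_
  gcongr

lemma Z_bound {t : ℝ} {s : ℂ} (hs : s ≠ 1)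
    (h1 : 1 - 1 / el 1 t ≤ s.re) (h3 : s.re ≤ 3) (ht : |s.im| ≤ |t| + 1) :
    ‖riemannZeta s‖ ≤ 8 * el 1 t + 9 / ‖s - 1‖ := by
  have h0 : 0 < ‖s - 1‖ := norm_pos_iff.mpr (sub_ne_zero.mpr hs)
  rw [riemannZeta_eq_inv_sub_mul hs, norm_mul, norm_inv]
  calc _ ≤ ‖s - 1‖⁻¹ * (‖s - 1‖ * (8 * el 1 t) + 9) := by gcongr; exact Z1_bound h1 h3 ht
    _ = _ := by field_simp

lemma im_le_norm_sub_one (s : ℂ) : |s.im| ≤ ‖s - 1‖ := by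
  have := Complex.abs_im_le_norm (s - 1)
  simpa using this

lemma Z_bound' {t : ℝ} {s : ℂ} (hs : 1/2 ≤ |s.im|)
    (h1 : 1 - 1 / el 1 t ≤ s.re) (h3 : s.re ≤ 3) (ht : |s.im| ≤ |t| + 1) :
    ‖riemannZeta s‖ ≤ 20 * el 1 t := by
  have hs1 : s ≠ 1 := by rintro rfl; simp at hs; linarith
  have h2 := two_le_el le_rfl t
  have h4 : 1 / 2 ≤ ‖s - 1‖ := hs.trans (im_le_norm_sub_one s)
  have h5 : 9 / ‖s - 1‖ ≤ 18 := by rw [div_le_iff₀ (by linarith)]; linarith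
  have := Z_bound hs1 h1 h3 ht
  linarith

/-- Cauchy: derivative bound -/
lemma deriv_bound_of {f : ℂ → ℂ} {s : ℂ} {E : ℝ} (hE : 0 < E) (hf : ∀ z ∈ Metric.closedBall s (1 / (2 * E)), DifferentiableAt ℂ f z)
    (hb : ∀ z ∈ Metric.closedBall s (1 / (2 * E)), ‖f z‖ ≤ 20 * E) : ‖deriv f s‖ ≤ 40 * E ^ 2 := by
  have hr : 0 < 1 / (2 * E) := by positivity
  have hd : DiffContOnCl ℂ f (Metric.ball s (1 / (2 * E))) := by
    apply DifferentiableOn.diffContOnCl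
    rw [closure_ball _ hr.ne']
    intro z hz
    exact (hf z hz).differentiableWithinAt
  have := Complex.norm_deriv_le_of_forall_mem_sphere_norm_le hr hd
    (fun z hz => hb z (Metric.sphere_subset_closedBall hz))
  refine this.trans (le_of_eq ?_)
  field_simp; ring

lemma ball_facts {s z : ℂ} {E : ℝ} (hE : 2 ≤ E) (hz : z ∈ Metric.closedBall s (1 / (2 * E))) :
    |z.re - s.re| ≤ 1 / (2 * E) ∧ |z.im - s.im| ≤ 1 / (2 * E) ∧ 1 / (2 * E) ≤ 1 / 4 := by
  rw [Metric.mem_closedBall, dist_eq_norm] at hz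
  refine ⟨?_, ?_, ?_⟩
  · have := Complex.abs_re_le_norm (z - s); simp at this; linarith
  · have := Complex.abs_im_le_norm (z - s); simp at this; linarith
  · exact one_div_le_one_div_of_le (by norm_num) (by linarith)

lemma L_deriv {q : ℕ} [NeZero q] {χ : DirichletCharacter ℂ q} (hχ : χ ≠ 1) {t : ℝ} {s : ℂ}
    (h1 : 1 - 1 / (2 * el q t) ≤ s.re) (h3 : s.re ≤ 5/2) (ht : |s.im| ≤ |t| + 1/2) :
    ‖deriv (DirichletCharacter.LFunction χ) s‖ ≤ 40 * el q t ^ 2 := by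
  have hE := two_le_el (NeZero.pos q : 1 ≤ q) t
  refine deriv_bound_of (by linarith) (fun z _ => DirichletCharacter.differentiable_LFunction hχ z) ?_
  intro z hz
  obtain ⟨b1, b2, b3⟩ := ball_facts hE hz
  have e : 1 / el q t = 1 / (2 * el q t) + 1 / (2 * el q t) := by field_simp; norm_num
  have := abs_le.mp b1
  apply L_bound hχ
  · linarith
  · linarith
  · have := abs_sub_abs_le_abs_sub z.im s.im
    linarith

lemma Z_deriv {t : ℝ} {s : ℂ} (hs : 3/4 ≤ |s.im|)
    (h1 : 1 - 1 / (2 * el 1 t) ≤ s.re) (h3 : s.re ≤ 5/2) (ht : |s.im| ≤ |t| + 1/2) :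
    ‖deriv riemannZeta s‖ ≤ 40 * el 1 t ^ 2 := by
  have hE := two_le_el le_rfl t
  have him : ∀ z ∈ Metric.closedBall s (1 / (2 * el 1 t)), 1/2 ≤ |z.im| := by
    intro z hz
    obtain ⟨b1, b2, b3⟩ := ball_facts hE hz
    have := abs_sub_abs_le_abs_sub s.im z.im
    rw [abs_sub_comm] at this
    linarith
  refine deriv_bound_of (by linarith) (fun z hz => differentiableAt_riemannZeta ?_) ?_
  · have := him z hz
    rintro rfl; simp at this; linarith
  intro z hz
  obtain ⟨b1, b2, b3⟩ := ball_facts hE hz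
  have e : 1 / el 1 t = 1 / (2 * el 1 t) + 1 / (2 * el 1 t) := by field_simp; norm_num
  have := abs_le.mp b1
  apply Z_bound' (him z hz)
  · linarith
  · linarith
  · have := abs_sub_abs_le_abs_sub z.im s.im
    linarith

/-- trivial bound -/
lemma LSeries_le {f : ℕ → ℂ} (hf : ∀ n, ‖f n‖ ≤ 1) {s : ℂ} (hs : 1 < s.re) :
    ‖LSeries f s‖ ≤ s.re / (s.re - 1) := by
  obtain ⟨g1, g2⟩ := tail_rpow 1 le_rfl (by linarith : 0 < s.re - 1)
  have hb : ∀ n : ℕ, ‖LSeries.term f s (n + 2)‖ ≤ ((1 + 1 + n : ℕ) : ℝ) ^ (-(s.re - 1) - 1) := by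
    intro n
    rw [LSeries.norm_term_eq, if_neg (by omega), show -(s.re - 1) - 1 = -s.re by ring,
      Real.rpow_neg (by positivity), div_eq_mul_inv, show 1 + 1 + n = n + 2 by ring]
    refine mul_le_of_le_one_left (by positivity) (hf _)
  have hsum2 : Summable (fun n => LSeries.term f s (n + 2)) := Summable.of_norm_bounded g1 hb
  have hsum : Summable (LSeries.term f s) := (summable_nat_add_iff 2).mp hsum2
  unfold LSeries
  rw [← hsum.sum_add_tsum_nat_add 2]
  have h2 : ‖∑' n, LSeries.term f s (n + 2)‖ ≤ 1 / (s.re - 1) := by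
    refine (tsum_of_norm_bounded g1.hasSum hb).trans (g2.trans ?_)
    simp
  have h1 : ‖∑ i ∈ Finset.range 2, LSeries.term f s i‖ ≤ 1 := by
    simp [Finset.sum_range_succ, LSeries.term]
    exact hf 1
  refine (norm_add_le _ _).trans ((add_le_add h1 h2).trans (le_of_eq ?_))
  have : s.re - 1 ≠ 0 := by linarith
  field_simp; ring

lemma L_triv {q : ℕ} [NeZero q] (χ : DirichletCharacter ℂ q) {s : ℂ} (hs : 1 < s.re) (hs2 : s.re ≤ 2) :
    ‖DirichletCharacter.LFunction χ s‖ ≤ 2 / (s.re - 1) := by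
  rw [DirichletCharacter.LFunction_eq_LSeries χ hs]
  refine (LSeries_le (fun n => χ.norm_le_one _) hs).trans ?_
  have : 0 < s.re - 1 := by linarith
  gcongr

lemma L_triv_lower {q : ℕ} [NeZero q] (χ : DirichletCharacter ℂ q) {s : ℂ} (hs : 1 < s.re) (hs2 : s.re ≤ 2) :
    (s.re - 1) / 2 ≤ ‖DirichletCharacter.LFunction χ s‖ := by
  rw [DirichletCharacter.LFunction_eq_LSeries χ hs]
  have h := DirichletCharacter.LSeries.mul_mu_eq_one χ hs
  have h1 := congrArg norm h
  rw [norm_mul, norm_one] at h1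
  have h2 : ‖LSeries ((fun n : ℕ => χ n) * fun n => ((ArithmeticFunction.moebius n : ℤ) : ℂ)) s‖ ≤ s.re / (s.re - 1) := by
    apply LSeries_le _ hs
    intro n
    simp only [Pi.mul_apply, norm_mul]
    have a1 := χ.norm_le_one (n : ZMod q)
    have a2 : ‖((ArithmeticFunction.moebius n : ℤ) : ℂ)‖ ≤ 1 := by
      rw [Complex.norm_intCast]
      exact_mod_cast ArithmeticFunction.abs_moebius_le_one
    exact mul_le_one₀ a1 (norm_nonneg _) a2
  have h3 : s.re / (s.re - 1) ≤ 2 / (s.re - 1) := by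
    have : 0 < s.re - 1 := by linarith
    gcongr
  have h4 := h2.trans h3
  have h5 : (1 : ℝ) ≤ ‖LSeries (fun n : ℕ => χ n) s‖ * (2 / (s.re - 1)) := by
    have := mul_le_mul_of_nonneg_left h4 (norm_nonneg (LSeries (fun n : ℕ => χ n) s))
    linarith
  have : 0 < s.re - 1 := by linarith
  have h6 : ‖LSeries (fun n : ℕ => χ n) s‖ * (2 / (s.re - 1)) * ((s.re - 1) / 2) = ‖LSeries (fun n : ℕ => χ n) s‖ := by
    field_simp
  nlinarith

/-- abstract 3-4-1 -/
lemma abstract341 {F : ℝ → ℂ} {M M1 : ℝ} (hM : 1 ≤ M) (hM1 : 1 ≤ M1)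
    (hlip : ∀ a ∈ Set.Ioc (1:ℝ) 2, ∀ b ∈ Set.Ioc (1:ℝ) 2, ‖F a - F b‖ ≤ M1 * |a - b|)
    (h341 : ∀ a ∈ Set.Ioc (1:ℝ) 2, 1 ≤ (2 / (a - 1)) ^ 3 * ‖F a‖ ^ 4 * M) :
    ∀ a ∈ Set.Ioc (1:ℝ) 2, 1 / (128 * M * M1 ^ 3) ≤ ‖F a‖ := by
  intro a ha
  set δ : ℝ := 1 / (128 * M * M1 ^ 4) with hδ
  have hδ0 : 0 < δ := by positivity
  have hδ1 : δ ≤ 1 := by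
    rw [hδ, div_le_one (by positivity)]
    have : 1 ≤ M1 ^ 4 := one_le_pow₀ hM1
    nlinarith
  have key : ∀ b ∈ Set.Ioc (1:ℝ) 2, δ ≤ b - 1 → 2 * δ * M1 ≤ ‖F b‖ := by
    intro b hb hdb
    have h := h341 b hb
    have hb0 : 0 < b - 1 := by linarith [hb.1]
    have h2 : δ ^ 3 ≤ 8 * M * ‖F b‖ ^ 4 := by
      have e : (2 / (b - 1)) ^ 3 * ‖F b‖ ^ 4 * M * (b - 1) ^ 3 = 8 * M * ‖F b‖ ^ 4 := by
        field_simp; ring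
      calc δ ^ 3 ≤ (b - 1) ^ 3 := by gcongr
        _ = 1 * (b - 1) ^ 3 := by ring
        _ ≤ (2 / (b - 1)) ^ 3 * ‖F b‖ ^ 4 * M * (b - 1) ^ 3 := by gcongr
        _ = _ := e
    have h3 : (2 * δ * M1) ^ 4 ≤ ‖F b‖ ^ 4 := by
      have e : 8 * M * (2 * δ * M1) ^ 4 = δ ^ 3 := by
        have : δ * (128 * M * M1 ^ 4) = 1 := by rw [hδ]; field_simp
        calc 8 * M * (2 * δ * M1) ^ 4 = δ ^ 3 * (δ * (128 * M * M1 ^ 4)) := by ring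
          _ = _ := by rw [this, mul_one]
      have : 8 * M * (2 * δ * M1) ^ 4 ≤ 8 * M * ‖F b‖ ^ 4 := by rw [e]; exact h2
      exact le_of_mul_le_mul_left this (by positivity)
    exact le_of_pow_le_pow_left₀ (by norm_num) (norm_nonneg _) h3
  have e : 1 / (128 * M * M1 ^ 3) = δ * M1 := by rw [hδ]; field_simp
  rw [e]
  rcases le_or_gt δ (a - 1) with h | h
  · have := key a ha h
    nlinarith [mul_pos hδ0 (by linarith : 0 < M1)]
  · have hb : (1 + δ) ∈ Set.Ioc (1:ℝ) 2 := ⟨by linarith, by linarith⟩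
    have h1 := key (1 + δ) hb (by linarith)
    have h2 := hlip (1 + δ) hb a ha
    have h3 : |1 + δ - a| ≤ δ := by rw [abs_of_pos (by linarith)]; linarith [ha.1]
    have h4 := norm_sub_norm_le (F (1 + δ)) (F a)
    nlinarith

end TA

namespace TA

lemma gauss_norm {q : ℕ} [Fact q.Prime] {χ : DirichletCharacter ℂ q} (hχ : χ ≠ 1) :
    ‖gaussSum χ (ZMod.stdAddChar (N := q))‖ = Real.sqrt q := by
  have h1 := gaussSum_mul_gaussSum_eq_card hχ (ZMod.isPrimitive_stdAddChar q)
  rw [← star_gaussSum_eq] at h1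
  have h2 := congrArg norm h1
  rw [norm_mul, norm_star, ZMod.card, Complex.norm_natCast] at h2
  rw [← h2, Real.sqrt_mul_self (norm_nonneg _)]

lemma gauss_twist {q : ℕ} [Fact q.Prime] {χ : DirichletCharacter ℂ q} (hχ : χ ≠ 1) (a : ZMod q) :
    ∑ b : ZMod q, χ⁻¹ b * ZMod.stdAddChar (a * b) = χ a * gaussSum χ⁻¹ (ZMod.stdAddChar (N := q)) := by
  by_cases ha : a = 0
  · subst ha
    have : ∑ a : ZMod q, χ⁻¹ a = 0 := MulChar.sum_eq_zero_of_ne_one (by simpa using hχ)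
    simp [this, MulChar.map_zero]
  · have h := gaussSum_mulShift χ⁻¹ (ZMod.stdAddChar (N := q)) (Units.mk0 a ha)
    rw [← h]
    have hh : χ a * χ⁻¹ a = 1 := by
      have : (χ * χ⁻¹) a = 1 := by
        rw [mul_inv_cancel]; exact MulChar.one_apply (IsUnit.mk0 a ha)
      rw [← MulChar.mul_apply]; exact this
    simp only [Units.val_mk0]
    rw [← mul_assoc, hh, one_mul]
    simp [gaussSum, AddChar.mulShift_apply]

lemma sin_lower {x : ℝ} (h0 : 0 < x) (h1 : x < 1) : 1 / Real.sin (π * x) ≤ (1/2) * (1 / x + 1 / (1 - x)) := by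
  have hx1 : 0 < 1 - x := by linarith
  rcases le_total x (1/2) with h | h
  · have := Real.mul_le_sin (x := π * x) (by positivity) (by nlinarith [Real.pi_pos])
    have e : 2 / π * (π * x) = 2 * x := by field_simp
    rw [e] at this
    have h2 : 1 / Real.sin (π * x) ≤ 1 / (2 * x) := one_div_le_one_div_of_le (by linarith) this
    have h3 : 1 / (2 * x) = (1/2) * (1 / x) := by field_simp
    have : 0 < 1 / (1 - x) := by positivity
    linarith
  · have := Real.mul_le_sin (x := π * (1 - x)) (by positivity) (by nlinarith [Real.pi_pos])
    have e : 2 / π * (π * (1 - x)) = 2 * (1 - x) := by field_simp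
    have e2 : Real.sin (π * (1 - x)) = Real.sin (π * x) := by
      rw [show π * (1 - x) = π - π * x by ring, Real.sin_pi_sub]
    rw [e, e2] at this
    have h2 : 1 / Real.sin (π * x) ≤ 1 / (2 * (1 - x)) := one_div_le_one_div_of_le (by linarith) this
    have h3 : 1 / (2 * (1 - x)) = (1/2) * (1 / (1 - x)) := by field_simp
    have : 0 < 1 / x := by positivity
    linarith

lemma geom_bound {q : ℕ} [Fact q.Prime] (j : ℕ) (h0 : 1 ≤ j) (h1 : j < q) (N m : ℕ) :
    ‖∑ k ∈ Finset.range m, ZMod.stdAddChar (((N + 1 + k : ℕ) : ZMod q) * (j : ZMod q))‖ ≤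
      (1/2) * ((q : ℝ) / j + (q : ℝ) / ((q : ℝ) - j)) := by
  have hq : (0 : ℝ) < q := by exact_mod_cast (Fact.out : q.Prime).pos
  have hj : (0 : ℝ) < j := by exact_mod_cast h0
  have hjq : (j : ℝ) < q := by exact_mod_cast h1
  set w : ℂ := ZMod.stdAddChar (j : ZMod q) with hw
  have hw1 : ‖w‖ = 1 := by rw [hw, ZMod.stdAddChar_apply]; exact Circle.norm_coe _
  have hwe : w = Complex.exp (Complex.I * ((2 * π * (j / q) : ℝ) : ℂ)) := by
    have := ZMod.stdAddChar_coe (N := q) (j : ℤ)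
    rw [Int.cast_natCast] at this
    rw [hw, this]
    congr 1; push_cast; ring
  have hs : ‖w - 1‖ = 2 * Real.sin (π * (j / q)) := by
    rw [hwe, Complex.norm_exp_I_mul_ofReal_sub_one, show 2 * π * (j / q : ℝ) / 2 = π * (j / q) by ring, Real.norm_eq_abs, abs_of_nonneg]
    have : 0 ≤ Real.sin (π * (j / q)) := by
      apply Real.sin_nonneg_of_nonneg_of_le_pi (by positivity)
      have : (j / q : ℝ) ≤ 1 := by rw [div_le_one hq]; exact hjq.le
      nlinarith [Real.pi_pos]
    linarith
  have hsl := sin_lower (x := (j / q : ℝ)) (by positivity) (by rw [div_lt_one hq]; exact hjq)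
  have hpos : 0 < Real.sin (π * (j / q)) := by
    apply Real.sin_pos_of_pos_of_lt_pi (by positivity)
    have : (j / q : ℝ) < 1 := by rw [div_lt_one hq]; exact hjq
    nlinarith [Real.pi_pos]
  have e : ∑ k ∈ Finset.range m, ZMod.stdAddChar (((N + 1 + k : ℕ) : ZMod q) * (j : ZMod q)) =
      w ^ (N + 1) * ∑ k ∈ Finset.range m, w ^ k := by
    rw [Finset.mul_sum]
    refine Finset.sum_congr rfl fun k _ => ?_
    rw [← nsmul_eq_mul, AddChar.map_nsmul_eq_pow, pow_add]
  have hne : w ≠ 1 := by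
    intro h; rw [h] at hs; simp at hs; linarith
  rw [e, geom_sum_eq hne, norm_mul, norm_pow, hw1, one_pow, one_mul, norm_div, hs]
  have h3 : ‖w ^ m - 1‖ ≤ 2 := by
    refine (norm_sub_le _ _).trans ?_
    rw [norm_pow, hw1]; norm_num
  calc _ ≤ 2 / (2 * Real.sin (π * (j / q))) := by gcongr
    _ = 1 / Real.sin (π * (j / q)) := by field_simp
    _ ≤ _ := hsl
    _ = _ := by
      have : (q : ℝ) - j ≠ 0 := by linarith
      congr 1
      field_simp

lemma PV {q : ℕ} [Fact q.Prime] {χ : DirichletCharacter ℂ q} (hχ : χ ≠ 1) (N m : ℕ) :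
    ‖PS (fun n => χ (n : ZMod q)) N m‖ ≤ Real.sqrt q * (1 + Real.log q) := by
  have hqp : 1 ≤ q := (Fact.out : q.Prime).one_le
  have hq : (0 : ℝ) < q := by exact_mod_cast hqp
  have hχ' : χ⁻¹ ≠ 1 := by simpa using hχ
  have hg := gauss_norm hχ'
  have e : PS (fun n => χ (n : ZMod q)) N m * gaussSum χ⁻¹ (ZMod.stdAddChar (N := q)) =
      ∑ b : ZMod q, χ⁻¹ b * ∑ k ∈ Finset.range m, ZMod.stdAddChar (((N + 1 + k : ℕ) : ZMod q) * b) := by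
    unfold PS
    rw [Finset.sum_mul]
    simp_rw [← gauss_twist hχ, Finset.mul_sum]
    rw [Finset.sum_comm]
  have e2 : ∑ b : ZMod q, χ⁻¹ b * ∑ k ∈ Finset.range m, ZMod.stdAddChar (((N + 1 + k : ℕ) : ZMod q) * b) =
      ∑ j ∈ Finset.range (q - 1), χ⁻¹ ((j + 1 : ℕ) : ZMod q) * ∑ k ∈ Finset.range m, ZMod.stdAddChar (((N + 1 + k : ℕ) : ZMod q) * ((j + 1 : ℕ) : ZMod q)) := by
    have : ∀ g : ZMod q → ℂ, g 0 = 0 → ∑ b : ZMod q, g b = ∑ j ∈ Finset.range (q - 1), g ((j + 1 : ℕ) : ZMod q) := by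
      intro g hg0
      have h1 : ∑ b : ZMod q, g b = ∑ j ∈ Finset.range q, g (j : ZMod q) := by
        symm
        refine Finset.sum_nbij' (fun k => (k : ZMod q)) (fun a => a.val) ?_ ?_ ?_ ?_ ?_
        · intro a _; exact Finset.mem_univ _
        · intro a _; exact Finset.mem_range.mpr (ZMod.val_lt a)
        · intro a ha; exact ZMod.val_cast_of_lt (Finset.mem_range.mp ha)
        · intro a _; exact ZMod.natCast_zmod_val a
        · intro a _; rfl
      rw [h1]
      have h3 : Finset.range q = Finset.range ((q - 1) + 1) := by congr 1; omega
      rw [h3, Finset.sum_range_succ']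
      simp [hg0]
    apply this
    rw [MulChar.map_zero, zero_mul]
  have hb : ‖PS (fun n => χ (n : ZMod q)) N m * gaussSum χ⁻¹ (ZMod.stdAddChar (N := q))‖ ≤ q * (1 + Real.log q) := by
    rw [e, e2]
    refine (norm_sum_le _ _).trans ?_
    have h1 : ∀ j ∈ Finset.range (q - 1), ‖χ⁻¹ ((j + 1 : ℕ) : ZMod q) * ∑ k ∈ Finset.range m, ZMod.stdAddChar (((N + 1 + k : ℕ) : ZMod q) * ((j + 1 : ℕ) : ZMod q))‖ ≤
        (1/2) * ((q : ℝ) / (j + 1 : ℕ) + (q : ℝ) / ((q : ℝ) - (j + 1 : ℕ))) := by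
      intro j hj
      rw [norm_mul]
      have hj' := Finset.mem_range.mp hj
      refine (mul_le_of_le_one_left (norm_nonneg _) (χ⁻¹.norm_le_one _)).trans ?_
      exact geom_bound (j + 1) (by omega) (by omega) N m
    refine (Finset.sum_le_sum h1).trans ?_
    rw [← Finset.mul_sum, Finset.sum_add_distrib]
    have h2 : ∑ j ∈ Finset.range (q - 1), (q : ℝ) / ((q : ℝ) - (j + 1 : ℕ)) = ∑ j ∈ Finset.range (q - 1), (q : ℝ) / (j + 1 : ℕ) := by
      rw [← Finset.sum_range_reflect]
      refine Finset.sum_congr rfl fun j hj => ?_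
      have hj' := Finset.mem_range.mp hj
      congr 1
      rw [sub_eq_iff_eq_add]
      norm_cast
      omega
    rw [h2]
    have h3 : ∑ j ∈ Finset.range (q - 1), (q : ℝ) / (j + 1 : ℕ) = q * (harmonic (q - 1) : ℝ) := by
      rw [harmonic]; push_cast; rw [Finset.mul_sum]
      rfl
    rw [h3]
    have h4 := harmonic_le_one_add_log (q - 1)
    have h5 : Real.log ((q - 1 : ℕ) : ℝ) ≤ Real.log q := by
      rcases Nat.eq_zero_or_pos (q - 1) with h | h
      · rw [h]; simp; exact Real.log_nonneg (by exact_mod_cast hqp)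
      · apply Real.log_le_log (by exact_mod_cast h)
        exact_mod_cast Nat.sub_le q 1
    nlinarith
  rw [norm_mul, hg] at hb
  have hs : 0 < Real.sqrt q := Real.sqrt_pos.mpr hq
  have hss : Real.sqrt q * Real.sqrt q = q := Real.mul_self_sqrt hq.le
  have : ‖PS (fun n => χ (n : ZMod q)) N m‖ * Real.sqrt q ≤ (Real.sqrt q * (1 + Real.log q)) * Real.sqrt q := by
    have e3 : (Real.sqrt q * (1 + Real.log q)) * Real.sqrt q = q * (1 + Real.log q) := by
      rw [mul_right_comm, hss]
    rw [e3]; exact hb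
  exact le_of_mul_le_mul_right this hs

end TA

namespace TA

lemma abel_antitone {c : ℕ → ℂ} {b : ℕ → ℝ} {Q : ℝ} (hQ : ∀ m, ‖∑ k ∈ Finset.range m, c k‖ ≤ Q)
    (hb : ∀ k, b (k + 1) ≤ b k) (hb0 : ∀ k, 0 ≤ b k) (m : ℕ) :
    ‖∑ k ∈ Finset.range m, c k * (b k : ℂ)‖ ≤ Q * b 0 := by
  have hQ0 : 0 ≤ Q := (norm_nonneg _).trans (hQ 0)
  rcases m with _ | m
  · simp; exact mul_nonneg hQ0 (hb0 0)
  have e : ∀ m, ∑ k ∈ Finset.range (m + 1), c k * (b k : ℂ) = (∑ k ∈ Finset.range (m + 1), c k) * b m +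
      ∑ k ∈ Finset.range m, (∑ i ∈ Finset.range (k + 1), c i) * ((b k - b (k + 1) : ℝ) : ℂ) := by
    intro m
    induction m with
    | zero => simp
    | succ m ih =>
      rw [Finset.sum_range_succ, ih, Finset.sum_range_succ (fun k => (∑ i ∈ Finset.range (k + 1), c i) * ((b k - b (k + 1) : ℝ) : ℂ)) m,
        Finset.sum_range_succ (fun k => c k) (m + 1)]
      push_cast; ring
  rw [e m]
  have h1 : ‖(∑ k ∈ Finset.range (m + 1), c k) * (b m : ℂ)‖ ≤ Q * b m := by
    rw [norm_mul, Complex.norm_real, Real.norm_eq_abs, abs_of_nonneg (hb0 m)]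
    exact mul_le_mul_of_nonneg_right (hQ _) (hb0 m)
  have h2 : ‖∑ k ∈ Finset.range m, (∑ i ∈ Finset.range (k + 1), c i) * ((b k - b (k + 1) : ℝ) : ℂ)‖ ≤ Q * (b 0 - b m) := by
    rw [← Finset.sum_range_sub' b m, Finset.mul_sum]
    refine norm_sum_le_of_le _ fun k _ => ?_
    have : 0 ≤ b k - b (k + 1) := by linarith [hb k]
    rw [norm_mul, Complex.norm_real, Real.norm_eq_abs, abs_of_nonneg this]
    exact mul_le_mul_of_nonneg_right (hQ _) this
  refine (norm_add_le _ _).trans ?_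
  linarith

lemma geom_sq_ge {x : ℝ} (h0 : 0 ≤ x) (d : ℕ) :
    ((d + 1 : ℕ) : ℝ) ^ 2 * x ^ d ≤ (∑ i ∈ Finset.range (d + 1), x ^ i) ^ 2 := by
  have h := Finset.sum_mul_sq_le_sq_mul_sq (Finset.range (d + 1)) (fun i => Real.sqrt (x ^ i)) (fun i => Real.sqrt (x ^ (d - i)))
  have e1 : ∀ i ∈ Finset.range (d + 1), Real.sqrt (x ^ i) * Real.sqrt (x ^ (d - i)) = Real.sqrt (x ^ d) := by
    intro i hi
    have := Finset.mem_range.mp hi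
    rw [← Real.sqrt_mul (by positivity), ← pow_add]
    congr 2; omega
  rw [Finset.sum_congr rfl e1] at h
  simp only [Real.sq_sqrt (pow_nonneg h0 _), Finset.sum_const, Finset.card_range, nsmul_eq_mul, mul_pow] at h
  have e2 : ∑ i ∈ Finset.range (d + 1), x ^ (d - i) = ∑ i ∈ Finset.range (d + 1), x ^ i := by
    rw [← Finset.sum_range_reflect]
    refine Finset.sum_congr rfl fun i hi => ?_
    have := Finset.mem_range.mp hi
    congr 1; omega
  rw [e2, ← sq] at h
  exact h

noncomputable def bL (x : ℝ) (i : ℕ) : ℝ := 1 / (((i + 1 : ℕ) : ℝ) * (1 - x)) - x ^ (i + 1) / (1 - x ^ (i + 1))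

lemma bL_eq {x : ℝ} (h0 : 0 < x) (h1 : x < 1) (i : ℕ) :
    bL x i = (1 / ((i + 1 : ℕ) : ℝ) - x ^ (i + 1) / (∑ j ∈ Finset.range (i + 1), x ^ j)) / (1 - x) := by
  have hx : 1 - x ≠ 0 := by linarith
  have e : 1 - x ^ (i + 1) = (1 - x) * ∑ j ∈ Finset.range (i + 1), x ^ j := by
    rw [mul_comm, geom_sum_mul_neg]
  have hp : 0 < ∑ j ∈ Finset.range (i + 1), x ^ j := Finset.sum_pos (fun _ _ => by positivity) (by simp)
  unfold bL
  rw [e]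
  field_simp

lemma bL_anti {x : ℝ} (h0 : 0 < x) (h1 : x < 1) (i : ℕ) : bL x (i + 1) ≤ bL x i := by
  rw [bL_eq h0 h1, bL_eq h0 h1]
  have hx : 0 < 1 - x := by linarith
  apply div_le_div_of_nonneg_right _ hx.le
  set G := ∑ j ∈ Finset.range (i + 1), x ^ j with hG
  set H := ∑ j ∈ Finset.range (i + 1 + 1), x ^ j with hH
  have hGp : 0 < G := Finset.sum_pos (fun _ _ => by positivity) (by simp)
  have hHp : 0 < H := Finset.sum_pos (fun _ _ => by positivity) (by simp)
  have hHG : H = 1 + x * G := by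
    rw [hH, Finset.sum_range_succ', hG, Finset.mul_sum]
    simp [pow_succ, mul_comm, add_comm]
  have a1 : ((i + 1 : ℕ) : ℝ) ^ 2 * x ^ i ≤ G ^ 2 := geom_sq_ge h0.le i
  have a2 : ((i + 1 + 1 : ℕ) : ℝ) ^ 2 * x ^ (i + 1) ≤ H ^ 2 := geom_sq_ge h0.le (i + 1)
  set n : ℝ := ((i + 1 : ℕ) : ℝ) with hn
  have hn1 : ((i + 1 + 1 : ℕ) : ℝ) = n + 1 := by rw [hn]; push_cast; ring
  have hn0 : 0 < n := by rw [hn]; positivity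
  rw [hn1] at a2 ⊢
  have key : n * (n + 1) * x ^ (i + 1) ≤ G * H := by
    apply le_of_pow_le_pow_left₀ (n := 2) (by norm_num) (by positivity)
    calc (n * (n + 1) * x ^ (i + 1)) ^ 2 = x * ((n ^ 2 * x ^ i) * ((n + 1) ^ 2 * x ^ (i + 1))) := by ring
      _ ≤ 1 * (G ^ 2 * H ^ 2) := by gcongr
      _ = _ := by ring
  have e1 : 1 / n - x ^ (i + 1) / G - (1 / (n + 1) - x ^ (i + 1 + 1) / H) = 1 / (n * (n + 1)) - x ^ (i + 1) * (H - x * G) / (G * H) := by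
    field_simp; ring
  have e2 : H - x * G = 1 := by rw [hHG]; ring
  rw [e2, mul_one] at e1
  have : x ^ (i + 1) / (G * H) ≤ 1 / (n * (n + 1)) := by
    rw [div_le_div_iff₀ (by positivity) (by positivity)]; linarith
  linarith

lemma bL_nonneg {x : ℝ} (h0 : 0 < x) (h1 : x < 1) (i : ℕ) : 0 ≤ bL x i := by
  rw [bL_eq h0 h1]
  have hx : 0 < 1 - x := by linarith
  apply div_nonneg _ hx.le
  have hGp : 0 < ∑ j ∈ Finset.range (i + 1), x ^ j := Finset.sum_pos (fun _ _ => by positivity) (by simp)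
  rw [sub_nonneg, div_le_div_iff₀ hGp (by positivity), one_mul, mul_comm]
  have : ∑ j ∈ Finset.range (i + 1), x ^ (i + 1) ≤ ∑ j ∈ Finset.range (i + 1), x ^ j := by
    refine Finset.sum_le_sum fun j hj => ?_
    exact pow_le_pow_of_le_one h0.le h1.le (by have := Finset.mem_range.mp hj; omega)
  simpa using this

lemma bL_zero {x : ℝ} (h1 : x < 1) : bL x 0 = 1 := by
  have : 1 - x ≠ 0 := by linarith
  unfold bL; simp; field_simp

lemma mult_sum {x : ℝ} (h0 : 0 < x) (h1 : x < 1) {d : ℕ} (hd : 1 ≤ d) (M : ℕ) :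
    x ^ d / (1 - x ^ d) - ∑ n ∈ (Finset.Ioc 0 M).filter (d ∣ ·), x ^ n = x ^ (d * (M / d + 1)) / (1 - x ^ d) := by
  have hxd : 1 - x ^ d ≠ 0 := by
    have : x ^ d < 1 := pow_lt_one₀ h0.le h1 (by omega)
    linarith
  induction M with
  | zero => simp
  | succ M ih =>
    rw [← Finset.insert_Ioc_right_eq_Ioc_add_one (by omega), Finset.filter_insert]
    by_cases hdv : d ∣ M + 1
    · rw [if_pos hdv, Finset.sum_insert (by simp)]
      have e : (M + 1) / d = M / d + 1 := by rw [Nat.succ_div, if_pos hdv]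
      have e2 : d * (M / d + 1) = M + 1 := by rw [← e]; exact Nat.mul_div_cancel' hdv
      rw [e]
      have e3 : x ^ (d * (M / d + 1 + 1)) = x ^ (M + 1) * x ^ d := by
        rw [← pow_add]; congr 1; rw [mul_add, e2]; ring
      rw [e3]
      rw [e2] at ih
      have : x ^ d / (1 - x ^ d) = x ^ (M + 1) / (1 - x ^ d) + ∑ n ∈ (Finset.Ioc 0 M).filter (d ∣ ·), x ^ n := by
        linarith
      rw [this]
      field_simp; ring
    · rw [if_neg hdv, ih, Nat.succ_div, if_neg hdv]

lemma mult_sum_bound {x : ℝ} (h0 : 0 < x) (h1 : x < 1) {d : ℕ} (hd : 1 ≤ d) (M : ℕ) :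
    |x ^ d / (1 - x ^ d) - ∑ n ∈ (Finset.Ioc 0 M).filter (d ∣ ·), x ^ n| ≤ x ^ M / (1 - x) := by
  rw [mult_sum h0 h1 hd]
  have hxd : x ^ d ≤ x := pow_le_of_le_one h0.le h1.le (by omega)
  have hx : 0 < 1 - x := by linarith
  rw [abs_of_nonneg (by apply div_nonneg <;> [positivity; linarith])]
  have : x ^ (d * (M / d + 1)) ≤ x ^ M := by
    apply pow_le_pow_of_le_one h0.le h1.le
    exact (Nat.lt_mul_div_succ M (by omega)).le
  gcongr

lemma zetaMul_apply' {q : ℕ} (χ : DirichletCharacter ℂ q) (n : ℕ) :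
    χ.zetaMul n = ∑ d ∈ n.divisors, χ (d : ZMod q) := by
  rw [DirichletCharacter.zetaMul, ArithmeticFunction.coe_zeta_mul_apply]
  refine Finset.sum_congr rfl fun d hd => ?_
  exact if_neg (Nat.pos_of_mem_divisors hd).ne'

open scoped ComplexOrder in
lemma zetaMul_sq {q : ℕ} {χ : DirichletCharacter ℂ q} (hχ : χ ^ 2 = 1) {m : ℕ} (hm : m ≠ 0) :
    1 ≤ (χ.zetaMul (m ^ 2)) := by
  rw [χ.isMultiplicative_zetaMul.multiplicative_factorization _ (pow_ne_zero 2 hm)]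
  refine Finset.prod_induction _ (fun z : ℂ => 1 ≤ z) (fun a b ha hb => one_le_mul_of_one_le_of_one_le ha hb) le_rfl ?_
  intro p hp
  have hp' := Nat.prime_of_mem_primeFactors hp
  rw [Nat.factorization_pow]
  simp only [Finsupp.smul_apply, smul_eq_mul]
  generalize m.factorization p = k
  rw [zetaMul_apply', Nat.sum_divisors_prime_pow hp']
  simp only [Nat.cast_pow, map_pow]
  rcases MulChar.isQuadratic_iff_sq_eq_one.mpr hχ p with h | h | h
  · simp [h, Finset.sum_range_succ']
  · rw [Finset.sum_range_succ']; simp [h]; positivity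
  · simp only [h, neg_one_geom_sum]
    rw [if_neg (by rw [Nat.not_even_iff_odd]; exact odd_two_mul_add_one k)]

lemma lambert_finite {q : ℕ} (χ : DirichletCharacter ℂ q) {x : ℝ} (h0 : 0 < x) (h1 : x < 1) (M : ℕ) :
    ‖∑ i ∈ Finset.range M, χ ((i + 1 : ℕ) : ZMod q) * ((x ^ (i + 1) / (1 - x ^ (i + 1)) : ℝ) : ℂ) -
      ∑ n ∈ Finset.Ioc 0 M, χ.zetaMul n * ((x ^ n : ℝ) : ℂ)‖ ≤ M * (x ^ M / (1 - x)) := by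
  have e : ∑ n ∈ Finset.Ioc 0 M, χ.zetaMul n * ((x ^ n : ℝ) : ℂ) =
      ∑ d ∈ Finset.Ioc 0 M, χ (d : ZMod q) * ((∑ n ∈ (Finset.Ioc 0 M).filter (d ∣ ·), x ^ n : ℝ) : ℂ) := by
    simp_rw [zetaMul_apply', Finset.sum_mul, Complex.ofReal_sum, Finset.mul_sum]
    apply Finset.sum_comm'
    intro n d
    simp only [Finset.mem_Ioc, Nat.mem_divisors, Finset.mem_filter]
    constructor
    · rintro ⟨⟨a, b⟩, c, _⟩
      exact ⟨⟨⟨a, b⟩, c⟩, Nat.pos_of_dvd_of_pos c a, (Nat.le_of_dvd a c).trans b⟩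
    · rintro ⟨⟨⟨a, b⟩, c⟩, _⟩
      exact ⟨⟨a, b⟩, c, by omega⟩
  have e2 : ∑ d ∈ Finset.Ioc 0 M, χ (d : ZMod q) * ((∑ n ∈ (Finset.Ioc 0 M).filter (d ∣ ·), x ^ n : ℝ) : ℂ) =
     ∑ i ∈ Finset.range M, χ ((i + 1 : ℕ) : ZMod q) * ((∑ n ∈ (Finset.Ioc 0 M).filter ((i + 1) ∣ ·), x ^ n : ℝ) : ℂ) := by
    rw [Finset.range_eq_Ico, Finset.sum_Ico_add' (fun d : ℕ => χ (d : ZMod q) * ((∑ n ∈ (Finset.Ioc 0 M).filter (d ∣ ·), x ^ n : ℝ) : ℂ)) 0 M 1]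
    rfl
  rw [e, e2, ← Finset.sum_sub_distrib]
  calc _ ≤ ∑ i ∈ Finset.range M, (x ^ M / (1 - x)) := by
        refine norm_sum_le_of_le _ fun i _ => ?_
        rw [← mul_sub, norm_mul, ← Complex.ofReal_sub, Complex.norm_real, Real.norm_eq_abs]
        exact (mul_le_of_le_one_left (abs_nonneg _) (χ.norm_le_one _)).trans (mult_sum_bound h0 h1 (by omega) M)
    _ = _ := by simp

lemma L_one_tendsto {q : ℕ} [NeZero q] {χ : DirichletCharacter ℂ q} (hχ : χ ≠ 1) :
    Tendsto (fun M => ∑ i ∈ Finset.range M, χ ((i + 1 : ℕ) : ZMod q) * ((1 / ((i + 1 : ℕ) : ℝ) : ℝ) : ℂ)) atTop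
      (nhds (χ.LFunction 1)) := by
  rw [LFunction_formula hχ le_rfl (by simp : 0 < (1 : ℂ).re)]
  have h := tail_hasSum (N := 1) le_rfl (PS_char_le hχ 1) (by simp : 0 < (1 : ℂ).re)
  rw [← tendsto_add_atTop_iff_nat 1]
  refine (h.const_add _).congr fun M => ?_
  rw [show M + 1 = 1 + M by ring, Finset.sum_range_add]
  congr 1
  · simp
  · refine Finset.sum_congr rfl fun k _ => ?_
    rw [show 1 + k + 1 = 1 + 1 + k by ring, Complex.cpow_neg_one]
    push_cast; simp

open scoped ComplexOrder in
lemma L_one_lower {q : ℕ} [NeZero q] {χ : DirichletCharacter ℂ q} (hχ : χ ≠ 1) (hχ2 : χ ^ 2 = 1) {Q : ℝ} (hQ1 : 1 ≤ Q)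
    (hQ : ∀ m, ‖PS (fun n => χ (n : ZMod q)) 0 m‖ ≤ Q) : 1 / (40 * Q) ≤ ‖χ.LFunction 1‖ := by
  obtain ⟨S, hS1, hS2⟩ : ∃ S : ℕ, 4 * Q ≤ S ∧ (S : ℝ) ≤ 5 * Q :=
    ⟨⌈4 * Q⌉₊, Nat.le_ceil _, (Nat.ceil_lt_add_one (by linarith)).le.trans (by linarith)⟩
  have hS0 : (4 : ℝ) ≤ S := by linarith
  set Y : ℝ := 2 * S ^ 2 with hY
  have hY1 : 32 ≤ Y := by nlinarith
  set x : ℝ := 1 - 1 / Y with hx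
  have hYi : 0 < 1 / Y := by positivity
  have hYi2 : 1 / Y ≤ 1 / 32 := one_div_le_one_div_of_le (by norm_num) hY1
  have h0 : 0 < x := by linarith
  have h1 : x < 1 := by linarith
  have h1x : 1 - x = 1 / Y := by rw [hx]; ring
  have habel : ∀ M, ‖(Y : ℂ) * ∑ i ∈ Finset.range M, χ ((i + 1 : ℕ) : ZMod q) * ((1 / ((i + 1 : ℕ) : ℝ) : ℝ) : ℂ) -
      ∑ i ∈ Finset.range M, χ ((i + 1 : ℕ) : ZMod q) * ((x ^ (i + 1) / (1 - x ^ (i + 1)) : ℝ) : ℂ)‖ ≤ Q := by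
    intro M
    have hQ' : ∀ m, ‖∑ k ∈ Finset.range m, χ ((k + 1 : ℕ) : ZMod q)‖ ≤ Q := by
      intro m
      have := hQ m
      unfold PS at this
      simpa [add_comm] using this
    have := abel_antitone hQ' (bL_anti h0 h1) (bL_nonneg h0 h1) M
    rw [bL_zero h1, mul_one] at this
    refine le_trans (le_of_eq (congrArg _ ?_)) this
    rw [Finset.mul_sum, ← Finset.sum_sub_distrib]
    refine Finset.sum_congr rfl fun i _ => ?_
    unfold bL
    rw [h1x, Complex.ofReal_sub, mul_sub]
    congr 1
    have hYc : (Y : ℂ) ≠ 0 := by exact_mod_cast (by linarith : Y ≠ 0)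
    push_cast
    field_simp
  have hB : ∀ M, S ^ 2 ≤ M → (S : ℝ) / 2 ≤ ‖∑ n ∈ Finset.Ioc 0 M, χ.zetaMul n * ((x ^ n : ℝ) : ℂ)‖ := by
    intro M hM
    refine le_trans ?_ (Complex.re_le_norm _)
    rw [Complex.re_sum]
    have hre : ∀ n, (χ.zetaMul n * ((x ^ n : ℝ) : ℂ)).re = (χ.zetaMul n).re * x ^ n := by
      intro n; rw [Complex.re_mul_ofReal]
    simp_rw [hre]
    have hnn : ∀ n, 0 ≤ (χ.zetaMul n).re := fun n => (Complex.le_def.mp (DirichletCharacter.zetaMul_nonneg hχ2 n)).1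
    have hinj : Set.InjOn (fun m : ℕ => m ^ 2) (Finset.Ioc 0 S : Finset ℕ) := by
      intro a _ b _ h
      exact Nat.pow_left_injective (by norm_num) h
    calc (S : ℝ) / 2 = ∑ m ∈ Finset.Ioc 0 S, (1 / 2 : ℝ) := by simp; ring
      _ ≤ ∑ m ∈ Finset.Ioc 0 S, (χ.zetaMul (m ^ 2)).re * x ^ (m ^ 2) := by
        refine Finset.sum_le_sum fun m hm => ?_
        obtain ⟨hm0, hmS⟩ := Finset.mem_Ioc.mp hm
        have a1 : 1 ≤ (χ.zetaMul (m ^ 2)).re := (Complex.le_def.mp (zetaMul_sq hχ2 (by omega : m ≠ 0))).1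
        have a2 : (1 : ℝ) / 2 ≤ x ^ (m ^ 2) := by
          have := one_add_mul_le_pow (a := -(1 / Y)) (by linarith) (m ^ 2)
          have e : (1 : ℝ) + -(1 / Y) = x := by rw [hx]; ring
          rw [e] at this
          refine le_trans ?_ this
          have hmS' : (m : ℝ) ≤ S := by exact_mod_cast hmS
          have : ((m ^ 2 : ℕ) : ℝ) * (1 / Y) ≤ 1 / 2 := by
            rw [mul_one_div, div_le_iff₀ (by positivity), hY]
            push_cast
            nlinarith
          linarith
        nlinarith
      _ = ∑ n ∈ (Finset.Ioc 0 S).image (fun m => m ^ 2), (χ.zetaMul n).re * x ^ n := by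
        rw [Finset.sum_image hinj]
      _ ≤ _ := by
        apply Finset.sum_le_sum_of_subset_of_nonneg
        · intro n hn
          obtain ⟨m, hm, rfl⟩ := Finset.mem_image.mp hn
          obtain ⟨hm0, hmS⟩ := Finset.mem_Ioc.mp hm
          exact Finset.mem_Ioc.mpr ⟨by positivity, (Nat.pow_le_pow_left hmS 2).trans hM⟩
        · intro n _ _
          exact mul_nonneg (hnn n) (by positivity)
  have hlim : Tendsto (fun M : ℕ => Y * ‖∑ i ∈ Finset.range M, χ ((i + 1 : ℕ) : ZMod q) * ((1 / ((i + 1 : ℕ) : ℝ) : ℝ) : ℂ)‖ +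
      (M : ℝ) * (x ^ M / (1 - x))) atTop (nhds (Y * ‖χ.LFunction 1‖ + 0)) := by
    refine ((L_one_tendsto hχ).norm.const_mul Y).add ?_
    have := (tendsto_self_mul_const_pow_of_lt_one h0.le h1).div_const (1 - x)
    rw [zero_div] at this
    refine this.congr fun M => ?_
    ring
  have hfin : (S : ℝ) / 2 - Q ≤ Y * ‖χ.LFunction 1‖ + 0 := by
    refine ge_of_tendsto hlim ?_
    filter_upwards [eventually_ge_atTop (S ^ 2)] with M hM
    have b1 := habel M
    have b2 := hB M hM
    have b3 := lambert_finite χ h0 h1 M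
    have c1 := norm_sub_norm_le (∑ n ∈ Finset.Ioc 0 M, χ.zetaMul n * ((x ^ n : ℝ) : ℂ)) (∑ i ∈ Finset.range M, χ ((i + 1 : ℕ) : ZMod q) * ((x ^ (i + 1) / (1 - x ^ (i + 1)) : ℝ) : ℂ))
    rw [norm_sub_rev] at c1
    have c2 := norm_sub_norm_le (∑ i ∈ Finset.range M, χ ((i + 1 : ℕ) : ZMod q) * ((x ^ (i + 1) / (1 - x ^ (i + 1)) : ℝ) : ℂ)) ((Y : ℂ) * ∑ i ∈ Finset.range M, χ ((i + 1 : ℕ) : ZMod q) * ((1 / ((i + 1 : ℕ) : ℝ) : ℝ) : ℂ))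
    rw [norm_sub_rev, norm_mul, Complex.norm_real, Real.norm_eq_abs, abs_of_pos (by linarith : 0 < Y)] at c2
    linarith
  have h5 : (S : ℝ) / 4 ≤ Y * ‖χ.LFunction 1‖ := by linarith
  rw [hY] at h5
  have h6 : 1 / (8 * (S : ℝ)) ≤ ‖χ.LFunction 1‖ := by
    rw [div_le_iff₀ (by positivity)]
    have : (S : ℝ) * 1 ≤ S * (‖χ.LFunction 1‖ * (8 * S)) := by nlinarith
    exact le_of_mul_le_mul_left this (by linarith)
  refine le_trans ?_ h6
  apply one_div_le_one_div_of_le (by positivity)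
  linarith

end TA

namespace TA

lemma convex_reProdIm' {s t : Set ℝ} (hs : Convex ℝ s) (ht : Convex ℝ t) : Convex ℝ (s ×ℂ t) := by
  have h1 := hs.linear_preimage Complex.reLm
  have h2 := ht.linear_preimage Complex.imLm
  exact h1.inter h2

lemma L341 {q : ℕ} [NeZero q] (χ : DirichletCharacter ℂ q) (t : ℝ) {a : ℝ} (ha : a ∈ Set.Ioc (1:ℝ) 2) :
    1 ≤ (2 / (a - 1)) ^ 3 * ‖χ.LFunction ⟨a, t⟩‖ ^ 4 * ‖(χ ^ 2).LFunction ⟨a, 2 * t⟩‖ := by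
  have h := DirichletCharacter.norm_LFunction_product_ge_one χ (x := a - 1) (by linarith [ha.1]) t
  have e1 : (1 : ℂ) + ((a - 1 : ℝ) : ℂ) = ⟨a, 0⟩ := by apply Complex.ext <;> simp
  have e2 : (1 : ℂ) + ((a - 1 : ℝ) : ℂ) + Complex.I * t = ⟨a, t⟩ := by apply Complex.ext <;> simp
  have e3 : (1 : ℂ) + ((a - 1 : ℝ) : ℂ) + 2 * Complex.I * t = ⟨a, 2 * t⟩ := by apply Complex.ext <;> simp
  rw [e2, e3, e1, norm_mul, norm_mul, norm_pow, norm_pow] at h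
  refine h.le.trans ?_
  have := L_triv (1 : DirichletCharacter ℂ q) (s := ⟨a, 0⟩) ha.1 ha.2
  simp only at this
  have h0 : 0 < a - 1 := by linarith [ha.1]
  gcongr

lemma L_lip {q : ℕ} [NeZero q] {χ : DirichletCharacter ℂ q} (hχ : χ ≠ 1) {t : ℝ} {s w : ℂ}
    (hs1 : 1 ≤ s.re) (hs2 : s.re ≤ 2) (hs : |s.im| ≤ |t| + 1/2) 
    (hw1 : 1 ≤ w.re) (hw2 : w.re ≤ 2) (hw : |w.im| ≤ |t| + 1/2) :
    ‖χ.LFunction s - χ.LFunction w‖ ≤ 40 * el q t ^ 2 * ‖s - w‖ := by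
  have hE := two_le_el (NeZero.pos q : 1 ≤ q) t
  have hc : Convex ℝ (Set.Icc (1:ℝ) 2 ×ℂ Set.Icc (-(|t| + 1/2)) (|t| + 1/2)) :=
    convex_reProdIm' (convex_Icc _ _) (convex_Icc _ _)
  refine Convex.norm_image_sub_le_of_norm_deriv_le (𝕜 := ℂ) (f := χ.LFunction) (fun z _ => DirichletCharacter.differentiable_LFunction hχ z) ?_ hc ?_ ?_
  · intro z hz
    have hz' := Complex.mem_reProdIm.mp hz
    refine L_deriv hχ ?_ ?_ (abs_le.mpr hz'.2)
    · have : 0 < 1 / (2 * el q t) := by positivity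
      linarith [hz'.1.1]
    · linarith [hz'.1.2]
  · exact Complex.mem_reProdIm.mpr ⟨⟨hw1, hw2⟩, abs_le.mp hw⟩
  · exact Complex.mem_reProdIm.mpr ⟨⟨hs1, hs2⟩, abs_le.mp hs⟩

lemma norm_mk_sub (a b t : ℝ) : ‖(⟨a, t⟩ : ℂ) - ⟨b, t⟩‖ = |a - b| := by
  have : (⟨a, t⟩ : ℂ) - ⟨b, t⟩ = ((a - b : ℝ) : ℂ) := by apply Complex.ext <;> simp
  rw [this, Complex.norm_real, Real.norm_eq_abs]

lemma L_lower_of_M {q : ℕ} [NeZero q] {χ : DirichletCharacter ℂ q} (hχ : χ ≠ 1) (t : ℝ) {M : ℝ} (hM : 1 ≤ M)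
    (h2 : ∀ a ∈ Set.Ioc (1:ℝ) 2, ‖(χ ^ 2).LFunction ⟨a, 2 * t⟩‖ ≤ M) {a : ℝ} (ha : a ∈ Set.Ioc (1:ℝ) 2) :
    1 / (128 * M * (40 * el q t ^ 2) ^ 3) ≤ ‖χ.LFunction ⟨a, t⟩‖ := by
  have hE := two_le_el (NeZero.pos q : 1 ≤ q) t
  refine abstract341 (F := fun a => χ.LFunction ⟨a, t⟩) hM (by nlinarith) ?_ ?_ a ha
  · intro a ha b hb
    have := L_lip hχ (t := t) (s := ⟨a, t⟩) (w := ⟨b, t⟩) ha.1.le ha.2 (by simp) hb.1.le hb.2 (by simp)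
    rwa [norm_mk_sub] at this
  · intro a ha
    refine (L341 χ t ha).trans ?_
    have : 0 < a - 1 := by linarith [ha.1]
    gcongr
    exact h2 a ha

lemma L_lower {q : ℕ} [Fact q.Prime] {χ : DirichletCharacter ℂ q} (hχ : χ ≠ 1) (t : ℝ) {a : ℝ} (ha : a ∈ Set.Ioc (1:ℝ) 2) :
    (1 / (128 * 60000 * 64000)) / (Real.sqrt q * el q t ^ 9) ≤ ‖χ.LFunction ⟨a, t⟩‖ := by
  have hq1 : 1 ≤ q := (Fact.out : q.Prime).one_le
  have hqR : (1 : ℝ) ≤ q := by exact_mod_cast hq1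
  have hE := two_le_el hq1 t
  set E := el q t with hEdef
  have hs : 1 ≤ Real.sqrt q := Real.one_le_sqrt.mpr hqR
  have hE2 : 1 ≤ E ^ 2 := one_le_pow₀ (by linarith)
  have hE6 : 1 ≤ E ^ 6 := one_le_pow₀ (by linarith)
  have hE8 : 1 ≤ E ^ 8 := one_le_pow₀ (by linarith)
  by_cases hχ2 : χ ^ 2 = 1
  swap
  · have h := L_lower_of_M hχ t (M := 40 * E) (by linarith) (fun a ha => by
      have := L_bound hχ2 (t := 2 * t) (s := ⟨a, 2 * t⟩) (by
        have : 0 < 1 / el q (2 * t) := by have := two_le_el hq1 (2*t); positivity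
        linarith [ha.1]) (by linarith [ha.2]) (by simp)
      have h3 := el_two_mul hq1 t
      linarith) ha
    refine le_trans ?_ h
    rw [div_div]
    apply one_div_le_one_div_of_le (by positivity)
    calc 128 * (40 * E) * (40 * E ^ 2) ^ 3 = (128 * 40 * 64000) * (1 * (E ^ 7 * 1)) := by ring
      _ ≤ (128 * 60000 * 64000) * (Real.sqrt q * (E ^ 7 * E ^ 2)) := by gcongr; norm_num
      _ = _ := by ring
  · set η : ℝ := 1 / (6400 * (Real.sqrt q * E ^ 3)) with hη
    have hη0 : 0 < η := by positivity
    have hη1 : η ≤ 1 / 2 := by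
      apply one_div_le_one_div_of_le (by norm_num)
      have : 1 ≤ E ^ 3 := one_le_pow₀ (by linarith)
      nlinarith
    rcases lt_or_ge η |t| with ht | ht
    · have h := L_lower_of_M hχ t (M := 60000 * (Real.sqrt q * E ^ 3)) ?_ ?_ ha
      · refine le_trans (le_of_eq ?_) h
        rw [← hEdef]; field_simp; norm_num
      · have : 1 ≤ E ^ 3 := one_le_pow₀ (by linarith)
        nlinarith
      · intro a ha
        have ht0 : 0 < |t| := by linarith
        have hs1 : (⟨a, 2 * t⟩ : ℂ) ≠ 1 := by
          intro h
          have := congrArg Complex.re h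
          simp at this; linarith [ha.1]
        have e := DirichletCharacter.LFunctionTrivChar_eq_mul_riemannZeta (N := q) hs1
        rw [hχ2]
        change ‖DirichletCharacter.LFunctionTrivChar q ⟨a, 2 * t⟩‖ ≤ _
        rw [e, (Fact.out : q.Prime).primeFactors, Finset.prod_singleton, norm_mul]
        have f1 : ‖1 - (q : ℂ) ^ (-(⟨a, 2 * t⟩ : ℂ))‖ ≤ 2 := by
          refine (norm_sub_le _ _).trans ?_
          rw [norm_one, Complex.norm_natCast_cpow_of_pos (by omega)]
          have : (q : ℝ) ^ (-(⟨a, 2 * t⟩ : ℂ)).re ≤ 1 := Real.rpow_le_one_of_one_le_of_nonpos hqR (by simp; linarith [ha.1])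
          linarith
        have f2 := Z_bound (t := 2 * t) hs1 (by
          have : 0 < 1 / el 1 (2 * t) := by have := two_le_el le_rfl (2*t); positivity
          simp only; linarith [ha.1]) (by simp only; linarith [ha.2]) (by simp)
        have f3 := el_two_mul le_rfl t
        have f4 := el_mono le_rfl hq1 t
        have f5 := im_le_norm_sub_one ⟨a, 2 * t⟩
        simp only [abs_mul, abs_two] at f5
        have f6 : 9 / ‖(⟨a, 2 * t⟩ : ℂ) - 1‖ ≤ 9 / (2 * η) := by gcongr; linarith
        have f7 : 9 / (2 * η) = 28800 * (Real.sqrt q * E ^ 3) := by rw [hη]; field_simp; norm_num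
        have f8 : ‖riemannZeta ⟨a, 2 * t⟩‖ ≤ 16 * E + 28800 * (Real.sqrt q * E ^ 3) := by linarith
        have f9 : E ≤ Real.sqrt q * E ^ 3 := by
          calc E = 1 * (E * 1) := by ring
            _ ≤ Real.sqrt q * (E * E ^ 2) := by gcongr
            _ = _ := by ring
        have f10 := mul_le_mul f1 f8 (norm_nonneg _) (by norm_num)
        linarith
    · rcases le_or_gt (a - 1) η with h | h
      · have hQ := L_one_lower hχ hχ2 (Q := Real.sqrt q * E) (by nlinarith) (fun m => by
          refine (PV hχ 0 m).trans ?_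
          gcongr
          have : (1 : ℝ) ≤ Real.log 9 := by
            rw [Real.le_log_iff_exp_le (by norm_num)]
            have := Real.exp_one_lt_d9
            linarith
          have h2 : Real.log q + Real.log 9 ≤ E := by
            rw [← Real.log_mul (by positivity) (by norm_num), hEdef, el]
            apply Real.log_le_log (by positivity)
            nlinarith [abs_nonneg t]
          linarith)
        have hd := L_lip hχ (t := t) (s := 1) (w := ⟨a, t⟩) (by simp) (by simp) (by simp; positivity) ha.1.le ha.2 (by simp)
        have hn : ‖(1 : ℂ) - ⟨a, t⟩‖ ≤ 2 * η := by
          refine (Complex.norm_le_abs_re_add_abs_im _).trans ?_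
          simp only [Complex.sub_re, Complex.one_re, Complex.sub_im, Complex.one_im, zero_sub, abs_neg]
          rw [abs_sub_comm, abs_of_pos (by linarith [ha.1])]
          linarith
        have hd2 : ‖χ.LFunction 1 - χ.LFunction ⟨a, t⟩‖ ≤ 1 / (80 * (Real.sqrt q * E)) := by
          refine hd.trans ?_
          calc _ ≤ 40 * E ^ 2 * (2 * η) := by gcongr
            _ = _ := by rw [hη]; field_simp; norm_num
        have h3 := norm_sub_norm_le (χ.LFunction 1) (χ.LFunction ⟨a, t⟩)
        have e4 : 1 / (40 * (Real.sqrt q * E)) = 1 / (80 * (Real.sqrt q * E)) + 1 / (80 * (Real.sqrt q * E)) := by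
          field_simp; norm_num
        have h5 : 1 / (80 * (Real.sqrt q * E)) ≤ ‖χ.LFunction ⟨a, t⟩‖ := by linarith
        refine le_trans ?_ h5
        rw [div_div]
        apply one_div_le_one_div_of_le (by positivity)
        calc 80 * (Real.sqrt q * E) = 80 * (Real.sqrt q * (E * 1)) := by ring
          _ ≤ (128 * 60000 * 64000) * (Real.sqrt q * (E * E ^ 8)) := by gcongr; norm_num
          _ = _ := by ring
      · have h2 := L_triv_lower χ (s := ⟨a, t⟩) ha.1 ha.2
        simp only at h2
        refine le_trans ?_ ((by linarith : η / 2 ≤ (a - 1) / 2).trans h2)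
        rw [hη, div_div, div_div]
        apply one_div_le_one_div_of_le (by positivity)
        calc 6400 * (Real.sqrt q * E ^ 3) * 2 = 12800 * (Real.sqrt q * (E ^ 3 * 1)) := by ring
          _ ≤ (128 * 60000 * 64000) * (Real.sqrt q * (E ^ 3 * E ^ 6)) := by gcongr; norm_num
          _ = _ := by ring

lemma Z_lower {t : ℝ} (ht : 1 ≤ |t|) {a : ℝ} (ha : a ∈ Set.Ioc (1:ℝ) 2) :
    (1 / (128 * 60000 * 64000)) / (el 1 t ^ 9) ≤ ‖riemannZeta ⟨a, t⟩‖ := by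
  have hE := two_le_el le_rfl t
  have hc : Convex ℝ (Set.Icc (1:ℝ) 2 ×ℂ ({t} : Set ℝ)) := convex_reProdIm' (convex_Icc _ _) (convex_singleton t)
  have h := abstract341 (F := fun a => riemannZeta ⟨a, t⟩) (M := 40 * el 1 t) (M1 := 40 * el 1 t ^ 2) (by linarith) (by nlinarith) ?_ ?_ a ha
  · refine le_trans ?_ h
    rw [div_div]
    apply one_div_le_one_div_of_le (by positivity)
    have hE2 : 1 ≤ el 1 t ^ 2 := one_le_pow₀ (by linarith)
    calc 128 * (40 * el 1 t) * (40 * el 1 t ^ 2) ^ 3 = (128 * 40 * 64000) * (el 1 t ^ 7 * 1) := by ring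
      _ ≤ (128 * 60000 * 64000) * (el 1 t ^ 7 * el 1 t ^ 2) := by gcongr; norm_num
      _ = _ := by ring
  · intro a ha b hb
    have := Convex.norm_image_sub_le_of_norm_deriv_le (𝕜 := ℂ) (f := riemannZeta) (C := 40 * el 1 t ^ 2) (x := ⟨b, t⟩) (y := ⟨a, t⟩) ?_ ?_ hc ?_ ?_
    · rwa [norm_mk_sub] at this
    · intro z hz
      have hz' := Complex.mem_reProdIm.mp hz
      have : z.im = t := hz'.2
      apply differentiableAt_riemannZeta
      rintro rfl
      simp at this; rw [← this] at ht; simp at ht; linarith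
    · intro z hz
      have hz' := Complex.mem_reProdIm.mp hz
      have him : z.im = t := hz'.2
      apply Z_deriv
      · rw [him]; linarith
      · have : 0 < 1 / (2 * el 1 t) := by positivity
        linarith [hz'.1.1]
      · linarith [hz'.1.2]
      · rw [him]; linarith
    · exact Complex.mem_reProdIm.mpr ⟨⟨hb.1.le, hb.2⟩, rfl⟩
    · exact Complex.mem_reProdIm.mpr ⟨⟨ha.1.le, ha.2⟩, rfl⟩
  · intro a ha
    have h1 := L341 (1 : DirichletCharacter ℂ 1) t ha
    rw [one_pow, DirichletCharacter.LFunction_modOne_eq] at h1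
    refine h1.trans ?_
    have : 0 < a - 1 := by linarith [ha.1]
    gcongr
    have h2 := Z_bound' (t := 2 * t) (s := ⟨a, 2 * t⟩) (by simp only [abs_mul, abs_two]; linarith) (by
      have : 0 < 1 / el 1 (2 * t) := by have := two_le_el le_rfl (2*t); positivity
      simp only; linarith [ha.1]) (by simp only; linarith [ha.2]) (by simp)
    have h3 := el_two_mul le_rfl t
    linarith

end TA

namespace TA

lemma logD {f : ℂ → ℂ} {s0 : ℂ} {v M : ℝ} (hv : 0 < v) (hM : 0 < M) (k : ℕ)
    (hf : ∀ z ∈ Metric.closedBall s0 (v / (2 * M)), AnalyticAt ℂ f z)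
    (hd : ∀ z ∈ Metric.closedBall s0 (v / (2 * M)), ‖deriv f z‖ ≤ M) (h0 : v ≤ ‖f s0‖) :
    ‖iteratedDeriv k (fun z => -deriv f z / f z) s0‖ ≤ k.factorial * (2 * M / v) ^ (k + 1) := by
  have hρ : 0 < v / (2 * M) := by positivity
  have hlow : ∀ z ∈ Metric.closedBall s0 (v / (2 * M)), v / 2 ≤ ‖f z‖ := by
    intro z hz
    have h1 := Convex.norm_image_sub_le_of_norm_deriv_le (𝕜 := ℂ) (f := f) (C := M) (x := s0) (y := z)
      (fun w hw => (hf w hw).differentiableAt) hd (convex_closedBall s0 _) (Metric.mem_closedBall_self hρ.le) hz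
    rw [Metric.mem_closedBall, dist_eq_norm] at hz
    have h2 : M * ‖z - s0‖ ≤ v / 2 := by
      calc M * ‖z - s0‖ ≤ M * (v / (2 * M)) := by gcongr
        _ = v / 2 := by field_simp
    have h3 : ‖f s0‖ ≤ ‖f z‖ + ‖f z - f s0‖ := by
      have := norm_sub_le (f z) (f z - f s0); simpa using this
    linarith
  have han : ∀ z ∈ Metric.closedBall s0 (v / (2 * M)), DifferentiableAt ℂ (fun z => -deriv f z / f z) z := by
    intro z hz
    have : f z ≠ 0 := by
      have := hlow z hz
      intro h; rw [h, norm_zero] at this; linarith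
    exact ((hf z hz).deriv.differentiableAt.neg).div (hf z hz).differentiableAt this
  have hdc : DiffContOnCl ℂ (fun z => -deriv f z / f z) (Metric.ball s0 (v / (2 * M))) := by
    apply DifferentiableOn.diffContOnCl
    rw [closure_ball _ hρ.ne']
    intro z hz
    exact (han z hz).differentiableWithinAt
  have := Complex.norm_iteratedDeriv_le_of_forall_mem_sphere_norm_le (C := 2 * M / v) k hρ hdc ?_
  · refine this.trans (le_of_eq ?_)
    rw [pow_succ, div_pow, div_pow]; field_simp
  · intro z hz
    have hz' := Metric.sphere_subset_closedBall hz
    rw [norm_div, norm_neg]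
    calc ‖deriv f z‖ / ‖f z‖ ≤ M / (v / 2) := by
          gcongr
          · exact hd z hz'
          · exact hlow z hz'
      _ = _ := by field_simp

lemma el_pow_le {q : ℕ} (hq : 1 ≤ q) (t : ℝ) (m : ℕ) : el q t ^ m ≤ m.factorial * (q * (|t| + 9)) := by
  have hE := two_le_el hq t
  have h := Real.pow_div_factorial_le_exp (el q t) (by linarith) m
  rw [div_le_iff₀ (by positivity)] at h
  have : Real.exp (el q t) = q * (|t| + 9) := by
    rw [el, Real.exp_log]
    have : (0:ℝ) < q := by exact_mod_cast hq
    positivity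
  rw [this] at h
  linarith

lemma abscissa_lt {f : ℕ → ℂ} (hf : ∀ s : ℂ, 1 < s.re → LSeriesSummable f s) {a : ℝ} (ha : 1 < a) :
    LSeries.abscissaOfAbsConv f < a := by
  have : LSeries.abscissaOfAbsConv f ≤ ((1 : ℝ) : EReal) := by
    apply LSeries.abscissaOfAbsConv_le_of_forall_lt_LSeriesSummable
    intro y hy
    exact hf y (by simpa using hy)
  exact this.trans_lt (by exact_mod_cast ha)

lemma isOpen_re : IsOpen {s : ℂ | 1 < s.re} := isOpen_lt continuous_const Complex.continuous_re

/-- constant -/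
noncomputable def cc : ℝ := 1 / (128 * 60000 * 64000)

lemma cc_pos : 0 < cc := by unfold cc; norm_num
lemma cc_le : cc ≤ 1 := by unfold cc; norm_num

lemma rad_le {v E : ℝ} (hE : 2 ≤ E) (hv : v ≤ 1) : v / (2 * (40 * E ^ 2)) ≤ 1 / (2 * E) := by
  rw [div_le_div_iff₀ (by positivity) (by positivity)]
  nlinarith

/-- twisted von Mangoldt -/
noncomputable def chiL {q : ℕ} (χ : DirichletCharacter ℂ q) : ℕ → ℂ :=
  (fun n : ℕ => χ (n : ZMod q)) * fun n : ℕ => (ArithmeticFunction.vonMangoldt n : ℂ)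

lemma D_chi (k : ℕ) : ∃ C : ℝ, 0 < C ∧ ∀ (q : ℕ) [Fact q.Prime] (χ : DirichletCharacter ℂ q), χ ≠ 1 →
    ∀ (t : ℝ) (a : ℝ), a ∈ Set.Ioc (1:ℝ) 2 →
    ‖LSeries (LSeries.logMul^[k] (chiL χ)) ⟨a, t⟩‖
      ≤ C * (Real.sqrt q ^ (k + 1) * q * (|t| + 9)) := by
  refine ⟨k.factorial * (80 / cc) ^ (k + 1) * (11 * (k + 1)).factorial, by have := cc_pos; positivity, ?_⟩
  intro q hq χ hχ t a ha
  have hq1 : 1 ≤ q := hq.out.one_lt.le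
  have hE := two_le_el hq1 t
  have hcc := cc_pos
  have hq1' : (1:ℝ) ≤ q := by exact_mod_cast hq1
  have hsq : 1 ≤ Real.sqrt q := Real.one_le_sqrt.mpr hq1'
  set E := el q t with hEdef
  set v : ℝ := cc / (Real.sqrt q * E ^ 9) with hv
  have hv0 : 0 < v := by positivity
  have hv1 : v ≤ 1 := by
    rw [hv, div_le_one (by positivity)]
    have : 1 ≤ E ^ 9 := one_le_pow₀ (by linarith)
    nlinarith [cc_le]
  have hr := rad_le hE hv1
  have key := logD (f := χ.LFunction) (s0 := ⟨a, t⟩) (v := v) (M := 40 * E ^ 2) hv0 (by positivity) k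
    (fun z _ => (DirichletCharacter.differentiable_LFunction hχ).analyticAt z) ?_ (L_lower hχ t ha)
  · have h1 : iteratedDeriv k (fun z => -deriv χ.LFunction z / χ.LFunction z) ⟨a, t⟩ =
      iteratedDeriv k (LSeries (chiL χ)) ⟨a, t⟩ := by
      apply Filter.EventuallyEq.iteratedDeriv_eq
      filter_upwards [isOpen_re.mem_nhds (show (⟨a, t⟩ : ℂ) ∈ {s : ℂ | 1 < s.re} from ha.1)] with z hz
      rw [chiL, DirichletCharacter.LSeries_twist_vonMangoldt_eq χ hz, DirichletCharacter.deriv_LFunction_eq_deriv_LSeries χ hz,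
        DirichletCharacter.LFunction_eq_LSeries χ hz]
    have habs : LSeries.abscissaOfAbsConv (chiL χ) < ((⟨a, t⟩ : ℂ).re : EReal) :=
      abscissa_lt (fun s hs => DirichletCharacter.LSeriesSummable_twist_vonMangoldt χ hs) ha.1
    rw [h1, LSeries_iteratedDeriv k habs,
      norm_mul, norm_pow, norm_neg, norm_one, one_pow, one_mul] at key
    refine key.trans ?_
    have e1 : 2 * (40 * E ^ 2) / v = (80 / cc) * (Real.sqrt q * E ^ 11) := by
      rw [hv]; field_simp; norm_num
    rw [e1, mul_pow, mul_pow, ← pow_mul]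
    have := el_pow_le hq1 t (11 * (k + 1))
    rw [← hEdef] at this
    calc _ ≤ k.factorial * ((80 / cc) ^ (k + 1) * (Real.sqrt q ^ (k + 1) * ((11 * (k + 1)).factorial * (q * (|t| + 9))))) := by gcongr
      _ = _ := by ring
  · intro z hz
    obtain ⟨b1, b2, b3⟩ := ball_facts hE (Metric.closedBall_subset_closedBall hr hz)
    simp only at b1 b2
    rw [abs_le] at b1 b2
    refine L_deriv hχ ?_ ?_ ?_
    · rw [← hEdef]; linarith [ha.1]
    · linarith [ha.2]
    · have := abs_sub_abs_le_abs_sub z.im t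
      have := abs_le.mpr b2
      linarith


/-- von Mangoldt, complex valued -/
noncomputable def vL : ℕ → ℂ := fun n : ℕ => (ArithmeticFunction.vonMangoldt n : ℂ)

lemma D_zeta_aux {s : ℂ} (hs : 1 < s.re) (k : ℕ) :
    iteratedDeriv k (fun z => -deriv riemannZeta z / riemannZeta z - riemannZeta z) s =
    (-1) ^ k * (LSeries (LSeries.logMul^[k] vL) s - LSeries (LSeries.logMul^[k] 1) s) := by
  have h1 : iteratedDeriv k (fun z => -deriv riemannZeta z / riemannZeta z - riemannZeta z) s =
      iteratedDeriv k (LSeries vL - LSeries 1) s := by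
    apply Filter.EventuallyEq.iteratedDeriv_eq
    filter_upwards [isOpen_re.mem_nhds (show s ∈ {s : ℂ | 1 < s.re} from hs)] with z hz
    have : LSeries vL z = -deriv riemannZeta z / riemannZeta z := ArithmeticFunction.LSeries_vonMangoldt_eq_deriv_riemannZeta_div hz
    rw [Pi.sub_apply, this, LSeries_one_eq_riemannZeta hz]
  have a1 : LSeries.abscissaOfAbsConv vL < s.re := abscissa_lt (fun s hs => ArithmeticFunction.LSeriesSummable_vonMangoldt hs) hs
  have a2 : LSeries.abscissaOfAbsConv 1 < s.re := abscissa_lt (fun s hs => LSeriesSummable_one_iff.mpr hs) hs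
  rw [h1, iteratedDeriv_sub, LSeries_iteratedDeriv k a1, LSeries_iteratedDeriv k a2]
  · ring
  · exact ((LSeries_analyticOnNhd vL) s a1).contDiffAt
  · exact ((LSeries_analyticOnNhd 1) s a2).contDiffAt

lemma zeta_ld {s : ℂ} (hs : 1 < s.re) : -deriv riemannZeta s / riemannZeta s - riemannZeta s =
    -deriv riemannZeta₁ s / riemannZeta₁ s - riemannZeta₀ s := by
  have hs1 : s ≠ 1 := by rintro rfl; simp at hs
  have hz : riemannZeta s ≠ 0 := riemannZeta_ne_zero_of_one_le_re hs.le
  have hs2 : s - 1 ≠ 0 := sub_ne_zero.mpr hs1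
  have hd : deriv riemannZeta₁ s = riemannZeta s + (s - 1) * deriv riemannZeta s := by
    have : riemannZeta₁ =ᶠ[nhds s] fun z => (z - 1) * riemannZeta z := by
      filter_upwards [isOpen_ne.mem_nhds hs1] with z hz
      rw [riemannZeta_eq_inv_sub_mul hz]
      field_simp [sub_ne_zero.mpr hz]
    rw [this.deriv_eq]
    have h2 := ((hasDerivAt_id s).sub_const 1).mul (differentiableAt_riemannZeta hs1).hasDerivAt
    have h3 := h2.deriv
    simp only [id, one_mul] at h3
    exact h3
  have h1 : riemannZeta₁ s = (s - 1) * riemannZeta s := by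
    rw [riemannZeta_eq_inv_sub_mul hs1]; field_simp
  have h0 : riemannZeta₀ s = riemannZeta s - (s - 1)⁻¹ := by rw [riemannZeta_eq_inv_sub_add hs1]; ring
  rw [hd, h1, h0]
  field_simp
  ring

lemma zeta1_ne {s : ℂ} (hs : 1 ≤ s.re) : riemannZeta₁ s ≠ 0 := by
  by_cases h : s = 1
  · simp [h]
  · have := riemannZeta_ne_zero_of_one_le_re hs
    rw [riemannZeta_eq_inv_sub_mul h] at this
    exact right_ne_zero_of_mul this

lemma D_zeta_small (k : ℕ) : ∃ C : ℝ, 0 < C ∧ ∀ (t : ℝ) (a : ℝ), a ∈ Set.Ioc (1:ℝ) 2 → |t| ≤ 1 →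
    ‖iteratedDeriv k (fun z => -deriv riemannZeta z / riemannZeta z - riemannZeta z) ⟨a, t⟩‖ ≤ C := by
  set Z : ℂ → ℂ := fun s => -deriv riemannZeta₁ s / riemannZeta₁ s - riemannZeta₀ s with hZ
  have hcomp : IsCompact (Set.Icc (1:ℝ) 2 ×ℂ Set.Icc (-1 : ℝ) 1) := isCompact_Icc.reProdIm isCompact_Icc
  have han : AnalyticOnNhd ℂ Z (Set.Icc (1:ℝ) 2 ×ℂ Set.Icc (-1 : ℝ) 1) := by
    intro z hz
    have h1 : AnalyticAt ℂ riemannZeta₁ z := differentiable_riemannZeta₁.analyticAt z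
    exact (h1.deriv.neg.div h1 (zeta1_ne (Complex.mem_reProdIm.mp hz).1.1)).sub (differentiable_riemannZeta₀.analyticAt z)
  obtain ⟨C, hC⟩ := hcomp.exists_bound_of_continuousOn (han.iterated_deriv k).continuousOn
  refine ⟨|C| + 1, by positivity, ?_⟩
  intro t a ha ht
  have h1 : iteratedDeriv k (fun z => -deriv riemannZeta z / riemannZeta z - riemannZeta z) ⟨a, t⟩ = iteratedDeriv k Z ⟨a, t⟩ := by
    apply Filter.EventuallyEq.iteratedDeriv_eq
    filter_upwards [isOpen_re.mem_nhds (show (⟨a, t⟩ : ℂ) ∈ {s : ℂ | 1 < s.re} from ha.1)] with z hz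
    exact zeta_ld hz
  rw [h1, iteratedDeriv_eq_iterate]
  have := hC ⟨a, t⟩ (Complex.mem_reProdIm.mpr ⟨⟨ha.1.le, ha.2⟩, abs_le.mp ht⟩)
  linarith [le_abs_self C]

lemma D_zeta_large (k : ℕ) : ∃ C : ℝ, 0 < C ∧ ∀ (t : ℝ) (a : ℝ), a ∈ Set.Ioc (1:ℝ) 2 → 1 ≤ |t| →
    ‖iteratedDeriv k (fun z => -deriv riemannZeta z / riemannZeta z - riemannZeta z) ⟨a, t⟩‖ ≤ C * (|t| + 9) := by
  refine ⟨k.factorial * (80 / cc) ^ (k + 1) * (11 * (k + 1)).factorial + k.factorial * 20 * 2 ^ k * (k + 1).factorial, by have := cc_pos; positivity, ?_⟩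
  intro t a ha ht
  have hE := two_le_el le_rfl t
  have hcc := cc_pos
  set E := el 1 t with hEdef
  set v : ℝ := cc / (E ^ 9) with hv
  have hv0 : 0 < v := by positivity
  have hv1 : v ≤ 1 := by
    rw [hv, div_le_one (by positivity)]
    have : 1 ≤ E ^ 9 := one_le_pow₀ (by linarith)
    linarith [cc_le]
  have hr := rad_le hE hv1
  have hball : ∀ z ∈ Metric.closedBall (⟨a, t⟩ : ℂ) (1 / (2 * E)), 3 / 4 ≤ |z.im| ∧ 1 - 1 / (2 * E) ≤ z.re ∧ z.re ≤ 5 / 2 ∧ |z.im| ≤ |t| + 1/2 := by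
    intro z hz
    obtain ⟨b1, b2, b3⟩ := ball_facts hE hz
    simp only at b1 b2
    have h1 := abs_sub_abs_le_abs_sub z.im t
    have h2 := abs_sub_abs_le_abs_sub t z.im
    rw [abs_sub_comm t] at h2
    rw [abs_le] at b1
    refine ⟨by linarith, by linarith [ha.1], by linarith [ha.2], by linarith⟩
  have hne : ∀ z ∈ Metric.closedBall (⟨a, t⟩ : ℂ) (1 / (2 * E)), z ≠ 1 := by
    rintro z hz rfl
    have := (hball _ hz).1
    norm_num at this
  have hana : ∀ z : ℂ, z ≠ 1 → AnalyticAt ℂ riemannZeta z := by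
    intro z hz
    exact differentiableOn_riemannZeta.analyticAt (isOpen_ne.mem_nhds hz)
  have hsub := Metric.closedBall_subset_closedBall (x := (⟨a, t⟩ : ℂ)) hr
  have hs1 : (⟨a, t⟩ : ℂ) ≠ 1 := by
    intro h
    have := congrArg Complex.re h
    simp at this; linarith [ha.1]
  have key := logD (f := riemannZeta) (s0 := ⟨a, t⟩) (v := v) (M := 40 * E ^ 2) hv0 (by positivity) k
    (fun z hz => hana z (hne z (hsub hz))) (fun z hz => by
      obtain ⟨c1, c2, c3, c4⟩ := hball z (hsub hz)
      exact Z_deriv c1 c2 c3 c4) (Z_lower ht ha)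
  have hr0 : 0 < 1 / (2 * E) := by positivity
  have key2 : ‖iteratedDeriv k riemannZeta ⟨a, t⟩‖ ≤ k.factorial * (20 * E) / (1 / (2 * E)) ^ k := by
    apply Complex.norm_iteratedDeriv_le_of_forall_mem_sphere_norm_le _ hr0
    · apply DifferentiableOn.diffContOnCl
      rw [closure_ball _ hr0.ne']
      intro z hz
      exact (differentiableAt_riemannZeta (hne z hz)).differentiableWithinAt
    · intro z hz
      obtain ⟨c1, c2, c3, c4⟩ := hball z (Metric.sphere_subset_closedBall hz)
      refine Z_bound' (by linarith) ?_ (by linarith) (by linarith)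
      have : 1 / (2 * E) ≤ 1 / E := one_div_le_one_div_of_le (by linarith) (by linarith)
      rw [← hEdef]; linarith
  have hsplit : iteratedDeriv k (fun z => -deriv riemannZeta z / riemannZeta z - riemannZeta z) ⟨a, t⟩ =
      iteratedDeriv k (fun z => -deriv riemannZeta z / riemannZeta z) ⟨a, t⟩ - iteratedDeriv k riemannZeta ⟨a, t⟩ := by
    have hz0 : riemannZeta ⟨a, t⟩ ≠ 0 := riemannZeta_ne_zero_of_one_le_re ha.1.le
    exact iteratedDeriv_sub (f := fun z => -deriv riemannZeta z / riemannZeta z) (g := riemannZeta)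
      (((hana _ hs1).deriv.neg.div (hana _ hs1) hz0).contDiffAt) (hana _ hs1).contDiffAt
  rw [hsplit]
  refine (norm_sub_le _ _).trans ?_
  have e1 : 2 * (40 * E ^ 2) / v = (80 / cc) * E ^ 11 := by
    rw [hv]; field_simp; norm_num
  rw [e1, mul_pow, ← pow_mul] at key
  have p1 := el_pow_le le_rfl t (11 * (k + 1))
  have p2 := el_pow_le le_rfl t (k + 1)
  rw [← hEdef] at p1 p2
  simp only [Nat.cast_one, one_mul] at p1 p2
  have key' : ‖iteratedDeriv k (fun z => -deriv riemannZeta z / riemannZeta z) ⟨a, t⟩‖ ≤ k.factorial * ((80 / cc) ^ (k + 1) * ((11 * (k + 1)).factorial * (|t| + 9))) := by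
    refine key.trans ?_
    gcongr
  have key2' : ‖iteratedDeriv k riemannZeta ⟨a, t⟩‖ ≤ k.factorial * 20 * 2 ^ k * ((k + 1).factorial * (|t| + 9)) := by
    refine key2.trans ?_
    have : k.factorial * (20 * E) / (1 / (2 * E)) ^ k = k.factorial * 20 * 2 ^ k * E ^ (k + 1) := by
      rw [div_pow, one_pow, mul_pow, pow_succ]; field_simp
    rw [this]
    gcongr
  calc _ ≤ _ := add_le_add key' key2'
    _ = _ := by ring

lemma D_zeta (k : ℕ) : ∃ C : ℝ, 0 < C ∧ ∀ (t : ℝ) (a : ℝ), a ∈ Set.Ioc (1:ℝ) 2 →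
    ‖LSeries (LSeries.logMul^[k] vL) ⟨a, t⟩ - LSeries (LSeries.logMul^[k] 1) ⟨a, t⟩‖ ≤ C * (|t| + 9) := by
  obtain ⟨C1, h1, h1'⟩ := D_zeta_small k
  obtain ⟨C2, h2, h2'⟩ := D_zeta_large k
  refine ⟨C1 + C2, by positivity, ?_⟩
  intro t a ha
  have h := D_zeta_aux (s := ⟨a, t⟩) ha.1 k
  have h3 : ‖LSeries (LSeries.logMul^[k] vL) ⟨a, t⟩ - LSeries (LSeries.logMul^[k] 1) ⟨a, t⟩‖ =
    ‖iteratedDeriv k (fun z => -deriv riemannZeta z / riemannZeta z - riemannZeta z) ⟨a, t⟩‖ := by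
    rw [h, norm_mul, norm_pow, norm_neg, norm_one, one_pow, one_mul]
  rw [h3]
  have := abs_nonneg t
  rcases le_total |t| 1 with ht | ht
  · refine (h1' t a ha ht).trans ?_
    nlinarith
  · refine (h2' t a ha ht).trans ?_
    nlinarith

end TA

namespace TA
open MeasureTheory

/-- Gaussian kernel -/
noncomputable def Gs (T v : ℝ) : ℝ := T / Real.sqrt (2 * π) * Real.exp (-(T ^ 2 / 2) * v ^ 2)

lemma Gs_nonneg {T : ℝ} (hT : 0 < T) (v : ℝ) : 0 ≤ Gs T v := by unfold Gs; positivity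

lemma Gs_int {T : ℝ} (hT : 0 < T) : Integrable (Gs T) := by
  unfold Gs
  exact (integrable_exp_neg_mul_sq (by positivity)).const_mul _

lemma Gs_int' {T : ℝ} (hT : 0 < T) (l : ℝ) : Integrable (fun u => Gs T (l - u)) := (Gs_int hT).comp_sub_left l

lemma Gs_integral {T : ℝ} (hT : 0 < T) : ∫ v, Gs T v = 1 := by
  unfold Gs
  rw [integral_const_mul, integral_gaussian]
  have : π / (T ^ 2 / 2) = (Real.sqrt (2 * π) / T) ^ 2 := by
    rw [div_pow, Real.sq_sqrt (by positivity)]; field_simp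
  rw [this, Real.sqrt_sq (by positivity)]
  field_simp

lemma Gs_integral' {T : ℝ} (hT : 0 < T) (l : ℝ) : ∫ u, Gs T (l - u) = 1 := by
  rw [integral_sub_left_eq_self (Gs T) volume l, Gs_integral hT]

lemma Gs_tail {T δ v : ℝ} (hT : 0 < T) (hδ : 0 < δ) (hv : δ ≤ |v|) :
    Gs T v ≤ 8 / (T * δ) ^ 2 * Gs (T / Real.sqrt 2) v := by
  unfold Gs
  have h2 : Real.sqrt 2 ^ 2 = 2 := Real.sq_sqrt (by norm_num)
  have h20 : 0 < Real.sqrt 2 := by positivity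
  have h22 : Real.sqrt 2 ≤ 2 := by nlinarith
  have e1 : Real.exp (-(T ^ 2 / 2) * v ^ 2) = Real.exp (-((T / Real.sqrt 2) ^ 2 / 2) * v ^ 2) * Real.exp (-(T ^ 2 * v ^ 2 / 4)) := by
    rw [← Real.exp_add]; congr 1; rw [div_pow, h2]; ring
  have hv2 : δ ^ 2 ≤ v ^ 2 := by rw [← sq_abs v]; gcongr
  have hy : 0 < T ^ 2 * δ ^ 2 / 4 := by positivity
  have e2 : Real.exp (-(T ^ 2 * v ^ 2 / 4)) ≤ 4 / (T * δ) ^ 2 := by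
    calc Real.exp (-(T ^ 2 * v ^ 2 / 4)) ≤ Real.exp (-(T ^ 2 * δ ^ 2 / 4)) := by
          apply Real.exp_le_exp.mpr
          have : T ^ 2 * δ ^ 2 ≤ T ^ 2 * v ^ 2 := by gcongr
          linarith
      _ ≤ (T ^ 2 * δ ^ 2 / 4)⁻¹ := by
          rw [Real.exp_neg]
          apply inv_anti₀ hy
          linarith [Real.add_one_le_exp (T ^ 2 * δ ^ 2 / 4)]
      _ = _ := by rw [mul_pow]; field_simp
  rw [e1]
  calc T / Real.sqrt (2 * π) * (Real.exp (-((T / Real.sqrt 2) ^ 2 / 2) * v ^ 2) * Real.exp (-(T ^ 2 * v ^ 2 / 4)))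
      ≤ T / Real.sqrt (2 * π) * (Real.exp (-((T / Real.sqrt 2) ^ 2 / 2) * v ^ 2) * (4 / (T * δ) ^ 2)) := by gcongr
    _ = Real.sqrt 2 * (4 / (T * δ) ^ 2 * (T / Real.sqrt 2 / Real.sqrt (2 * π) * Real.exp (-((T / Real.sqrt 2) ^ 2 / 2) * v ^ 2))) := by
        field_simp
    _ ≤ 2 * (4 / (T * δ) ^ 2 * (T / Real.sqrt 2 / Real.sqrt (2 * π) * Real.exp (-((T / Real.sqrt 2) ^ 2 / 2) * v ^ 2))) := by gcongr
    _ = _ := by ring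

lemma Gs_set_tail {T δ l : ℝ} (hT : 0 < T) (hδ : 0 < δ) {S : Set ℝ} (hS : MeasurableSet S) (h : ∀ u ∈ S, δ ≤ |l - u|) :
    ∫ u in S, Gs T (l - u) ≤ 8 / (T * δ) ^ 2 := by
  have hT2 : 0 < T / Real.sqrt 2 := by positivity
  calc ∫ u in S, Gs T (l - u) ≤ ∫ u in S, 8 / (T * δ) ^ 2 * Gs (T / Real.sqrt 2) (l - u) := by
        apply setIntegral_mono_on (Gs_int' hT l).integrableOn ((Gs_int' hT2 l).const_mul _).integrableOn hS
        intro u hu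
        exact Gs_tail hT hδ (h u hu)
    _ = 8 / (T * δ) ^ 2 * ∫ u in S, Gs (T / Real.sqrt 2) (l - u) := integral_const_mul _ _
    _ ≤ 8 / (T * δ) ^ 2 * ∫ u, Gs (T / Real.sqrt 2) (l - u) := by
        gcongr
        · exact Eventually.of_forall (fun u => Gs_nonneg hT2 _)
        · exact Gs_int' hT2 l
        · exact Measure.restrict_le_self
    _ = _ := by rw [Gs_integral' hT2, mul_one]

lemma Phi_le_one {T : ℝ} (hT : 0 < T) (l : ℝ) (S : Set ℝ) : ∫ u in S, Gs T (l - u) ≤ 1 := by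
  rw [← Gs_integral' hT l]
  exact setIntegral_le_integral (Gs_int' hT l) (Eventually.of_forall (fun u => Gs_nonneg hT _))

lemma Phi_nonneg {T : ℝ} (hT : 0 < T) (l : ℝ) (S : Set ℝ) : 0 ≤ ∫ u in S, Gs T (l - u) :=
  integral_nonneg (fun u => Gs_nonneg hT _)

lemma Gs_fourier {T : ℝ} (hT : 0 < T) (v : ℝ) :
    ∫ t : ℝ, Complex.exp (Complex.I * v * t) * Complex.exp (-((1 / (2 * T ^ 2) : ℝ) : ℂ) * t ^ 2) = ((2 * π * Gs T v : ℝ) : ℂ) := by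
  have hb : 0 < (((1 / (2 * T ^ 2) : ℝ) : ℂ)).re := by rw [Complex.ofReal_re]; positivity
  rw [fourierIntegral_gaussian hb]
  have e1 : (π : ℂ) / ((1 / (2 * T ^ 2) : ℝ) : ℂ) = (((2 * π * T ^ 2 : ℝ)) : ℂ) := by
    push_cast
    have : (T : ℂ) ≠ 0 := by exact_mod_cast hT.ne'
    field_simp
  have e2 : ((1 : ℂ) / 2) = ((1 / 2 : ℝ) : ℂ) := by push_cast; rfl
  rw [e1, e2, ← Complex.ofReal_cpow (by positivity), ← Real.sqrt_eq_rpow]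
  have e3 : -(v : ℂ) ^ 2 / (4 * ((1 / (2 * T ^ 2) : ℝ) : ℂ)) = ((-(T ^ 2 / 2) * v ^ 2 : ℝ) : ℂ) := by
    push_cast
    have : (T : ℂ) ≠ 0 := by exact_mod_cast hT.ne'
    field_simp
    norm_num
  rw [e3, ← Complex.ofReal_exp, ← Complex.ofReal_mul]
  congr 1
  unfold Gs
  rw [Real.sqrt_mul (by positivity) (T ^ 2), Real.sqrt_sq hT.le]
  have : Real.sqrt (2 * π) * Real.sqrt (2 * π) = 2 * π := Real.mul_self_sqrt (by positivity)
  have h0 : 0 < Real.sqrt (2 * π) := by positivity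
  field_simp
  nlinarith

lemma gauss_abs_integral {T M : ℝ} (hT : 1 ≤ T) (hM : 0 ≤ M) {F : ℝ → ℂ} (hF : ∀ t, ‖F t‖ ≤ M * (|t| + 9)) :
    ‖∫ t : ℝ, F t * Complex.exp (-((1 / (2 * T ^ 2) : ℝ) : ℂ) * t ^ 2)‖ ≤ 2 * π * (8 * M * T ^ 2) := by
  have hb : 0 < 1 / (4 * T ^ 2) := by positivity
  have hle : ∀ t : ℝ, ‖F t * Complex.exp (-((1 / (2 * T ^ 2) : ℝ) : ℂ) * t ^ 2)‖ ≤ 11 * M * T * Real.exp (-(1 / (4 * T ^ 2)) * t ^ 2) := by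
    intro t
    have e1 : -((1 / (2 * T ^ 2) : ℝ) : ℂ) * t ^ 2 = ((-(1 / (2 * T ^ 2)) * t ^ 2 : ℝ) : ℂ) := by push_cast; ring
    rw [norm_mul, e1, ← Complex.ofReal_exp, Complex.norm_real, Real.norm_eq_abs, abs_of_pos (Real.exp_pos _)]
    have e2 : Real.exp (-(1 / (2 * T ^ 2)) * t ^ 2) = Real.exp (-(1 / (4 * T ^ 2)) * t ^ 2) * Real.exp (-(1 / (4 * T ^ 2)) * t ^ 2) := by
      rw [← Real.exp_add]; congr 1; field_simp; ring
    have e3 : |t| + 9 ≤ 11 * T * Real.exp ((1 / (4 * T ^ 2)) * t ^ 2) := by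
      have h1 := Real.add_one_le_exp ((1 / (4 * T ^ 2)) * t ^ 2)
      have h2 : |t| ≤ T * (1 + 1 / (4 * T ^ 2) * t ^ 2) := by
        have : T * (1 + 1 / (4 * T ^ 2) * t ^ 2) - |t| = (2 * T - |t|) ^ 2 / (4 * T) := by
          rw [← sq_abs t]; field_simp; ring
        have : 0 ≤ (2 * T - |t|) ^ 2 / (4 * T) := by positivity
        linarith
      have h3 : 0 ≤ (1 / (4 * T ^ 2)) * t ^ 2 := by positivity
      nlinarith
    have e4 : Real.exp ((1 / (4 * T ^ 2)) * t ^ 2) * Real.exp (-(1 / (4 * T ^ 2)) * t ^ 2) = 1 := by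
      rw [← Real.exp_add]; simp
    have hE := Real.exp_pos (-(1 / (4 * T ^ 2)) * t ^ 2)
    rw [e2]
    calc ‖F t‖ * (Real.exp (-(1 / (4 * T ^ 2)) * t ^ 2) * Real.exp (-(1 / (4 * T ^ 2)) * t ^ 2))
        ≤ (M * (11 * T * Real.exp ((1 / (4 * T ^ 2)) * t ^ 2))) * (Real.exp (-(1 / (4 * T ^ 2)) * t ^ 2) * Real.exp (-(1 / (4 * T ^ 2)) * t ^ 2)) := by
          gcongr
          exact (hF t).trans (by gcongr)
      _ = 11 * M * T * (Real.exp ((1 / (4 * T ^ 2)) * t ^ 2) * Real.exp (-(1 / (4 * T ^ 2)) * t ^ 2)) * Real.exp (-(1 / (4 * T ^ 2)) * t ^ 2) := by ring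
      _ = _ := by rw [e4]; ring
  refine (norm_integral_le_of_norm_le ((integrable_exp_neg_mul_sq hb).const_mul (11 * M * T)) (Eventually.of_forall hle)).trans ?_
  rw [integral_const_mul, integral_gaussian]
  have e5 : π / (1 / (4 * T ^ 2)) = π * (2 * T) ^ 2 := by field_simp; norm_num
  have hs : Real.sqrt π ≤ 2 := by
    rw [Real.sqrt_le_left (by norm_num)]; linarith [Real.pi_le_four]
  rw [e5, Real.sqrt_mul (by positivity), Real.sqrt_sq (by positivity)]
  calc 11 * M * T * (Real.sqrt π * (2 * T)) ≤ 11 * M * T * (2 * (2 * T)) := by gcongr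
    _ = 44 * (M * T ^ 2) := by ring
    _ ≤ (2 * π * 8) * (M * T ^ 2) := by gcongr; linarith [Real.pi_gt_d2]
    _ = _ := by ring
  
lemma smooth_point {w lam : ℕ → ℝ} (sw : Summable w) {M T : ℝ} (hM : 0 ≤ M) (hT : 1 ≤ T)
    (hF : ∀ t : ℝ, ‖∑' n, (w n : ℂ) * Complex.exp (-(Complex.I * t * lam n))‖ ≤ M * (|t| + 9)) (u : ℝ) :
    ‖∑' n, w n * Gs T (lam n - u)‖ ≤ 8 * M * T ^ 2 := by
  have hT0 : 0 < T := by linarith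
  set b : ℝ := 1 / (2 * T ^ 2) with hb
  have hb0 : 0 < b := by positivity
  have hgi : Integrable (fun t : ℝ => Complex.exp (-(b : ℂ) * t ^ 2)) := integrable_cexp_neg_mul_sq (by simpa using hb0)
  set F : ℕ → ℝ → ℂ := fun n t => (w n : ℂ) * (Complex.exp (Complex.I * ((u - lam n : ℝ) : ℂ) * t) * Complex.exp (-(b : ℂ) * t ^ 2)) with hFdef
  have hone : ∀ v t : ℝ, ‖Complex.exp (Complex.I * (v : ℂ) * t)‖ = 1 := by
    intro v t
    have : Complex.I * (v : ℂ) * t = ((v * t : ℝ) : ℂ) * Complex.I := by push_cast; ring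
    rw [this, Complex.norm_exp_ofReal_mul_I]
  have hIntg : ∀ n, Integrable (F n) := by
    intro n
    apply Integrable.const_mul
    refine hgi.bdd_mul (c := 1) (Continuous.aestronglyMeasurable (by fun_prop)) (Eventually.of_forall (fun t => (hone _ t).le))
  have hsum : Summable (fun n => ∫ t, ‖F n t‖) := by
    have : (fun n => ∫ t, ‖F n t‖) = fun n => |w n| * ∫ t : ℝ, ‖Complex.exp (-(b : ℂ) * t ^ 2)‖ := by
      funext n
      rw [← integral_const_mul]
      congr 1; funext t
      rw [hFdef]; simp only
      rw [norm_mul, norm_mul, hone, one_mul, Complex.norm_real, Real.norm_eq_abs]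
    rw [this]
    exact sw.abs.mul_right _
  have h := integral_tsum_of_summable_integral_norm hIntg hsum
  have h1 : ∀ n, ∫ t, F n t = ((2 * π * (w n * Gs T (lam n - u)) : ℝ) : ℂ) := by
    intro n
    rw [hFdef]; simp only
    rw [integral_const_mul, Gs_fourier hT0, ← Complex.ofReal_mul]
    congr 1
    have : Gs T (u - lam n) = Gs T (lam n - u) := by
      unfold Gs; congr 3; ring
    rw [this]; ring
  have h2 : ∀ t : ℝ, ∑' n, F n t = (Complex.exp (Complex.I * u * t) * ∑' n, (w n : ℂ) * Complex.exp (-(Complex.I * t * lam n))) * Complex.exp (-(b : ℂ) * t ^ 2) := by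
    intro t
    rw [← tsum_mul_left, ← tsum_mul_right]
    congr 1; funext n
    rw [hFdef]; simp only
    have : Complex.exp (Complex.I * ((u - lam n : ℝ) : ℂ) * t) = Complex.exp (Complex.I * u * t) * Complex.exp (-(Complex.I * t * lam n)) := by
      rw [← Complex.exp_add]; congr 1; push_cast; ring
    rw [this]; ring
  have h3 := gauss_abs_integral hT hM (F := fun t => Complex.exp (Complex.I * u * t) * ∑' n, (w n : ℂ) * Complex.exp (-(Complex.I * t * lam n)))
    (fun t => by rw [norm_mul, hone, one_mul]; exact hF t)
  simp only [h1] at h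
  rw [← Complex.ofReal_tsum] at h
  rw [← hb] at h3
  simp only [← h2] at h3
  rw [← h, Complex.norm_real, tsum_mul_left, norm_mul, Real.norm_eq_abs (2 * π), abs_of_pos (by positivity)] at h3
  exact le_of_mul_le_mul_left h3 (by positivity)

lemma Gs_le_const {T : ℝ} (hT : 0 < T) (v : ℝ) : Gs T v ≤ T / Real.sqrt (2 * π) := by
  unfold Gs
  have : Real.exp (-(T ^ 2 / 2) * v ^ 2) ≤ 1 := by
    apply Real.exp_le_one_iff.mpr
    have : 0 ≤ (T ^ 2 / 2) * v ^ 2 := by positivity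
    linarith
  calc _ ≤ T / Real.sqrt (2 * π) * 1 := by gcongr
    _ = _ := mul_one _

lemma smooth_int {w lam : ℕ → ℝ} (sw : Summable w) {M T : ℝ} (hM : 0 ≤ M) (hT : 1 ≤ T)
    (hF : ∀ t : ℝ, ‖∑' n, (w n : ℂ) * Complex.exp (-(Complex.I * t * lam n))‖ ≤ M * (|t| + 9)) {A B : ℝ} (hAB : A ≤ B) :
    ‖∑' n, w n * ∫ u in Set.Ioc A B, Gs T (lam n - u)‖ ≤ 8 * M * T ^ 2 * (B - A) := by
  have hT0 : 0 < T := by linarith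
  have hIntg : ∀ n, Integrable (fun u => w n * Gs T (lam n - u)) (volume.restrict (Set.Ioc A B)) := by
    intro n
    exact ((Gs_int' hT0 (lam n)).const_mul _).integrableOn
  have hsum : Summable (fun n => ∫ u in Set.Ioc A B, ‖w n * Gs T (lam n - u)‖) := by
    refine Summable.of_nonneg_of_le (fun n => integral_nonneg (fun u => norm_nonneg _)) (fun n => ?_) sw.abs
    have : ∀ u, ‖w n * Gs T (lam n - u)‖ = |w n| * Gs T (lam n - u) := by
      intro u
      rw [norm_mul, Real.norm_eq_abs, Real.norm_eq_abs, abs_of_nonneg (Gs_nonneg hT0 _)]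
    simp only [this]
    rw [integral_const_mul]
    calc _ ≤ |w n| * 1 := by gcongr; exact Phi_le_one hT0 _ _
      _ = _ := mul_one _
  have h := integral_tsum_of_summable_integral_norm hIntg hsum
  simp only [integral_const_mul] at h
  rw [h]
  have := norm_setIntegral_le_of_norm_le_const (μ := volume) (s := Set.Ioc A B) (f := fun u => ∑' n, w n * Gs T (lam n - u))
    (C := 8 * M * T ^ 2) (by simp) (fun u _ => smooth_point sw hM hT hF u)
  refine this.trans (le_of_eq ?_)
  rw [Measure.real, Real.volume_Ioc, ENNReal.toReal_ofReal (by linarith)]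

open Classical in
lemma tauber {b e lam : ℕ → ℝ} (hb : ∀ n, 0 ≤ b n) (he : ∀ n, 0 ≤ e n) (sb : Summable b) (se : Summable e)
    {M T δ : ℝ} (hM : 0 ≤ M) (hT : 1 ≤ T) (hδ : 0 < δ)
    (hF : ∀ t : ℝ, ‖∑' n, ((b n - e n : ℝ) : ℂ) * Complex.exp (-(Complex.I * t * lam n))‖ ≤ M * (|t| + 9))
    {U V : ℝ} (hUV : U ≤ V) :
    ∑' n, (if lam n ∈ Set.Icc U V then b n else 0) ≤
      ∑' n, (if lam n ∈ Set.Icc (U - 2 * δ) (V + 2 * δ) then e n else 0)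
        + 8 / (T * δ) ^ 2 * (∑' n, b n + ∑' n, e n) + 8 * M * T ^ 2 * (V - U + 2 * δ) := by
  have hT0 : 0 < T := by linarith
  set η : ℝ := 8 / (T * δ) ^ 2 with hη
  have hη0 : 0 ≤ η := by positivity
  set S : Set ℝ := Set.Ioc (U - δ) (V + δ) with hS
  have hSm : MeasurableSet S := measurableSet_Ioc
  set Φ : ℕ → ℝ := fun n => ∫ u in S, Gs T (lam n - u) with hΦ
  have hΦ0 : ∀ n, 0 ≤ Φ n := fun n => Phi_nonneg hT0 _ _
  have hΦ1 : ∀ n, Φ n ≤ 1 := fun n => Phi_le_one hT0 _ _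
  have hin : ∀ n, lam n ∈ Set.Icc U V → 1 ≤ Φ n + η := by
    intro n hn
    have h1 := integral_add_compl hSm (Gs_int' hT0 (lam n))
    rw [Gs_integral' hT0] at h1
    have h2 := Gs_set_tail (l := lam n) hT0 hδ hSm.compl ?_
    · rw [← h1]; gcongr
    · intro u hu
      by_contra hcon
      push Not at hcon
      rw [abs_lt] at hcon
      exact hu ⟨by linarith [hn.1], by linarith [hn.2]⟩
  have hout : ∀ n, lam n ∉ Set.Icc (U - 2 * δ) (V + 2 * δ) → Φ n ≤ η := by
    intro n hn
    apply Gs_set_tail hT0 hδ hSm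
    intro u hu
    by_contra hcon
    push Not at hcon
    rw [abs_lt] at hcon
    exact hn ⟨by linarith [hu.1], by linarith [hu.2]⟩
  have sbI : Summable (fun n => if lam n ∈ Set.Icc U V then b n else 0) :=
    Summable.of_nonneg_of_le (fun n => by split_ifs <;> simp [hb n]) (fun n => by split_ifs <;> simp [hb n]) sb
  have seI : Summable (fun n => if lam n ∈ Set.Icc (U - 2 * δ) (V + 2 * δ) then e n else 0) :=
    Summable.of_nonneg_of_le (fun n => by split_ifs <;> simp [he n]) (fun n => by split_ifs <;> simp [he n]) se
  have sbΦ : Summable (fun n => b n * Φ n) :=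
    Summable.of_nonneg_of_le (fun n => mul_nonneg (hb n) (hΦ0 n)) (fun n => mul_le_of_le_one_right (hb n) (hΦ1 n)) sb
  have seΦ : Summable (fun n => e n * Φ n) :=
    Summable.of_nonneg_of_le (fun n => mul_nonneg (he n) (hΦ0 n)) (fun n => mul_le_of_le_one_right (he n) (hΦ1 n)) se
  have h1 : ∑' n, (if lam n ∈ Set.Icc U V then b n else 0) ≤ ∑' n, b n * Φ n + η * ∑' n, b n := by
    rw [← tsum_mul_left, ← sbΦ.tsum_add (sb.mul_left η)]
    refine sbI.tsum_le_tsum (fun n => ?_) (sbΦ.add (sb.mul_left η))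
    split_ifs with h
    · have := mul_le_mul_of_nonneg_left (hin n h) (hb n); linarith
    · have := mul_nonneg (hb n) (hΦ0 n); have := mul_nonneg hη0 (hb n); linarith
  have h2 : ∑' n, e n * Φ n ≤ ∑' n, (if lam n ∈ Set.Icc (U - 2 * δ) (V + 2 * δ) then e n else 0) + η * ∑' n, e n := by
    rw [← tsum_mul_left, ← seI.tsum_add (se.mul_left η)]
    refine seΦ.tsum_le_tsum (fun n => ?_) (seI.add (se.mul_left η))
    split_ifs with h
    · have := mul_le_of_le_one_right (he n) (hΦ1 n); have := mul_nonneg hη0 (he n); linarith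
    · have := mul_le_mul_of_nonneg_left (hout n h) (he n); linarith
  have h3 := smooth_int (w := fun n => b n - e n) (sb.sub se) hM hT hF (A := U - δ) (B := V + δ) (by linarith)
  have h4 : ∑' n, (b n - e n) * Φ n = ∑' n, b n * Φ n - ∑' n, e n * Φ n := by
    rw [← sbΦ.tsum_sub seΦ]; congr 1; funext n; ring
  have h5 := (le_abs_self _).trans h3
  change ∑' n, (b n - e n) * Φ n ≤ _ at h5
  rw [h4] at h5
  have h6 : 8 * M * T ^ 2 * (V + δ - (U - δ)) = 8 * M * T ^ 2 * (V - U + 2 * δ) := by ring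
  rw [h6] at h5
  linarith

end TA

namespace TA
open ArithmeticFunction (vonMangoldt)

/-- weight detecting a residue class -/
noncomputable def aq (q : ℕ) (a : ZMod q) (n : ℕ) : ℝ := by
  classical
  exact vonMangoldt n * ((if (n : ZMod q) = 0 then 1 else 0) + ((q : ℝ) - 1) * (if (n : ZMod q) = a then 1 else 0))

noncomputable def en (k : ℕ) (σ : ℝ) (n : ℕ) : ℝ := Real.log n ^ k * (n : ℝ) ^ (-σ)

lemma aq_char {q : ℕ} [hq : Fact q.Prime] {a : ZMod q} (ha : a ≠ 0) (n : ℕ) :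
    (aq q a n : ℂ) = vL n + ∑ χ ∈ (Finset.univ : Finset (DirichletCharacter ℂ q)).erase 1, χ a⁻¹ * chiL χ n := by
  have hu : IsUnit a := isUnit_iff_ne_zero.mpr ha
  have h := DirichletCharacter.sum_char_inv_mul_char_eq ℂ hu (n : ZMod q)
  have h1 : ∑ χ ∈ (Finset.univ : Finset (DirichletCharacter ℂ q)).erase 1, χ a⁻¹ * chiL χ n =
     (∑ χ ∈ (Finset.univ : Finset (DirichletCharacter ℂ q)).erase 1, χ a⁻¹ * χ (n : ZMod q)) * (vonMangoldt n : ℂ) := by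
    rw [Finset.sum_mul]
    apply Finset.sum_congr rfl
    intro χ _
    simp only [chiL, Pi.mul_apply]; ring
  rw [h1]
  rw [← Finset.add_sum_erase Finset.univ _ (Finset.mem_univ (1 : DirichletCharacter ℂ q)), Nat.totient_prime hq.out] at h
  have hui : IsUnit a⁻¹ := isUnit_iff_ne_zero.mpr (inv_ne_zero ha)
  rw [MulChar.one_apply hui, one_mul] at h
  have h2 := eq_sub_of_add_eq' h
  rw [h2]
  have hcast : (((q - 1 : ℕ)) : ℂ) = (q : ℂ) - 1 := by
    rw [Nat.cast_sub hq.out.one_lt.le]; simp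
  unfold aq vL
  rw [hcast]
  by_cases hn : (n : ZMod q) = 0
  · rw [hn, if_neg ha, if_neg (Ne.symm ha)]
    rw [MulChar.map_nonunit _ (by simp)]
    simp
  · rw [MulChar.one_apply (isUnit_iff_ne_zero.mpr hn), if_neg hn]
    by_cases hna : (n : ZMod q) = a
    · rw [if_pos hna, if_pos hna.symm]; push_cast; ring
    · rw [if_neg hna, if_neg (Ne.symm hna)]; push_cast; ring

lemma aq_nonneg {q : ℕ} (hq : 1 ≤ q) (a : ZMod q) (n : ℕ) : 0 ≤ aq q a n := by
  have : (1:ℝ) ≤ q := by exact_mod_cast hq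
  have h1 := ArithmeticFunction.vonMangoldt_nonneg (n := n)
  unfold aq
  apply mul_nonneg h1
  split_ifs <;> simp <;> linarith

lemma aq_le {q : ℕ} (hq : 1 ≤ q) (a : ZMod q) (n : ℕ) : aq q a n ≤ q * Real.log n := by
  have : (1:ℝ) ≤ q := by exact_mod_cast hq
  have h1 := ArithmeticFunction.vonMangoldt_nonneg (n := n)
  have h2 := ArithmeticFunction.vonMangoldt_le_log (n := n)
  unfold aq
  rw [mul_comm]
  apply mul_le_mul _ h2 h1 (by linarith)
  split_ifs <;> simp; linarith

lemma en_nonneg (k : ℕ) (σ : ℝ) (n : ℕ) : 0 ≤ en k σ n := by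
  unfold en
  have := Real.log_natCast_nonneg n
  positivity

lemma logMul_iter (f : ℕ → ℂ) (k n : ℕ) : LSeries.logMul^[k] f n = (Real.log n : ℂ) ^ k * f n := by
  induction k generalizing f with
  | zero => simp
  | succ k ih =>
    rw [Function.iterate_succ, Function.comp, ih, LSeries.logMul, pow_succ]
    rw [← Complex.natCast_log]; ring

lemma term_eq {k : ℕ} (hk : 1 ≤ k) (f : ℕ → ℂ) (σ t : ℝ) (n : ℕ) :
    LSeries.term (LSeries.logMul^[k] f) ⟨σ, t⟩ n = f n * (en k σ n : ℂ) * Complex.exp (-(Complex.I * t * (Real.log n : ℝ))) := by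
  rw [LSeries.term_def]
  split_ifs with h
  · subst h; simp [en, zero_pow (by omega : k ≠ 0)]
  · have hn : (n : ℂ) ≠ 0 := by exact_mod_cast h
    have hn' : (0 : ℝ) < n := by exact_mod_cast Nat.pos_of_ne_zero h
    rw [logMul_iter, en, div_eq_mul_inv, ← Complex.cpow_neg, Complex.cpow_def_of_ne_zero hn, Real.rpow_def_of_pos hn']
    push_cast
    rw [← Complex.natCast_log]
    have : Complex.exp ((Complex.log n) * -(⟨σ, t⟩ : ℂ)) = Complex.exp (Complex.log n * -(σ : ℂ)) * Complex.exp (-(Complex.I * t * Complex.log n)) := by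
      rw [← Complex.exp_add]; congr 1
      have : (⟨σ, t⟩ : ℂ) = σ + t * Complex.I := by apply Complex.ext <;> simp
      rw [this]; ring
    rw [← Complex.natCast_log] at this
    rw [this]; ring

lemma term_summable {k : ℕ} {f : ℕ → ℂ} (hf : ∀ s : ℂ, 1 < s.re → LSeriesSummable f s) {σ : ℝ} (hσ : 1 < σ) (t : ℝ) :
    Summable (LSeries.term (LSeries.logMul^[k] f) ⟨σ, t⟩) := by
  apply LSeriesSummable_of_abscissaOfAbsConv_lt_re
  rw [LSeries.absicssaOfAbsConv_logPowMul]
  exact abscissa_lt hf hσ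

lemma F_bound {k : ℕ} (hk : 1 ≤ k) : ∃ C : ℝ, 0 < C ∧ ∀ (q : ℕ) [Fact q.Prime] (a : ZMod q), a ≠ 0 →
    ∀ (σ : ℝ), σ ∈ Set.Ioc (1:ℝ) 2 → ∀ t : ℝ,
    ‖∑' n : ℕ, ((aq q a n * en k σ n - en k σ n : ℝ) : ℂ) * Complex.exp (-(Complex.I * t * (Real.log n : ℝ)))‖
      ≤ C * (Real.sqrt q ^ (k + 1) * q ^ 2) * (|t| + 9) := by
  obtain ⟨C1, h1, h1'⟩ := D_chi k
  obtain ⟨C2, h2, h2'⟩ := D_zeta k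
  refine ⟨C1 + C2, by positivity, ?_⟩
  intro q hq a ha σ hσ t
  have hq1' : (1:ℝ) ≤ q := by exact_mod_cast hq.out.one_lt.le
  have hsq : 1 ≤ Real.sqrt q := Real.one_le_sqrt.mpr hq1'
  set s : ℂ := ⟨σ, t⟩ with hs
  have sv : Summable (LSeries.term (LSeries.logMul^[k] vL) s) := term_summable (fun s hs => ArithmeticFunction.LSeriesSummable_vonMangoldt hs) hσ.1 t
  have s1 : Summable (LSeries.term (LSeries.logMul^[k] 1) s) := term_summable (fun s hs => LSeriesSummable_one_iff.mpr hs) hσ.1 t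
  have sχ : ∀ χ : DirichletCharacter ℂ q, Summable (LSeries.term (LSeries.logMul^[k] (chiL χ)) s) := fun χ =>
    term_summable (fun s hs => DirichletCharacter.LSeriesSummable_twist_vonMangoldt χ hs) hσ.1 t
  have heq : ∀ n : ℕ, ((aq q a n * en k σ n - en k σ n : ℝ) : ℂ) * Complex.exp (-(Complex.I * t * (Real.log n : ℝ))) =
     (LSeries.term (LSeries.logMul^[k] vL) s n - LSeries.term (LSeries.logMul^[k] 1) s n) + 
      ∑ χ ∈ (Finset.univ : Finset (DirichletCharacter ℂ q)).erase 1, χ a⁻¹ * LSeries.term (LSeries.logMul^[k] (chiL χ)) s n := by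
    intro n
    simp only [hs, term_eq hk]
    have : ∑ χ ∈ (Finset.univ : Finset (DirichletCharacter ℂ q)).erase 1, χ a⁻¹ * (chiL χ n * (en k σ n : ℂ) * Complex.exp (-(Complex.I * t * (Real.log n : ℝ)))) =
      (∑ χ ∈ (Finset.univ : Finset (DirichletCharacter ℂ q)).erase 1, χ a⁻¹ * chiL χ n) * ((en k σ n : ℂ) * Complex.exp (-(Complex.I * t * (Real.log n : ℝ)))) := by
      rw [Finset.sum_mul]; apply Finset.sum_congr rfl; intro χ _; ring
    rw [this]
    push_cast
    rw [aq_char ha]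
    simp only [Pi.one_apply]
    ring
  simp only [heq]
  rw [(sv.sub s1).tsum_add (summable_sum (fun χ _ => (sχ χ).mul_left _)), sv.tsum_sub s1,
    Summable.tsum_finsetSum (fun χ _ => (sχ χ).mul_left _)]
  simp only [tsum_mul_left]
  refine (norm_add_le _ _).trans ?_
  have g1 : ‖∑' n, LSeries.term (LSeries.logMul^[k] vL) s n - ∑' n, LSeries.term (LSeries.logMul^[k] 1) s n‖ ≤ C2 * (|t| + 9) := h2' t σ hσ
  have g2 : ‖∑ χ ∈ (Finset.univ : Finset (DirichletCharacter ℂ q)).erase 1, χ a⁻¹ * ∑' n, LSeries.term (LSeries.logMul^[k] (chiL χ)) s n‖ ≤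
      q * (C1 * (Real.sqrt q ^ (k + 1) * q * (|t| + 9))) := by
    refine (norm_sum_le_of_le (f := fun χ : DirichletCharacter ℂ q => χ a⁻¹ * ∑' n, LSeries.term (LSeries.logMul^[k] (chiL χ)) s n) _ (n := fun _ => C1 * (Real.sqrt q ^ (k + 1) * q * (|t| + 9))) ?_).trans ?_
    · intro χ hχ
      rw [norm_mul]
      have b1 := DirichletCharacter.norm_le_one χ a⁻¹
      have b2 : ‖∑' n, LSeries.term (LSeries.logMul^[k] (chiL χ)) s n‖ ≤ _ := h1' q χ (Finset.ne_of_mem_erase hχ) t σ hσ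
      calc _ ≤ 1 * (C1 * (Real.sqrt q ^ (k + 1) * q * (|t| + 9))) := by gcongr
        _ = _ := one_mul _
    · rw [Finset.sum_const, nsmul_eq_mul]
      gcongr
      have hc := DirichletCharacter.card_eq_totient_of_hasEnoughRootsOfUnity ℂ q
      rw [Nat.card_eq_fintype_card, ← Finset.card_univ] at hc
      calc _ ≤ (Finset.univ : Finset (DirichletCharacter ℂ q)).card := Finset.card_le_card (Finset.erase_subset _ _)
        _ ≤ q := by rw [hc]; exact Nat.totient_le q
  have g3 : 1 ≤ Real.sqrt q ^ (k + 1) * q ^ 2 := one_le_mul_of_one_le_of_one_le (one_le_pow₀ hsq) (one_le_pow₀ hq1')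
  have g4 : C2 * (|t| + 9) ≤ C2 * (|t| + 9) * (Real.sqrt q ^ (k + 1) * q ^ 2) := le_mul_of_one_le_right (by positivity) g3
  calc _ ≤ _ := add_le_add g1 g2
    _ ≤ C2 * (|t| + 9) * (Real.sqrt q ^ (k + 1) * q ^ 2) + _ := add_le_add g4 le_rfl
    _ = _ := by ring

lemma en_sum {k : ℕ} (hk : 1 ≤ k) {X : ℝ} (hX : 1 ≤ X) :
    Summable (en k (1 + 1 / X)) ∧ ∑' n, en k (1 + 1 / X) n ≤ k.factorial * (2 * X) ^ (k + 1) := by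
  obtain ⟨g1, g2⟩ := tail_rpow 1 le_rfl (σ := 1 / (2 * X)) (by positivity)
  have h0 : en k (1 + 1 / X) 0 = 0 := by simp [en, zero_pow (by omega : k ≠ 0)]
  have h1 : en k (1 + 1 / X) 1 = 0 := by simp [en, zero_pow (by omega : k ≠ 0)]
  have hle : ∀ n : ℕ, en k (1 + 1 / X) (n + 2) ≤ k.factorial * (2 * X) ^ k * ((1 + 1 + n : ℕ) : ℝ) ^ (-(1 / (2 * X)) - 1) := by
    intro n
    have hn : ((n + 2 : ℕ) : ℝ) = ((1 + 1 + n : ℕ) : ℝ) := by push_cast; ring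
    rw [en, hn]
    set y : ℝ := ((1 + 1 + n : ℕ) : ℝ) with hy
    have hy1 : 1 ≤ y := by rw [hy]; push_cast; linarith [(Nat.cast_nonneg n : (0:ℝ) ≤ n)]
    have hl := Real.log_nonneg hy1
    have h := Real.pow_div_factorial_le_exp (Real.log y / (2 * X)) (by positivity) k
    rw [div_le_iff₀ (by positivity), div_pow, div_le_iff₀ (by positivity)] at h
    have e1 : y ^ (-(1 + 1 / X)) = y ^ (-(1 / (2 * X)) - 1) * Real.exp (-(Real.log y / (2 * X))) := by
      rw [Real.rpow_def_of_pos (by linarith), Real.rpow_def_of_pos (by linarith), ← Real.exp_add]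
      congr 1; field_simp; ring
    have e2 : Real.exp (Real.log y / (2 * X)) * Real.exp (-(Real.log y / (2 * X))) = 1 := by rw [← Real.exp_add]; simp
    rw [e1]
    calc _ ≤ (Real.exp (Real.log y / (2 * X)) * k.factorial * (2 * X) ^ k) * (y ^ (-(1 / (2 * X)) - 1) * Real.exp (-(Real.log y / (2 * X)))) := by gcongr
      _ = k.factorial * (2 * X) ^ k * y ^ (-(1 / (2 * X)) - 1) * (Real.exp (Real.log y / (2 * X)) * Real.exp (-(Real.log y / (2 * X)))) := by ring
      _ = _ := by rw [e2, mul_one]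
  have hs : Summable (fun n => en k (1 + 1 / X) (n + 2)) :=
    Summable.of_nonneg_of_le (fun n => en_nonneg _ _ _) hle (g1.mul_left _)
  have hs' := (summable_nat_add_iff 2).mp hs
  refine ⟨hs', ?_⟩
  rw [← hs'.sum_add_tsum_nat_add 2]
  simp only [Finset.sum_range_succ, Finset.sum_range_zero, h0, h1, zero_add]
  calc _ ≤ ∑' n : ℕ, k.factorial * (2 * X) ^ k * ((1 + 1 + n : ℕ) : ℝ) ^ (-(1 / (2 * X)) - 1) := hs.tsum_le_tsum hle (g1.mul_left _)
    _ = k.factorial * (2 * X) ^ k * ∑' n : ℕ, ((1 + 1 + n : ℕ) : ℝ) ^ (-(1 / (2 * X)) - 1) := tsum_mul_left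
    _ ≤ k.factorial * (2 * X) ^ k * (2 * X) := by
        gcongr
        refine g2.trans (le_of_eq ?_)
        simp
    _ = _ := by ring

lemma bn_sum {k : ℕ} {X : ℝ} (hX : 1 ≤ X) {q : ℕ} (hq : 1 ≤ q) (a : ZMod q) :
    Summable (fun n => aq q a n * en k (1 + 1 / X) n) ∧
    ∑' n, aq q a n * en k (1 + 1 / X) n ≤ q * ((k + 1).factorial * (2 * X) ^ (k + 2)) := by
  obtain ⟨h1, h2⟩ := en_sum (k := k + 1) (by omega) hX
  have hle : ∀ n, aq q a n * en k (1 + 1 / X) n ≤ q * en (k + 1) (1 + 1 / X) n := by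
    intro n
    have := mul_le_mul_of_nonneg_right (aq_le hq a n) (en_nonneg k (1 + 1 / X) n)
    refine this.trans (le_of_eq ?_)
    unfold en; ring
  have hs : Summable (fun n => aq q a n * en k (1 + 1 / X) n) :=
    Summable.of_nonneg_of_le (fun n => mul_nonneg (aq_nonneg hq a n) (en_nonneg _ _ _)) hle (h1.mul_left _)
  refine ⟨hs, (hs.tsum_le_tsum hle (h1.mul_left _)).trans ?_⟩
  rw [tsum_mul_left]
  gcongr

end TA

namespace TA
open ArithmeticFunction (vonMangoldt)

open Classical in
/-- windowed sum -/
noncomputable def win (f : ℕ → ℝ) (U V : ℝ) : ℝ := ∑' n : ℕ, if Real.log n ∈ Set.Icc U V then f n else 0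

open Classical in
lemma win_summable {f : ℕ → ℝ} (hf : ∀ n, 0 ≤ f n) (sf : Summable f) (U V : ℝ) :
    Summable (fun n : ℕ => if Real.log n ∈ Set.Icc U V then f n else 0) :=
  Summable.of_nonneg_of_le (fun n => by split_ifs <;> simp [hf n]) (fun n => by split_ifs <;> simp [hf n]) sf

lemma win_split {f : ℕ → ℝ} (hf : ∀ n, 0 ≤ f n) (sf : Summable f) (A B U V : ℝ) :
    win f A B ≤ win f U V + win f A U + win f V B := by
  unfold win
  rw [← (win_summable hf sf U V).tsum_add (win_summable hf sf A U),
    ← ((win_summable hf sf U V).add (win_summable hf sf A U)).tsum_add (win_summable hf sf V B)]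
  refine (win_summable hf sf A B).tsum_le_tsum (fun n => ?_) (((win_summable hf sf U V).add (win_summable hf sf A U)).add (win_summable hf sf V B))
  have h0 := hf n
  simp only [Set.mem_Icc]
  split_ifs <;> first | (simp; done) | linarith | skip
  all_goals (exfalso; grind)

lemma en_window {k : ℕ} {X : ℝ} (hX : 1 ≤ X) {α β : ℝ} (h0 : 0 < α) (h1 : α ≤ β) (h2 : β ≤ 2 * X) (h3 : β - α ≤ 1) :
    win (en k (1 + 1 / X)) α β ≤ (2 * X) ^ k * (2 * (β - α) + Real.exp (-α)) := by
  classical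
  unfold win
  set S := Finset.Icc ⌈Real.exp α⌉₊ ⌊Real.exp β⌋₊ with hS
  have hmem : ∀ n : ℕ, Real.log n ∈ Set.Icc α β → n ∈ S := by
    intro n hn
    have hn0 : (0:ℝ) < n := by
      rcases Nat.eq_zero_or_pos n with h | h
      · subst h; simp at hn; linarith [hn.1]
      · exact_mod_cast h
    rw [hS, Finset.mem_Icc]
    refine ⟨Nat.ceil_le.mpr ?_, Nat.le_floor ?_⟩
    · rw [← Real.exp_log hn0]; exact Real.exp_le_exp.mpr hn.1
    · rw [← Real.exp_log hn0]; exact Real.exp_le_exp.mpr hn.2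
  rw [tsum_eq_sum (s := S) (fun n hn => if_neg (fun h => hn (hmem n h)))]
  have hterm : ∀ n ∈ S, (if Real.log n ∈ Set.Icc α β then en k (1 + 1 / X) n else 0) ≤ (2 * X) ^ k * Real.exp (-α) := by
    intro n hn
    split_ifs with h
    · have hn1 : Real.exp α ≤ n := Nat.ceil_le.mp (Finset.mem_Icc.mp hn).1
      have hn2 : (1:ℝ) ≤ n := by linarith [Real.add_one_le_exp α]
      unfold en
      have : (n:ℝ) ^ (-(1 + 1 / X)) ≤ Real.exp (-α) := by
        calc (n:ℝ) ^ (-(1 + 1 / X)) ≤ (n:ℝ) ^ (-1 : ℝ) := by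
              apply Real.rpow_le_rpow_of_exponent_le hn2
              have : 0 < 1 / X := by positivity
              linarith
          _ = (n:ℝ)⁻¹ := Real.rpow_neg_one _
          _ ≤ (Real.exp α)⁻¹ := inv_anti₀ (Real.exp_pos _) hn1
          _ = _ := (Real.exp_neg _).symm
      have hl := Real.log_nonneg hn2
      have hl2 : Real.log n ≤ 2 * X := h.2.trans h2
      gcongr
    · positivity
  refine (Finset.sum_le_card_nsmul _ _ _ hterm).trans ?_
  rw [nsmul_eq_mul]
  have hcard : (S.card : ℝ) ≤ Real.exp β - Real.exp α + 1 := by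
    rw [hS, Nat.card_Icc]
    have a1 := Nat.le_ceil (Real.exp α)
    have a2 := Nat.floor_le (Real.exp_pos β).le
    have a3 := Real.exp_le_exp.mpr h1
    rcases le_total ⌈Real.exp α⌉₊ (⌊Real.exp β⌋₊ + 1) with h | h
    · rw [Nat.cast_sub h]; push_cast; linarith
    · rw [Nat.sub_eq_zero_of_le h]; push_cast; linarith
  have hexp : Real.exp (β - α) ≤ 1 + 2 * (β - α) := by
    have := Real.abs_exp_sub_one_le (x := β - α) (by rw [abs_of_nonneg (by linarith)]; linarith)
    rw [abs_of_nonneg (by linarith : 0 ≤ β - α)] at this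
    linarith [le_abs_self (Real.exp (β - α) - 1)]
  calc _ ≤ (Real.exp β - Real.exp α + 1) * ((2 * X) ^ k * Real.exp (-α)) := by gcongr
    _ = (2 * X) ^ k * (Real.exp β * Real.exp (-α) - Real.exp α * Real.exp (-α) + Real.exp (-α)) := by ring
    _ = (2 * X) ^ k * (Real.exp (β - α) - 1 + Real.exp (-α)) := by
        rw [← Real.exp_add, ← Real.exp_add]; simp [sub_eq_add_neg]
    _ ≤ _ := by gcongr; linarith

lemma exp_neg_le_pow {y : ℝ} (hy : 0 < y) (m : ℕ) : Real.exp (-y) ≤ m.factorial / y ^ m := by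
  have h := Real.pow_div_factorial_le_exp y hy.le m
  rw [Real.exp_neg, inv_le_comm₀ (Real.exp_pos _) (by positivity), inv_div]
  exact h

/-- edge estimate -/
lemma edge {X : ℝ} (hX : 102 ≤ X) {α β : ℝ} (h0 : X / 3 ≤ α) (h1 : α ≤ β) (h2 : β ≤ 2 * X) (h3 : β - α ≤ 4 / X ^ 3) :
    win (en 51 (1 + 1 / X)) α β ≤ 2 ^ 51 * 170 * X ^ 48 := by
  have hX3 : 4 / X ^ 3 ≤ 1 := by
    rw [div_le_one (by positivity)]
    have : X ^ 3 ≥ 102 ^ 3 := by gcongr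
    linarith
  refine (en_window (by linarith) (by linarith) h1 h2 (h3.trans hX3)).trans ?_
  have e1 : Real.exp (-α) ≤ 162 / X ^ 3 := by
    calc Real.exp (-α) ≤ Real.exp (-(X / 3)) := Real.exp_le_exp.mpr (by linarith)
      _ ≤ (3 : ℕ).factorial / (X / 3) ^ 3 := exp_neg_le_pow (by linarith) 3
      _ = _ := by
        rw [div_pow]; norm_num [Nat.factorial]; field_simp; norm_num
  calc (2 * X) ^ 51 * (2 * (β - α) + Real.exp (-α)) ≤ (2 * X) ^ 51 * (2 * (4 / X ^ 3) + 162 / X ^ 3) := by gcongr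
    _ = _ := by field_simp; ring

lemma comb1 {wb we we' a1 a2 s m K1 K2 K3 Z : ℝ} (h : wb ≤ we' + s + m) (h2 : we' ≤ we + a1 + a2)
    (h3 : a1 ≤ K1 * Z) (h4 : a2 ≤ K1 * Z) (hs : s ≤ K2 * Z) (h5 : m ≤ K3 * Z) : wb ≤ we + (K1 * 2 + K2 + K3) * Z := by
  linarith

lemma comb2 {wb we we' a1 a2 s m K1 K2 K3 Z : ℝ} (h : we' ≤ wb + s + m) (h2 : we ≤ we' + a1 + a2)
    (h3 : a1 ≤ K1 * Z) (h4 : a2 ≤ K1 * Z) (hs : s ≤ K2 * Z) (h5 : m ≤ K3 * Z) : we ≤ wb + (K1 * 2 + K2 + K3) * Z := by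
  linarith

lemma window_bound : ∃ C : ℝ, 0 < C ∧ ∀ X : ℝ, 102 ≤ X → ∀ (q : ℕ) [Fact q.Prime], (q : ℝ) ≤ 4 * X → ∀ a : ZMod q, a ≠ 0 →
    ∀ U V : ℝ, X / 2 ≤ U → U ≤ V → V ≤ X →
    |win (fun n => aq q a n * en 51 (1 + 1 / X) n) U V - win (en 51 (1 + 1 / X)) U V| ≤ C * X ^ 48 := by
  obtain ⟨C, hC, hF⟩ := F_bound (k := 51) (by norm_num)
  refine ⟨2 ^ 51 * 170 * 2 + 8 * (4 * ((52).factorial * 2 ^ 53) + (51).factorial * 2 ^ 52) + 8 * (C * 4 ^ 28) * 2, by positivity, ?_⟩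
  intro X hX q hq hqX a ha U V hU hUV hV
  set σ : ℝ := 1 + 1 / X with hσ
  have hσ' : σ ∈ Set.Ioc (1:ℝ) 2 := by
    have h1 : 0 < 1 / X := by positivity
    have h2 : 1 / X ≤ 1 := by rw [div_le_one (by linarith)]; linarith
    exact ⟨by linarith, by linarith⟩
  have hq1 : 1 ≤ q := hq.out.one_lt.le
  have hq1' : (1:ℝ) ≤ q := by exact_mod_cast hq1
  obtain ⟨se, se'⟩ := en_sum (k := 51) (by norm_num) (by linarith : 1 ≤ X)
  obtain ⟨sb, sb'⟩ := bn_sum (k := 51) (by linarith : 1 ≤ X) hq1 a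
  rw [← hσ] at se se' sb sb'
  set b : ℕ → ℝ := fun n => aq q a n * en 51 σ n with hb
  set e : ℕ → ℝ := en 51 σ with he
  have hb0 : ∀ n, 0 ≤ b n := fun n => mul_nonneg (aq_nonneg hq1 a n) (en_nonneg _ _ _)
  have he0 : ∀ n, 0 ≤ e n := fun n => en_nonneg _ _ _
  set M : ℝ := C * (Real.sqrt q ^ (51 + 1) * q ^ 2) with hM
  have hM0 : 0 ≤ M := by positivity
  have hMle : M ≤ C * 4 ^ 28 * X ^ 28 := by
    have : Real.sqrt q ^ (51 + 1) * (q:ℝ) ^ 2 = (q:ℝ) ^ 28 := by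
      have : Real.sqrt q ^ (51 + 1) = (Real.sqrt q ^ 2) ^ 26 := by rw [← pow_mul]
      rw [this, Real.sq_sqrt (by linarith), ← pow_add]
    rw [hM, this]
    calc C * (q:ℝ) ^ 28 ≤ C * (4 * X) ^ 28 := by gcongr
      _ = _ := by ring
  have hX1 : 1 ≤ X ^ 9 := one_le_pow₀ (by linarith)
  have hδ : 0 < 1 / X ^ 3 := by positivity
  have hδ1 : 1 / X ^ 3 ≤ 1 := by rw [div_le_one (by positivity)]; exact one_le_pow₀ (by linarith)
  have hF1 : ∀ t : ℝ, ‖∑' n, ((b n - e n : ℝ) : ℂ) * Complex.exp (-(Complex.I * t * (Real.log n : ℝ)))‖ ≤ M * (|t| + 9) :=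
    fun t => hF q a ha σ hσ' t
  have hF2 : ∀ t : ℝ, ‖∑' n, ((e n - b n : ℝ) : ℂ) * Complex.exp (-(Complex.I * t * (Real.log n : ℝ)))‖ ≤ M * (|t| + 9) := by
    intro t
    refine le_trans (le_of_eq ?_) (hF1 t)
    rw [← norm_neg, ← tsum_neg]
    congr 2; funext n; push_cast; ring
  have hη : 8 / (X ^ 9 * (1 / X ^ 3)) ^ 2 = 8 / X ^ 12 := by
    congr 1; field_simp
  have hsum : 8 / X ^ 12 * (∑' n, b n + ∑' n, e n) ≤ 8 * (4 * ((52).factorial * 2 ^ 53) + (51).factorial * 2 ^ 52) * X ^ 48 := by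
    have t1 : ∑' n, b n ≤ 4 * ((52).factorial * 2 ^ 53) * X ^ 54 := by
      refine sb'.trans ?_
      calc (q:ℝ) * ((51 + 1).factorial * (2 * X) ^ (51 + 2)) ≤ (4 * X) * ((51 + 1).factorial * (2 * X) ^ (51 + 2)) := by gcongr
        _ = 4 * ((51 + 1).factorial * 2 ^ 53) * X ^ 54 := by ring
    have t2 : ∑' n, e n ≤ (51).factorial * 2 ^ 52 * X ^ 54 := by
      refine se'.trans ?_
      calc ((51).factorial : ℝ) * (2 * X) ^ (51 + 1) = (51).factorial * 2 ^ 52 * X ^ 52 := by ring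
        _ ≤ (51).factorial * 2 ^ 52 * X ^ 54 := by gcongr <;> linarith
    calc 8 / X ^ 12 * (∑' n, b n + ∑' n, e n) ≤ 8 / X ^ 12 * (4 * ((52).factorial * 2 ^ 53) * X ^ 54 + (51).factorial * 2 ^ 52 * X ^ 54) := by
          gcongr
      _ = 8 * (4 * ((52).factorial * 2 ^ 53) + (51).factorial * 2 ^ 52) * X ^ 42 := by field_simp
      _ ≤ _ := by gcongr <;> linarith
  have hMT : ∀ L : ℝ, 0 ≤ L → L ≤ 2 * X → 8 * M * (X ^ 9) ^ 2 * L ≤ 8 * (C * 4 ^ 28) * 2 * X ^ 48 := by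
    intro L hL0 hL
    calc 8 * M * (X ^ 9) ^ 2 * L ≤ 8 * (C * 4 ^ 28 * X ^ 28) * (X ^ 9) ^ 2 * (2 * X) := by gcongr
      _ = 8 * (C * 4 ^ 28) * 2 * X ^ 47 := by ring
      _ ≤ _ := by gcongr <;> linarith
  have hd2 : 2 * (1 / X ^ 3) ≤ 4 / X ^ 3 := by rw [mul_one_div]; gcongr; norm_num
  have hd4 : 4 * (1 / X ^ 3) = 4 / X ^ 3 := by rw [mul_one_div]
  have hup : win b U V ≤ win e U V + (2 ^ 51 * 170 * 2 + 8 * (4 * ((52).factorial * 2 ^ 53) + (51).factorial * 2 ^ 52) + 8 * (C * 4 ^ 28) * 2) * X ^ 48 := by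
    have h := tauber hb0 he0 sb se hM0 hX1 hδ hF1 hUV
    rw [hη] at h
    have h2 := win_split he0 se (U - 2 * (1 / X ^ 3)) (V + 2 * (1 / X ^ 3)) U V
    have h3 := edge hX (α := U - 2 * (1 / X ^ 3)) (β := U) (by linarith) (by linarith) (by linarith) (by linarith)
    have h4 := edge hX (α := V) (β := V + 2 * (1 / X ^ 3)) (by linarith) (by linarith) (by linarith) (by linarith)
    have h5 := hMT (V - U + 2 * (1 / X ^ 3)) (by linarith) (by linarith)
    rw [← hσ] at h3 h4
    exact comb1 h h2 h3 h4 hsum h5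
  have hlow : win e U V ≤ win b U V + (2 ^ 51 * 170 * 2 + 8 * (4 * ((52).factorial * 2 ^ 53) + (51).factorial * 2 ^ 52) + 8 * (C * 4 ^ 28) * 2) * X ^ 48 := by
    rcases le_total (U + 2 * (1 / X ^ 3)) (V - 2 * (1 / X ^ 3)) with hc | hc
    · have h := tauber he0 hb0 se sb hM0 hX1 hδ hF2 hc
      rw [hη] at h
      have h2 := win_split he0 se U V (U + 2 * (1 / X ^ 3)) (V - 2 * (1 / X ^ 3))
      have h3 := edge hX (α := U) (β := U + 2 * (1 / X ^ 3)) (by linarith) (by linarith) (by linarith) (by linarith)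
      have h4 := edge hX (α := V - 2 * (1 / X ^ 3)) (β := V) (by linarith) (by linarith) (by linarith) (by linarith)
      have h5 := hMT (V - 2 * (1 / X ^ 3) - (U + 2 * (1 / X ^ 3)) + 2 * (1 / X ^ 3)) (by linarith) (by linarith)
      rw [← hσ] at h3 h4
      have e1 : U + 2 * (1 / X ^ 3) - 2 * (1 / X ^ 3) = U := by ring
      have e2 : V - 2 * (1 / X ^ 3) + 2 * (1 / X ^ 3) = V := by ring
      rw [e1, e2] at h
      rw [add_comm (tsum b)] at hsum
      exact comb2 h h2 h3 h4 hsum h5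
    · have h3 := edge hX (α := U) (β := V) (by linarith) hUV (by linarith) (by linarith)
      rw [← hσ] at h3
      have h4 : 0 ≤ win b U V := by
        unfold win
        exact tsum_nonneg (fun n => by split_ifs <;> simp [hb0 n])
      have h5 : 0 ≤ X ^ 48 := by positivity
      have h6 : 0 ≤ (8 * (4 * ((52).factorial * 2 ^ 53) + (51).factorial * 2 ^ 52 : ℝ) + 8 * (C * 4 ^ 28) * 2) * X ^ 48 := by positivity
      linarith
  rw [abs_le]
  constructor <;> linarith

end TA

namespace TA
open ArithmeticFunction (vonMangoldt)

lemma abel {d g : ℕ → ℝ} {N0 N : ℕ} {D : ℝ} (hN : N0 + 1 ≤ N) (hg0 : 0 ≤ g (N0 + 1))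
    (hg : ∀ m, N0 + 1 ≤ m → m + 1 ≤ N → g m ≤ g (m + 1))
    (hD : ∀ m, N0 + 1 ≤ m → m ≤ N → |∑ n ∈ Finset.Ioc N0 m, d n| ≤ D) :
    |∑ n ∈ Finset.Ioc N0 N, g n * d n| ≤ 2 * g N * D := by
  have key : ∀ m, N0 + 1 ≤ m → m ≤ N → 0 ≤ g m ∧
      |∑ n ∈ Finset.Ioc N0 m, g n * d n - g m * ∑ n ∈ Finset.Ioc N0 m, d n| ≤ D * (g m - g (N0 + 1)) := by
    intro m hm
    induction m, hm using Nat.le_induction with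
    | base => intro _; refine ⟨hg0, ?_⟩; simp
    | succ m hm ih =>
      intro hmN
      obtain ⟨h0, h1⟩ := ih (by omega)
      have h2 := hg m hm hmN
      refine ⟨h0.trans h2, ?_⟩
      have hI : ∀ f : ℕ → ℝ, ∑ n ∈ Finset.Ioc N0 (m + 1), f n = ∑ n ∈ Finset.Ioc N0 m, f n + f (m + 1) := by
        intro f
        rw [Finset.sum_Ioc_succ_top (by omega)]
      rw [hI, hI]
      have e : ∑ n ∈ Finset.Ioc N0 m, g n * d n + g (m + 1) * d (m + 1) - g (m + 1) * (∑ n ∈ Finset.Ioc N0 m, d n + d (m + 1))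
        = (∑ n ∈ Finset.Ioc N0 m, g n * d n - g m * ∑ n ∈ Finset.Ioc N0 m, d n) + (g m - g (m + 1)) * ∑ n ∈ Finset.Ioc N0 m, d n := by ring
      rw [e]
      refine (abs_add_le _ _).trans ?_
      rw [abs_mul, abs_of_nonpos (by linarith : g m - g (m + 1) ≤ 0)]
      have h3 := hD m hm (by omega)
      have h4 : -(g m - g (m + 1)) * |∑ n ∈ Finset.Ioc N0 m, d n| ≤ -(g m - g (m + 1)) * D := by
        apply mul_le_mul_of_nonneg_left h3; linarith
      linarith
  obtain ⟨h0, h1⟩ := key N hN le_rfl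
  have h2 := hD N hN le_rfl
  have hD0 : 0 ≤ D := (abs_nonneg _).trans h2
  have h3 : |g N * ∑ n ∈ Finset.Ioc N0 N, d n| ≤ g N * D := by
    rw [abs_mul, abs_of_nonneg h0]; gcongr
  have h4 := abs_sub_abs_le_abs_sub (∑ n ∈ Finset.Ioc N0 N, g n * d n) (g N * ∑ n ∈ Finset.Ioc N0 N, d n)
  nlinarith [mul_nonneg hD0 hg0]

lemma win_eq {f : ℕ → ℝ} {N0 m : ℕ} (h0 : 1 ≤ N0) (hm : N0 + 1 ≤ m) :
    win f (Real.log ((N0 + 1 : ℕ) : ℝ)) (Real.log m) = ∑ n ∈ Finset.Ioc N0 m, f n := by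
  classical
  unfold win
  have hiff : ∀ n : ℕ, Real.log n ∈ Set.Icc (Real.log ((N0 + 1 : ℕ) : ℝ)) (Real.log m) ↔ n ∈ Finset.Ioc N0 m := by
    intro n
    rw [Finset.mem_Ioc, Set.mem_Icc]
    rcases Nat.eq_zero_or_pos n with rfl | hn
    · have : 0 < Real.log ((N0 + 1 : ℕ) : ℝ) := Real.log_pos (by exact_mod_cast (by omega : 1 < N0 + 1))
      simp only [Nat.cast_zero, Real.log_zero]
      constructor
      · intro h; linarith [h.1]
      · intro h; omega
    · rw [Real.log_le_log_iff (by positivity) (by positivity), Real.log_le_log_iff (by positivity) (by exact_mod_cast (by omega : 0 < m))]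
      norm_cast
  rw [tsum_eq_sum (s := Finset.Ioc N0 m) (fun n hn => if_neg (fun h => hn ((hiff n).mp h)))]
  exact Finset.sum_congr rfl (fun n hn => if_pos ((hiff n).mpr hn))

lemma G_mono {σ s t : ℝ} (hσ : 1 ≤ σ) (hs : 51 ≤ s) (hst : s ≤ t) :
    Real.exp (σ * s) / s ^ 51 ≤ Real.exp (σ * t) / t ^ 51 := by
  have hs0 : 0 < s := by linarith
  have ht0 : 0 < t := by linarith
  rw [div_le_div_iff₀ (by positivity) (by positivity)]
  have h1 : t ≤ s * Real.exp ((t - s) / 51) := by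
    have := Real.add_one_le_exp ((t - s) / 51)
    have h2 : s * ((t - s) / 51 + 1) ≤ s * Real.exp ((t - s) / 51) := by gcongr
    nlinarith
  have h2 : t ^ 51 ≤ s ^ 51 * Real.exp (t - s) := by
    calc t ^ 51 ≤ (s * Real.exp ((t - s) / 51)) ^ 51 := by gcongr
      _ = s ^ 51 * Real.exp (t - s) := by
        rw [mul_pow, ← Real.exp_nat_mul]; congr 2; push_cast; ring
  calc Real.exp (σ * s) * t ^ 51 ≤ Real.exp (σ * s) * (s ^ 51 * Real.exp (t - s)) := by gcongr
    _ = Real.exp (σ * s + (t - s)) * s ^ 51 := by rw [Real.exp_add]; ring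
    _ ≤ _ := by gcongr; nlinarith

/-- main sum over `(√x, x]` -/
lemma aq_sum : ∃ C : ℝ, 0 < C ∧ ∀ x : ℝ, 102 ≤ Real.log x → 0 < x → ∀ (q : ℕ) [Fact q.Prime], (q : ℝ) ≤ 4 * Real.log x → ∀ a : ZMod q, a ≠ 0 →
    |∑ n ∈ Finset.Ioc ⌊Real.sqrt x⌋₊ ⌊x⌋₊, (aq q a n - 1)| ≤ C * x / Real.log x ^ 3 := by
  obtain ⟨C, hC, hw⟩ := window_bound
  refine ⟨2 * Real.exp 1 * C, by positivity, ?_⟩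
  intro x hX hx q hq hqX a ha
  set X := Real.log x with hXd
  have hX0 : 0 < X := by linarith
  have hxe : Real.exp X = x := Real.exp_log hx
  have hsq : Real.log (Real.sqrt x) = X / 2 := by rw [Real.log_sqrt hx.le]
  have hsq0 : 0 < Real.sqrt x := Real.sqrt_pos.mpr hx
  have hsx : Real.sqrt x = Real.exp (X / 2) := by rw [← hsq, Real.exp_log hsq0]
  have hs4 : 4 ≤ Real.sqrt x := by
    rw [hsx]; linarith [Real.add_one_le_exp (X / 2)]
  have hss : Real.sqrt x * Real.sqrt x = x := Real.mul_self_sqrt hx.le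
  set N0 := ⌊Real.sqrt x⌋₊ with hN0
  set N := ⌊x⌋₊ with hN
  have hN01 : 1 ≤ N0 := Nat.le_floor (by push_cast; linarith)
  have hN0N : N0 + 1 ≤ N := by
    apply Nat.le_floor
    push_cast
    have := Nat.floor_le hsq0.le
    nlinarith
  have hNx : (N:ℝ) ≤ x := Nat.floor_le hx.le
  have hN0x : Real.sqrt x ≤ ((N0 + 1 : ℕ) : ℝ) := by
    push_cast; exact (Nat.lt_floor_add_one _).le
  set σ : ℝ := 1 + 1 / X with hσ
  have hσ1 : 1 ≤ σ := by have : 0 < 1 / X := by positivity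
                         linarith
  have hlogs : ∀ m, N0 + 1 ≤ m → m ≤ N → X / 2 ≤ Real.log m ∧ Real.log m ≤ X ∧ (0:ℝ) < m := by
    intro m h1 h2
    have h1' : ((N0 + 1 : ℕ) : ℝ) ≤ m := by exact_mod_cast h1
    have h2' : (m : ℝ) ≤ N := by exact_mod_cast h2
    have hm0 : (0:ℝ) < m := by linarith
    refine ⟨?_, ?_, hm0⟩
    · rw [← hsq]; exact Real.log_le_log hsq0 (hN0x.trans h1')
    · exact Real.log_le_log hm0 (h2'.trans hNx)
  set G : ℝ → ℝ := fun s => Real.exp (σ * s) / s ^ 51 with hG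
  have hGe : ∀ m, N0 + 1 ≤ m → m ≤ N → G (Real.log m) * en 51 σ m = 1 := by
    intro m h1 h2
    obtain ⟨h3, h4, h5⟩ := hlogs m h1 h2
    have h6 : 0 < Real.log m := by linarith
    simp only [hG, en]
    rw [Real.rpow_def_of_pos h5]
    have : Real.exp (σ * Real.log m) / Real.log m ^ 51 * (Real.log m ^ 51 * Real.exp (Real.log m * -σ)) =
      Real.exp (σ * Real.log m) * Real.exp (Real.log m * -σ) := by field_simp
    rw [this, ← Real.exp_add]
    simp [mul_comm]
  have hab := abel (d := fun n => aq q a n * en 51 σ n - en 51 σ n) (g := fun n => G (Real.log n)) (D := C * X ^ 48) hN0N ?_ ?_ ?_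
  · have hGN : G (Real.log N) ≤ Real.exp 1 * x / X ^ 51 := by
      obtain ⟨h3, h4, h5⟩ := hlogs N hN0N le_rfl
      refine (G_mono hσ1 (by linarith) h4).trans (le_of_eq ?_)
      congr 1
      rw [hσ, add_mul, Real.exp_add, one_mul, hxe]
      have : 1 / X * X = 1 := by field_simp
      rw [this]; ring
    have he : ∑ n ∈ Finset.Ioc N0 N, (aq q a n - 1) = ∑ n ∈ Finset.Ioc N0 N, G (Real.log n) * (aq q a n * en 51 σ n - en 51 σ n) := by
      apply Finset.sum_congr rfl
      intro n hn
      obtain ⟨h1, h2⟩ := Finset.mem_Ioc.mp hn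
      have := hGe n h1 h2
      linear_combination (1 - aq q a n) * this
    rw [he]
    refine hab.trans ?_
    calc 2 * G (Real.log N) * (C * X ^ 48) ≤ 2 * (Real.exp 1 * x / X ^ 51) * (C * X ^ 48) := by gcongr
      _ = _ := by field_simp
  · obtain ⟨h3, h4, h5⟩ := hlogs (N0 + 1) le_rfl hN0N
    simp only [hG]
    have : 0 < Real.log ((N0 + 1 : ℕ) : ℝ) := by linarith
    positivity
  · intro m h1 h2
    obtain ⟨h3, h4, h5⟩ := hlogs m h1 (by omega)
    obtain ⟨h3', h4', h5'⟩ := hlogs (m + 1) (by omega) h2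
    apply G_mono hσ1 (by linarith)
    exact Real.log_le_log h5 (by push_cast; linarith)
  · intro m h1 h2
    obtain ⟨h3, h4, h5⟩ := hlogs m h1 h2
    obtain ⟨h3', h4', h5'⟩ := hlogs (N0 + 1) le_rfl hN0N
    have := hw X hX q hqX a ha (Real.log ((N0 + 1 : ℕ) : ℝ)) (Real.log m) h3' (Real.log_le_log h5' (by exact_mod_cast h1)) h4
    rw [win_eq hN01 h1, win_eq hN01 h1, ← Finset.sum_sub_distrib] at this
    exact this

open Classical in
/-- Chebyshev function in residue class -/
noncomputable def th (q : ℕ) (a : ZMod q) (u : ℝ) : ℝ :=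
  ∑ n ∈ (Finset.Ioc 0 ⌊u⌋₊).filter (fun n : ℕ => n.Prime ∧ (n : ZMod q) = a), Real.log n

lemma th_aq {q : ℕ} [hq : Fact q.Prime] {a : ZMod q} (ha : a ≠ 0) {x : ℝ} (hx : 1 ≤ x) :
    ((q:ℝ) - 1) * th q a x ≤ ∑ n ∈ Finset.Ioc 0 ⌊x⌋₊, aq q a n ∧
    ∑ n ∈ Finset.Ioc 0 ⌊x⌋₊, aq q a n ≤ ((q:ℝ) - 1) * th q a x + q * (2 * Real.sqrt x * Real.log x) + Real.log q := by
  classical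
  have hq1 : (1:ℝ) ≤ q := by exact_mod_cast hq.out.one_lt.le
  have hth : ((q:ℝ) - 1) * th q a x = ∑ n ∈ Finset.Ioc 0 ⌊x⌋₊, if n.Prime ∧ (n : ZMod q) = a then ((q:ℝ) - 1) * Real.log n else 0 := by
    unfold th
    rw [Finset.mul_sum, Finset.sum_filter]
  have hqn : ∀ n : ℕ, n.Prime → (n : ZMod q) = 0 → n = q := by
    intro n hn h
    rw [ZMod.natCast_eq_zero_iff] at h
    exact ((Nat.prime_dvd_prime_iff_eq hq.out hn).mp h).symm
  constructor
  · rw [hth]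
    apply Finset.sum_le_sum
    intro n _
    split_ifs with h
    · unfold aq
      rw [if_pos h.2, if_neg (by rw [h.2]; exact ha), ArithmeticFunction.vonMangoldt_apply_prime h.1]
      linarith
    · exact aq_nonneg hq.out.one_lt.le a n
  · have h1 : ∀ n ∈ Finset.Ioc 0 ⌊x⌋₊, aq q a n ≤ (if n.Prime ∧ (n : ZMod q) = a then ((q:ℝ) - 1) * Real.log n else 0)
        + q * (if ¬ n.Prime then vonMangoldt n else 0) + (if n = q then Real.log q else 0) := by
      intro n _
      have hv := ArithmeticFunction.vonMangoldt_nonneg (n := n)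
      have hl : 0 ≤ Real.log q := Real.log_nonneg hq1
      by_cases hn : n.Prime
      · unfold aq
        by_cases h0 : (n : ZMod q) = 0
        · have := hqn n hn h0
          have hne : (n : ZMod q) ≠ a := by rw [h0]; exact ha.symm
          rw [ArithmeticFunction.vonMangoldt_apply_prime hn]
          rw [if_pos h0, if_neg hne, if_neg (by tauto), if_neg (by simpa using hn), if_pos this, this]
          simp
        · rw [if_neg h0, ArithmeticFunction.vonMangoldt_apply_prime hn]
          by_cases h2 : (n : ZMod q) = a
          · rw [if_pos h2, if_pos ⟨hn, h2⟩]
            have : 0 ≤ (if n = q then Real.log q else 0) := by split_ifs <;> simp [hl]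
            simp only [hn, not_true, if_false]
            linarith
          · rw [if_neg h2, if_neg (by tauto)]
            simp only [hn, not_true, if_false]
            split_ifs <;> simp [hl]
      · rw [if_neg (by tauto), if_pos hn]
        have h3 : aq q a n ≤ q * vonMangoldt n := by
          unfold aq
          rw [mul_comm]
          apply mul_le_mul_of_nonneg_right _ hv
          split_ifs with h4 h5 h5
          · exact absurd (h5.symm.trans h4) ha
          · linarith
          · linarith
          · linarith
        have : 0 ≤ (if n = q then Real.log q else 0) := by split_ifs <;> simp [hl]
        linarith
    refine (Finset.sum_le_sum h1).trans ?_
    rw [Finset.sum_add_distrib, Finset.sum_add_distrib, ← hth, ← Finset.mul_sum]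
    have h2 : ∑ n ∈ Finset.Ioc 0 ⌊x⌋₊, (if ¬ n.Prime then vonMangoldt n else 0) ≤ 2 * Real.sqrt x * Real.log x := by
      rw [← Finset.sum_filter]
      have := Chebyshev.psi_sub_theta_le hx
      rw [Chebyshev.psi_sub_theta_eq_sum_not_prime] at this
      exact this
    have h3 : ∑ n ∈ Finset.Ioc 0 ⌊x⌋₊, (if n = q then Real.log q else 0) ≤ Real.log q := by
      rw [Finset.sum_ite_eq']
      split_ifs <;> simp [Real.log_nonneg hq1]
    gcongr

/-- prime number theorem in progressions -/
theorem pntap : ∃ C : ℝ, 0 < C ∧ ∀ x : ℝ, 102 ≤ Real.log x → 0 < x → ∀ (q : ℕ) [Fact q.Prime], (q : ℝ) ≤ 4 * Real.log x → ∀ a : ZMod q, a ≠ 0 →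
    |th q a x - x / ((q:ℝ) - 1)| ≤ C * x / Real.log x ^ 3 := by
  obtain ⟨C, hC, hs⟩ := aq_sum
  refine ⟨C + 15 * 3840, by positivity, ?_⟩
  intro x hX hx q hq hqX a ha
  have h0 := hs x hX hx q hqX a ha
  set X := Real.log x with hXd
  have hX0 : 0 < X := by linarith
  have hxe : Real.exp X = x := Real.exp_log hx
  have hx1 : 1 ≤ x := by rw [← hxe]; linarith [Real.add_one_le_exp X]
  have hsx : Real.sqrt x = Real.exp (X / 2) := by
    rw [← Real.exp_log (Real.sqrt_pos.mpr hx), Real.log_sqrt hx.le]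
  have hs1 : 1 ≤ Real.sqrt x := by rw [hsx]; linarith [Real.add_one_le_exp (X / 2)]
  have hq2 : (2:ℝ) ≤ q := by exact_mod_cast hq.out.two_le
  obtain ⟨h1, h2⟩ := th_aq ha hx1
  have hsmall : X ^ 2 * Real.sqrt x ≤ 3840 * x / X ^ 3 := by
    have := exp_neg_le_pow (y := X / 2) (by positivity) 5
    have e1 : Real.sqrt x = x * Real.exp (-(X / 2)) := by
      rw [hsx, ← hxe, ← Real.exp_add]; congr 1; ring
    rw [e1]
    calc X ^ 2 * (x * Real.exp (-(X / 2))) ≤ X ^ 2 * (x * ((5).factorial / (X / 2) ^ 5)) := by gcongr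
      _ = _ := by
        simp only [Nat.factorial]; push_cast; field_simp; norm_num
  have hle : ⌊Real.sqrt x⌋₊ ≤ ⌊x⌋₊ := Nat.floor_mono (by nlinarith [Real.mul_self_sqrt hx.le])
  have hA : |∑ n ∈ Finset.Ioc 0 ⌊x⌋₊, aq q a n - x| ≤ C * x / X ^ 3 + 6 * (X ^ 2 * Real.sqrt x) := by
    have hsplit : ∑ n ∈ Finset.Ioc 0 ⌊x⌋₊, aq q a n = ∑ n ∈ Finset.Ioc 0 ⌊Real.sqrt x⌋₊, aq q a n
        + (∑ n ∈ Finset.Ioc ⌊Real.sqrt x⌋₊ ⌊x⌋₊, (aq q a n - 1) + ((⌊x⌋₊ : ℝ) - ⌊Real.sqrt x⌋₊)) := by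
      rw [← Finset.sum_Ioc_consecutive _ (Nat.zero_le _) hle, Finset.sum_sub_distrib]
      simp [Nat.cast_sub hle]
    have hfl := Nat.floor_le (Real.sqrt_nonneg x)
    have hb : ∑ n ∈ Finset.Ioc 0 ⌊Real.sqrt x⌋₊, aq q a n ≤ 4 * (X ^ 2 * Real.sqrt x) := by
      have : ∀ n ∈ Finset.Ioc 0 ⌊Real.sqrt x⌋₊, aq q a n ≤ 4 * X * X := by
        intro n hn
        obtain ⟨m1, m2⟩ := Finset.mem_Ioc.mp hn
        have m3 : (n:ℝ) ≤ x := le_trans (le_trans (by exact_mod_cast m2 : (n:ℝ) ≤ ⌊Real.sqrt x⌋₊) hfl) (by nlinarith [Real.mul_self_sqrt hx.le])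
        refine (aq_le hq.out.one_lt.le a n).trans ?_
        have : Real.log n ≤ X := Real.log_le_log (by exact_mod_cast m1) m3
        have := Real.log_natCast_nonneg n
        gcongr
      refine (Finset.sum_le_card_nsmul _ _ _ this).trans ?_
      rw [nsmul_eq_mul, Nat.card_Ioc, Nat.sub_zero]
      calc (⌊Real.sqrt x⌋₊ : ℝ) * (4 * X * X) ≤ Real.sqrt x * (4 * X * X) := by gcongr
        _ = _ := by ring
    have hb0 : 0 ≤ ∑ n ∈ Finset.Ioc 0 ⌊Real.sqrt x⌋₊, aq q a n := Finset.sum_nonneg (fun n _ => aq_nonneg hq.out.one_lt.le a n)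
    have f1 := Nat.floor_le hx.le
    have f2 := (Nat.lt_floor_add_one x).le
    have f3 : (0:ℝ) ≤ ⌊Real.sqrt x⌋₊ := Nat.cast_nonneg _
    have hX2 : Real.sqrt x ≤ X ^ 2 * Real.sqrt x :=
      le_mul_of_one_le_left (by linarith) (one_le_pow₀ (by linarith))
    rw [hsplit]
    rw [abs_le] at h0 ⊢
    constructor <;> linarith [h0.1, h0.2]
  have hlq : Real.log q ≤ X ^ 2 * Real.sqrt x := by
    have := Real.log_le_sub_one_of_pos (by linarith : (0:ℝ) < q)
    nlinarith
  have hqq : (q:ℝ) * (2 * Real.sqrt x * X) ≤ 8 * (X ^ 2 * Real.sqrt x) := by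
    calc (q:ℝ) * (2 * Real.sqrt x * X) ≤ (4 * X) * (2 * Real.sqrt x * X) := by gcongr
      _ = _ := by ring
  have hB : |((q:ℝ) - 1) * th q a x - x| ≤ (C + 15 * 3840) * x / X ^ 3 := by
    have : (C + 15 * 3840) * x / X ^ 3 = C * x / X ^ 3 + 15 * (3840 * x / X ^ 3) := by ring
    rw [this]
    rw [abs_le] at hA ⊢
    constructor <;> linarith [hA.1, hA.2]
  have hq0 : (0:ℝ) < q - 1 := by linarith
  have e : th q a x - x / ((q:ℝ) - 1) = (((q:ℝ) - 1) * th q a x - x) / (q - 1) := by field_simp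
  rw [e, abs_div, abs_of_pos hq0, div_le_iff₀ hq0]
  refine hB.trans ?_
  have : 0 ≤ (C + 15 * 3840) * x / X ^ 3 := by positivity
  nlinarith

end TA

namespace TA

open Classical in
lemma interval_of_conv {K : ℕ} {P : ℕ → Prop} (hP : ∀ a b c, a ≤ b → b ≤ c → P a → P c → P b) :
    ∃ A B, A ≤ B ∧ B ≤ K ∧ (Finset.Ioc 0 K).filter P = Finset.Ioc A B := by
  by_cases hne : ((Finset.Ioc 0 K).filter P).Nonempty
  · set S := (Finset.Ioc 0 K).filter P with hS
    have h1 := Finset.min'_mem S hne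
    have h2 := Finset.max'_mem S hne
    have h12 := Finset.min'_le S _ h2
    have hmem : ∀ n, n ∈ S → (0 < n ∧ n ≤ K) ∧ P n := by
      intro n hn
      rwa [hS, Finset.mem_filter, Finset.mem_Ioc] at hn
    replace h1 := hmem _ h1
    replace h2 := hmem _ h2
    refine ⟨S.min' hne - 1, S.max' hne, by omega, by omega, ?_⟩
    ext n
    constructor
    · intro hn
      have h3 := Finset.min'_le S n hn
      have h4 := Finset.le_max' S n hn
      rw [Finset.mem_Ioc]; omega
    · intro hn
      rw [Finset.mem_Ioc] at hn
      rw [hS, Finset.mem_filter, Finset.mem_Ioc]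
      refine ⟨by omega, hP _ n _ (by omega) hn.2 h1.2 h2.2⟩
  · refine ⟨0, 0, le_rfl, Nat.zero_le _, ?_⟩
    rw [Finset.not_nonempty_iff_eq_empty] at hne
    rw [hne]; simp

open Classical in
lemma double {l : ℕ → ℝ} (hl : ∀ n, 0 ≤ l n) {c E : ℝ} (hc : 0 ≤ c) {K : ℕ}
    (hE : ∀ A B, A ≤ B → B ≤ K → |∑ n ∈ Finset.Ioc A B, l n - c * ((B:ℝ) - A)| ≤ E)
    (R : ℕ → ℕ → Prop)
    (h1 : ∀ q a b d, a ≤ b → b ≤ d → R q a → R q d → R q b)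
    (h2 : ∀ r a b d, a ≤ b → b ≤ d → R a r → R d r → R b r) :
    |∑ q ∈ Finset.Ioc 0 K, ∑ r ∈ Finset.Ioc 0 K, (if R q r then l q * l r else 0)
      - c ^ 2 * ∑ q ∈ Finset.Ioc 0 K, ∑ r ∈ Finset.Ioc 0 K, (if R q r then (1:ℝ) else 0)| ≤ E * (2 * c * K + E) := by
  have hone : ∀ P : ℕ → Prop, (∀ a b c, a ≤ b → b ≤ c → P a → P c → P b) →
      |∑ n ∈ Finset.Ioc 0 K, (if P n then l n else 0) - c * ∑ n ∈ Finset.Ioc 0 K, (if P n then (1:ℝ) else 0)| ≤ E := by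
    intro P hP
    obtain ⟨A, B, hAB, hBK, hI⟩ := interval_of_conv (K := K) hP
    rw [← Finset.sum_filter, ← Finset.sum_filter, hI]
    have := hE A B hAB hBK
    simpa [Nat.cast_sub hAB] using this
  have hE0 : 0 ≤ E := (abs_nonneg _).trans (hE 0 0 le_rfl (Nat.zero_le _))
  have hL : ∑ n ∈ Finset.Ioc 0 K, l n ≤ c * K + E := by
    have := (abs_le.mp (hE 0 K (Nat.zero_le _) le_rfl)).2
    simp at this; linarith
  set F : ℕ → ℝ := fun q => ∑ r ∈ Finset.Ioc 0 K, (if R q r then l r else 0) with hF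
  set G : ℕ → ℝ := fun q => ∑ r ∈ Finset.Ioc 0 K, (if R q r then (1:ℝ) else 0) with hG
  have e1 : ∑ q ∈ Finset.Ioc 0 K, ∑ r ∈ Finset.Ioc 0 K, (if R q r then l q * l r else 0) = ∑ q ∈ Finset.Ioc 0 K, l q * F q := by
    apply Finset.sum_congr rfl; intro q _
    simp only [hF, Finset.mul_sum, mul_ite, mul_zero]
  have e2 : ∑ q ∈ Finset.Ioc 0 K, l q * G q = ∑ r ∈ Finset.Ioc 0 K, ∑ q ∈ Finset.Ioc 0 K, (if R q r then l q else 0) := by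
    rw [Finset.sum_comm]
    apply Finset.sum_congr rfl; intro q _
    simp only [hG, Finset.mul_sum, mul_ite, mul_zero, mul_one]
  have e3 : ∑ q ∈ Finset.Ioc 0 K, G q = ∑ r ∈ Finset.Ioc 0 K, ∑ q ∈ Finset.Ioc 0 K, (if R q r then (1:ℝ) else 0) := by
    rw [Finset.sum_comm]
  have b1 : |∑ q ∈ Finset.Ioc 0 K, l q * F q - c * ∑ q ∈ Finset.Ioc 0 K, l q * G q| ≤ (c * K + E) * E := by
    have : ∑ q ∈ Finset.Ioc 0 K, l q * F q - c * ∑ q ∈ Finset.Ioc 0 K, l q * G q = ∑ q ∈ Finset.Ioc 0 K, l q * (F q - c * G q) := by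
      rw [Finset.mul_sum, ← Finset.sum_sub_distrib]
      apply Finset.sum_congr rfl; intro q _; ring
    rw [this]
    refine (Finset.abs_sum_le_sum_abs _ _).trans ?_
    calc ∑ q ∈ Finset.Ioc 0 K, |l q * (F q - c * G q)| ≤ ∑ q ∈ Finset.Ioc 0 K, l q * E := by
          apply Finset.sum_le_sum; intro q _
          rw [abs_mul, abs_of_nonneg (hl q)]
          exact mul_le_mul_of_nonneg_left (hone (R q) (h1 q)) (hl q)
      _ = (∑ q ∈ Finset.Ioc 0 K, l q) * E := by rw [Finset.sum_mul]
      _ ≤ _ := by gcongr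
  have b2 : |∑ q ∈ Finset.Ioc 0 K, l q * G q - c * ∑ q ∈ Finset.Ioc 0 K, G q| ≤ K * E := by
    rw [e2, e3, Finset.mul_sum, ← Finset.sum_sub_distrib]
    refine (Finset.abs_sum_le_sum_abs _ _).trans ?_
    refine (Finset.sum_le_card_nsmul _ _ E (fun r _ => hone (fun q => R q r) (h2 r))).trans ?_
    simp
  rw [e1]
  have e4 : ∑ q ∈ Finset.Ioc 0 K, l q * F q - c ^ 2 * ∑ q ∈ Finset.Ioc 0 K, G q =
     (∑ q ∈ Finset.Ioc 0 K, l q * F q - c * ∑ q ∈ Finset.Ioc 0 K, l q * G q)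
      + c * (∑ q ∈ Finset.Ioc 0 K, l q * G q - c * ∑ q ∈ Finset.Ioc 0 K, G q) := by ring
  rw [e4]
  refine (abs_add_le _ _).trans ?_
  rw [abs_mul, abs_of_nonneg hc]
  have b3 := mul_le_mul_of_nonneg_left b2 hc
  linarith

/-- log-weight on primes in the residue class -/
noncomputable def lw (p s n : ℕ) : ℝ := if n.Prime ∧ n % p = s then Real.log n else 0

lemma lw_nonneg (p s n : ℕ) : 0 ≤ lw p s n := by
  unfold lw; split_ifs
  · exact Real.log_natCast_nonneg n
  · exact le_rfl

lemma th_lw {p s : ℕ} (hs : s < p) (B : ℕ) : ∑ n ∈ Finset.Ioc 0 B, lw p s n = th p (s : ZMod p) B := by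
  unfold th lw
  rw [Nat.floor_natCast, Finset.sum_filter]
  apply Finset.sum_congr rfl
  intro n _
  have : (n : ZMod p) = (s : ZMod p) ↔ n % p = s := by
    rw [ZMod.natCast_eq_natCast_iff', Nat.mod_eq_of_lt hs]
  simp only [this]

lemma lw_interval : ∃ C : ℝ, 0 < C ∧ ∀ x : ℝ, 408 ≤ Real.log x → 0 < x → ∀ p : ℕ, p.Prime → (p : ℝ) ≤ Real.log x → ∀ s : ℕ, 0 < s → s < p →
    ∀ A B : ℕ, A ≤ B → B ≤ ⌊Real.sqrt x⌋₊ →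
    |∑ n ∈ Finset.Ioc A B, lw p s n - 1 / ((p:ℝ) - 1) * ((B:ℝ) - A)| ≤ C * Real.sqrt x / Real.log x ^ 3 := by
  obtain ⟨C, hC, h⟩ := pntap
  refine ⟨2 * (64 * C + 2 * 6144), by positivity, ?_⟩
  intro x hX hx p hp hpX s hs0 hsp A B hAB hB
  haveI : Fact p.Prime := ⟨hp⟩
  set X := Real.log x with hXd
  have hX0 : 0 < X := by linarith
  have hp2 : (2:ℝ) ≤ p := by exact_mod_cast hp.two_le
  have ha : (s : ZMod p) ≠ 0 := by
    rw [Ne, ZMod.natCast_eq_zero_iff]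
    exact fun hd => absurd (Nat.le_of_dvd hs0 hd) (by omega)
  have hsx : Real.sqrt x = Real.exp (X / 2) := by
    rw [← Real.exp_log (Real.sqrt_pos.mpr hx), Real.log_sqrt hx.le]
  have hsp : 0 < Real.sqrt x := Real.sqrt_pos.mpr hx
  have key : ∀ B : ℕ, B ≤ ⌊Real.sqrt x⌋₊ → |∑ n ∈ Finset.Ioc 0 B, lw p s n - 1 / ((p:ℝ) - 1) * B| ≤ (64 * C + 2 * 6144) * Real.sqrt x / X ^ 3 := by
    intro B hB
    have hBx : (B:ℝ) ≤ Real.sqrt x := le_trans (by exact_mod_cast hB) (Nat.floor_le hsp.le)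
    rcases le_total (X / 4) (Real.log B) with hc | hc
    · have hB0 : (0:ℝ) < B := by
        rcases Nat.eq_zero_or_pos B with h0 | h0
        · subst h0; simp at hc; linarith
        · exact_mod_cast h0
      have h1 := h B (by linarith) hB0 p (by linarith) (s : ZMod p) ha
      rw [th_lw (by assumption), one_div_mul_eq_div]
      refine h1.trans ?_
      calc C * B / Real.log B ^ 3 ≤ C * Real.sqrt x / (X / 4) ^ 3 := by gcongr
        _ = 64 * C * Real.sqrt x / X ^ 3 := by field_simp; ring
        _ ≤ _ := by gcongr; linarith
    · have hBle : (B:ℝ) ≤ Real.exp (X / 4) := by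
        rcases Nat.eq_zero_or_pos B with h0 | h0
        · subst h0; simp; positivity
        · rw [← Real.exp_log (by exact_mod_cast h0 : (0:ℝ) < B)]; exact Real.exp_le_exp.mpr hc
      have h0 : 0 ≤ ∑ n ∈ Finset.Ioc 0 B, lw p s n := Finset.sum_nonneg (fun n _ => lw_nonneg _ _ _)
      have h1 : ∑ n ∈ Finset.Ioc 0 B, lw p s n ≤ B * X := by
        refine (Finset.sum_le_card_nsmul _ _ X (fun n hn => ?_)).trans (le_of_eq ?_)
        · obtain ⟨m1, m2⟩ := Finset.mem_Ioc.mp hn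
          unfold lw
          split_ifs
          · have : Real.log n ≤ Real.log B := Real.log_le_log (by exact_mod_cast m1) (by exact_mod_cast m2)
            linarith
          · linarith
        · simp
      have hinv : 1 / ((p:ℝ) - 1) ≤ 1 := by rw [div_le_one (by linarith)]; linarith
      have hinv0 : 0 ≤ 1 / ((p:ℝ) - 1) := div_nonneg zero_le_one (by linarith)
      have hB0 : (0:ℝ) ≤ B := Nat.cast_nonneg _
      have h2 : 1 / ((p:ℝ) - 1) * B ≤ B * X := by nlinarith
      have h2' : 0 ≤ 1 / ((p:ℝ) - 1) * B := by positivity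
      have h3 : B * X ≤ 6144 * Real.sqrt x / X ^ 3 := by
        have := exp_neg_le_pow (y := X / 4) (by positivity) 4
        have e1 : Real.exp (X / 4) = Real.sqrt x * Real.exp (-(X / 4)) := by
          rw [hsx, ← Real.exp_add]; congr 1; ring
        calc B * X ≤ Real.exp (X / 4) * X := by gcongr
          _ = Real.sqrt x * Real.exp (-(X / 4)) * X := by rw [e1]
          _ ≤ Real.sqrt x * ((4).factorial / (X / 4) ^ 4) * X := by gcongr
          _ = _ := by simp only [Nat.factorial]; push_cast; field_simp; norm_num
      have h4 : (64 * C + 2 * 6144) * Real.sqrt x / X ^ 3 = 64 * C * Real.sqrt x / X ^ 3 + 2 * (6144 * Real.sqrt x / X ^ 3) := by ring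
      have h5 : 0 ≤ 64 * C * Real.sqrt x / X ^ 3 := by positivity
      rw [abs_le]
      constructor <;> linarith
  have hs := Finset.sum_Ioc_consecutive (lw p s) (Nat.zero_le A) hAB
  have k1 := key B hB
  have k2 := key A (hAB.trans hB)
  have e : 2 * (64 * C + 2 * 6144) * Real.sqrt x / X ^ 3 = 2 * ((64 * C + 2 * 6144) * Real.sqrt x / X ^ 3) := by ring
  rw [e]
  rw [← hs] at k1
  rw [abs_le] at k1 k2 ⊢
  rw [mul_sub]
  constructor <;> linarith [k1.1, k1.2, k2.1, k2.2]

end TA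

namespace TA

/-- geometric region -/
def Rg (x : ℝ) (p q r : ℕ) : Prop :=
  q < r ∧ ((p * q * r : ℕ) : ℝ) ≤ x ∧ (r:ℝ) < (((p:ℝ) - 1) / ((p:ℝ) - 2)) * ((q:ℝ) - 1)

open Classical in
/-- slice count -/
noncomputable def gs (x : ℝ) (p K q : ℕ) : ℝ := ∑ r ∈ Finset.Ioc 0 K, (if Rg x p q r then (1:ℝ) else 0)

lemma kap {p : ℕ} (hp : 3 ≤ p) : 1 < ((p:ℝ) - 1) / ((p:ℝ) - 2) ∧ ((p:ℝ) - 1) / ((p:ℝ) - 2) ≤ 2 := by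
  have : (3:ℝ) ≤ p := by exact_mod_cast hp
  constructor
  · rw [lt_div_iff₀ (by linarith)]; linarith
  · rw [div_le_iff₀ (by linarith)]; linarith

lemma Rg_bound {x : ℝ} {p q r : ℕ} (hp : 3 ≤ p) (h : Rg x p q r) : 0 < q ∧ (r:ℝ) ≤ Real.sqrt x ∧ (q:ℝ) ≤ Real.sqrt (x / p) := by
  obtain ⟨h1, h2, h3⟩ := h
  have hk := kap hp
  set κ := ((p:ℝ) - 1) / ((p:ℝ) - 2)
  have hq0 : 0 < q := by
    rcases Nat.eq_zero_or_pos q with h | h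
    · subst h; simp at h3
      have : (0:ℝ) ≤ r := Nat.cast_nonneg _
      linarith
    · exact h
  have hq : (1:ℝ) ≤ q := by exact_mod_cast hq0
  have hp' : (3:ℝ) ≤ p := by exact_mod_cast hp
  have hqr : (q:ℝ) < r := by exact_mod_cast h1
  push_cast at h2
  refine ⟨hq0, ?_, ?_⟩
  · apply Real.le_sqrt_of_sq_le
    have : (r:ℝ) ≤ 2 * q := by nlinarith
    have : (r:ℝ) ^ 2 ≤ 2 * (q * r) := by nlinarith
    have h5 : 3 * ((q:ℝ) * r) ≤ p * (q * r) := by gcongr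
    nlinarith [mul_pos (by linarith : (0:ℝ) < q) (by linarith : (0:ℝ) < r)]
  · apply Real.le_sqrt_of_sq_le
    rw [le_div_iff₀ (by linarith)]
    have : (q:ℝ) ^ 2 ≤ q * r := by nlinarith
    nlinarith

open Classical in
lemma gs_eq {x : ℝ} {p q : ℕ} (hp : 3 ≤ p) (hq : 0 < q) :
    gs x p ⌊Real.sqrt x⌋₊ q = ((Finset.Ioo q ⌈(((p:ℝ) - 1) / ((p:ℝ) - 2)) * ((q:ℝ) - 1)⌉₊).filter (fun r : ℕ => (r:ℝ) ≤ x / p / q)).card := by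
  unfold gs
  rw [← Finset.sum_filter, Finset.sum_const, nsmul_eq_mul, mul_one]
  congr 2
  have hp' : (3:ℝ) ≤ p := by exact_mod_cast hp
  have hq' : (0:ℝ) < q := by exact_mod_cast hq
  have hiff : ∀ r : ℕ, ((p * q * r : ℕ) : ℝ) ≤ x ↔ (r:ℝ) ≤ x / p / q := by
    intro r
    rw [le_div_iff₀ hq', le_div_iff₀ (by linarith)]
    push_cast
    constructor <;> intro h <;> nlinarith
  ext r
  simp only [Finset.mem_filter, Finset.mem_Ioc, Finset.mem_Ioo, Nat.lt_ceil]
  constructor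
  · rintro ⟨_, h1, h2, h3⟩
    exact ⟨⟨h1, h3⟩, (hiff r).mp h2⟩
  · rintro ⟨⟨h1, h3⟩, h2⟩
    have hR : Rg x p q r := ⟨h1, (hiff r).mpr h2, h3⟩
    exact ⟨⟨by omega, Nat.le_floor (Rg_bound hp hR).2.1⟩, hR⟩

lemma card_le_real {q : ℕ} {S : Finset ℕ} {b : ℝ} (h : ∀ r ∈ S, q < r ∧ (r:ℝ) ≤ b) (hb : q ≤ b) : (S.card : ℝ) ≤ b - q := by
  have hsub : S ⊆ Finset.Ioc q ⌊b⌋₊ := by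
    intro r hr
    rw [Finset.mem_Ioc]
    exact ⟨(h r hr).1, Nat.le_floor (h r hr).2⟩
  have := Finset.card_le_card hsub
  rw [Nat.card_Ioc] at this
  have h2 : q ≤ ⌊b⌋₊ := Nat.le_floor hb
  have h3 : (S.card : ℝ) ≤ ((⌊b⌋₊ - q : ℕ) : ℝ) := by exact_mod_cast this
  rw [Nat.cast_sub h2] at h3
  have := Nat.floor_le (le_trans (Nat.cast_nonneg q) hb)
  linarith

lemma card_ge_real {q : ℕ} {S : Finset ℕ} {b : ℝ} (h : ∀ r : ℕ, q < r → (r:ℝ) < b → r ∈ S) : b - q - 1 ≤ (S.card : ℝ) := by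
  have hsub : Finset.Ioo q ⌈b⌉₊ ⊆ S := by
    intro r hr
    rw [Finset.mem_Ioo, Nat.lt_ceil] at hr
    exact h r hr.1 hr.2
  have := Finset.card_le_card hsub
  rw [Nat.card_Ioo] at this
  have h3 : ((⌈b⌉₊ - q - 1 : ℕ) : ℝ) ≤ (S.card : ℝ) := by exact_mod_cast this
  have h4 := Nat.le_ceil b
  have h5 : (⌈b⌉₊ : ℝ) ≤ ((⌈b⌉₊ - q - 1 : ℕ) : ℝ) + q + 1 := by
    exact_mod_cast (by omega : ⌈b⌉₊ ≤ (⌈b⌉₊ - q - 1) + q + 1)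
  linarith

/-- small q -/
lemma gs_small {x : ℝ} {p q : ℕ} (hp : 3 ≤ p) (hq : 0 < q)
    (h : (((p:ℝ) - 1) / ((p:ℝ) - 2)) * q ≤ x / p / q) :
    |gs x p ⌊Real.sqrt x⌋₊ q - ((((p:ℝ) - 1) / ((p:ℝ) - 2)) - 1) * q| ≤ 3 := by
  classical
  rw [gs_eq hp hq]
  obtain ⟨k1, k2⟩ := kap hp
  set κ := ((p:ℝ) - 1) / ((p:ℝ) - 2)
  have hq' : (0:ℝ) < q := by exact_mod_cast hq
  set S := (Finset.Ioo q ⌈κ * ((q:ℝ) - 1)⌉₊).filter (fun r : ℕ => (r:ℝ) ≤ x / p / q) with hS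
  have hlow : κ * ((q:ℝ) - 1) - q - 1 ≤ S.card := by
    apply card_ge_real
    intro r h1 h2
    rw [hS, Finset.mem_filter, Finset.mem_Ioo, Nat.lt_ceil]
    exact ⟨⟨h1, h2⟩, by nlinarith⟩
  have hup : (S.card : ℝ) ≤ κ * q - q := by
    apply card_le_real
    · intro r hr
      rw [hS, Finset.mem_filter, Finset.mem_Ioo, Nat.lt_ceil] at hr
      exact ⟨hr.1.1, by nlinarith [hr.1.2]⟩
    · nlinarith
  rw [abs_le]; constructor <;> linarith

lemma gs_large {x : ℝ} {p q : ℕ} (hp : 3 ≤ p) (hq : 0 < q)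
    (h : x / p / q ≤ (((p:ℝ) - 1) / ((p:ℝ) - 2)) * q) (h' : (q:ℝ) ≤ x / p / q) :
    |gs x p ⌊Real.sqrt x⌋₊ q - (x / p / q - q)| ≤ 3 := by
  classical
  rw [gs_eq hp hq]
  obtain ⟨k1, k2⟩ := kap hp
  set κ := ((p:ℝ) - 1) / ((p:ℝ) - 2)
  have hq' : (0:ℝ) < q := by exact_mod_cast hq
  set S := (Finset.Ioo q ⌈κ * ((q:ℝ) - 1)⌉₊).filter (fun r : ℕ => (r:ℝ) ≤ x / p / q) with hS
  have hlow : (x / p / q - 2) - q - 1 ≤ S.card := by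
    apply card_ge_real
    intro r h1 h2
    rw [hS, Finset.mem_filter, Finset.mem_Ioo, Nat.lt_ceil]
    exact ⟨⟨h1, by nlinarith⟩, by linarith⟩
  have hup : (S.card : ℝ) ≤ x / p / q - q := by
    apply card_le_real _ h'
    intro r hr
    rw [hS, Finset.mem_filter, Finset.mem_Ioo, Nat.lt_ceil] at hr
    exact ⟨hr.1.1, hr.2⟩
  rw [abs_le]; constructor <;> linarith

/-- lower sum -/
lemma sum1 (M : ℕ) : ∑ n ∈ Finset.Ioc 0 M, (n:ℝ) = M * (M + 1) / 2 := by
  induction M with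
  | zero => simp
  | succ m ih => rw [Finset.sum_Ioc_succ_top (by omega), ih]; push_cast; ring

lemma sum2 {y : ℝ} (hy : 0 ≤ y) {M1 M2 : ℕ} (h1 : 1 ≤ M1) (h12 : M1 ≤ M2) :
    |∑ n ∈ Finset.Ioc M1 M2, (y / n - n) - ((y * Real.log M2 - (M2:ℝ) ^ 2 / 2) - (y * Real.log M1 - (M1:ℝ) ^ 2 / 2))|
      ≤ (y / M1 - y / M2) + M2 := by
  induction M2, h12 using Nat.le_induction with
  | base => simp
  | succ m hm ih =>
    rw [Finset.sum_Ioc_succ_top (by omega)]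
    have hm0 : (0:ℝ) < m := by exact_mod_cast (by omega : 0 < m)
    have hl1 : Real.log ((m + 1 : ℕ):ℝ) - Real.log m ≤ 1 / m := by
      rw [← Real.log_div (by positivity) (by positivity)]
      refine (Real.log_le_sub_one_of_pos (by positivity)).trans (le_of_eq ?_)
      push_cast; field_simp; ring
    have hl2 : 1 / ((m + 1 : ℕ):ℝ) ≤ Real.log ((m + 1 : ℕ):ℝ) - Real.log m := by
      have := Real.log_le_sub_one_of_pos (x := (m:ℝ) / ((m + 1 : ℕ):ℝ)) (by positivity)
      rw [Real.log_div (by positivity) (by positivity)] at this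
      have e : (m:ℝ) / ((m + 1 : ℕ):ℝ) - 1 = - (1 / ((m + 1 : ℕ):ℝ)) := by push_cast; field_simp; ring
      linarith
    have a1 := mul_le_mul_of_nonneg_left hl1 hy
    have a2 := mul_le_mul_of_nonneg_left hl2 hy
    rw [mul_one_div, mul_sub] at a1 a2
    have a3 : ((m + 1 : ℕ):ℝ) = m + 1 := by push_cast; rfl
    have a4 : ((m + 1 : ℕ):ℝ) ^ 2 = (m:ℝ) ^ 2 + 2 * m + 1 := by rw [a3]; ring
    rw [abs_le] at ih ⊢
    constructor <;> linarith [ih.1, ih.2]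

end TA

namespace TA

lemma sum_abs_le {S : Finset ℕ} {f g : ℕ → ℝ} {c : ℝ} (h : ∀ n ∈ S, |f n - g n| ≤ c) :
    |∑ n ∈ S, f n - ∑ n ∈ S, g n| ≤ c * S.card := by
  rw [← Finset.sum_sub_distrib]
  refine (Finset.abs_sum_le_sum_abs _ _).trans ?_
  refine (Finset.sum_le_card_nsmul _ _ c h).trans (le_of_eq ?_)
  rw [nsmul_eq_mul, mul_comm]

lemma floor_log {v : ℝ} (hv : 1 ≤ v) : (⌊v⌋₊ : ℝ) ≤ v ∧ v ≤ ⌊v⌋₊ + 1 ∧ v / 2 ≤ ⌊v⌋₊ ∧ (1:ℝ) ≤ ⌊v⌋₊ ∧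
    0 ≤ Real.log v - Real.log ⌊v⌋₊ ∧ Real.log v - Real.log ⌊v⌋₊ ≤ 1 / ⌊v⌋₊ := by
  have h1 := Nat.floor_le (by linarith : 0 ≤ v)
  have h2 := (Nat.lt_floor_add_one v).le
  have h3 : (1:ℝ) ≤ ⌊v⌋₊ := by exact_mod_cast Nat.le_floor (by simpa using hv)
  refine ⟨h1, h2, by linarith, h3, ?_, ?_⟩
  · have := Real.log_le_log (by linarith) h1
    linarith
  · rw [← Real.log_div (by linarith) (by linarith)]
    refine (Real.log_le_sub_one_of_pos (by positivity)).trans ?_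
    rw [div_sub_one (by linarith)]
    gcongr; linarith

lemma nl1 {q u κ y : ℝ} (h0 : 0 ≤ q) (h : q ≤ u) (hκ : 1 < κ) (hy : κ * u ^ 2 = y) : κ * q * q ≤ y := by
  have : q * q ≤ u ^ 2 := by nlinarith
  nlinarith
lemma nl2 {q u κ y : ℝ} (h0 : 0 ≤ u) (h : u ≤ q) (hκ : 1 < κ) (hy : κ * u ^ 2 = y) : y ≤ κ * q * q := by
  have : u ^ 2 ≤ q * q := by nlinarith
  nlinarith
lemma nl3 {q v y : ℝ} (h0 : 0 ≤ q) (h : q ≤ v) (hy : v ^ 2 = y) : q * q ≤ y := by nlinarith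
lemma nl4 {u v κ m y : ℝ} (hy : κ * u ^ 2 = y) (hk : κ ≤ 2) (hm : u / 2 ≤ m) (huv : u ≤ v) (hu : 1 ≤ u) : y ≤ 4 * v * m := by
  have h1 : y ≤ 2 * u ^ 2 := by nlinarith
  have h2 : u * u ≤ v * (2 * m) := by gcongr <;> linarith
  nlinarith
lemma nl5 {v m y : ℝ} (hy : v ^ 2 = y) (hm : v / 2 ≤ m) (hv : 0 ≤ v) : y ≤ 2 * v * m := by nlinarith
lemma nl6 {u v κ m : ℝ} (hm0 : 0 ≤ m) (hm : m ≤ u) (hm1 : u ≤ m + 1) (hk : 1 < κ) (hk2 : κ ≤ 2) (huv : u ≤ v) (hu : 1 ≤ u) :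
    0 ≤ κ * u ^ 2 - κ * m ^ 2 ∧ κ * u ^ 2 - κ * m ^ 2 ≤ 4 * v := by
  have h1 : m ^ 2 ≤ u ^ 2 := by gcongr
  have h2 : u ^ 2 - m ^ 2 ≤ 2 * u := by nlinarith
  constructor <;> nlinarith
lemma nl7 {v m : ℝ} (hm0 : 0 ≤ m) (hm : m ≤ v) (hm1 : v ≤ m + 1) : 0 ≤ v ^ 2 - m ^ 2 ∧ v ^ 2 - m ^ 2 ≤ 2 * v := by
  have h1 : m ^ 2 ≤ v ^ 2 := by gcongr
  constructor <;> nlinarith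
lemma nl8 {u v κ m : ℝ} (hm0 : 0 ≤ m) (hm : m ≤ u) (hk : 1 < κ) (hk2 : κ ≤ 2) (huv : u ≤ v) : 0 ≤ (κ - 1) * m ∧ (κ - 1) * m ≤ v := by
  constructor <;> nlinarith

set_option maxHeartbeats 1000000 in
lemma lattice {x : ℝ} {p : ℕ} (hp : 3 ≤ p) (hy : 4 ≤ x / p) :
    |∑ q ∈ Finset.Ioc 0 ⌊Real.sqrt x⌋₊, gs x p ⌊Real.sqrt x⌋₊ q
      - x / p * Real.log (((p:ℝ) - 1) / ((p:ℝ) - 2)) / 2| ≤ 100 * Real.sqrt x := by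
  have hp' : (3:ℝ) ≤ p := by exact_mod_cast hp
  obtain ⟨k1, k2⟩ := kap hp
  set κ := ((p:ℝ) - 1) / ((p:ℝ) - 2) with hκ
  set y := x / p with hyd
  have hx : 0 ≤ x := by
    by_contra hneg
    have : x / p ≤ 0 := div_nonpos_of_nonpos_of_nonneg (by linarith) (by linarith)
    linarith
  have hyx : y ≤ x := div_le_self hx (by linarith)
  set v := Real.sqrt y with hv
  set u := Real.sqrt (y / κ) with hu
  have hv2 : v ^ 2 = y := Real.sq_sqrt (by linarith)
  have hu2 : u ^ 2 = y / κ := Real.sq_sqrt (div_nonneg (by linarith) (by linarith))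
  have hu2' : κ * u ^ 2 = y := by rw [hu2]; field_simp
  have huv : u ≤ v := Real.sqrt_le_sqrt (div_le_self (by linarith) k1.le)
  have hu1 : 1 ≤ u := by
    apply Real.le_sqrt_of_sq_le
    rw [le_div_iff₀ (by linarith)]; linarith
  have hvx : v ≤ Real.sqrt x := Real.sqrt_le_sqrt hyx
  obtain ⟨a1, a2, a3, a4, a5, a6⟩ := floor_log hu1
  obtain ⟨b1, b2, b3, b4, b5, b6⟩ := floor_log (hu1.trans huv)
  have hM12 : ⌊u⌋₊ ≤ ⌊v⌋₊ := Nat.floor_mono huv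
  have hM2K : ⌊v⌋₊ ≤ ⌊Real.sqrt x⌋₊ := Nat.floor_mono hvx
  set K := ⌊Real.sqrt x⌋₊ with hK
  have hM1 : 1 ≤ ⌊u⌋₊ := by exact_mod_cast a4
  have hlogvu : Real.log v - Real.log u = Real.log κ / 2 := by
    have e1 : Real.log v = Real.log y / 2 := Real.log_sqrt (by linarith)
    have e2 : Real.log u = Real.log (y / κ) / 2 := Real.log_sqrt (div_nonneg (by linarith) (by linarith))
    have e3 : Real.log (y / κ) = Real.log y - Real.log κ := Real.log_div (by linarith) (by linarith)
    rw [e1, e2, e3]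
    ring
  -- the three ranges
  have s3 : ∑ q ∈ Finset.Ioc ⌊v⌋₊ K, gs x p K q = 0 := by
    apply Finset.sum_eq_zero
    intro q hq
    rw [Finset.mem_Ioc] at hq
    unfold gs
    apply Finset.sum_eq_zero
    intro r _
    rw [if_neg]
    intro hR
    have := (Rg_bound hp hR).2.2
    have : q ≤ ⌊v⌋₊ := Nat.le_floor this
    omega
  have s1 : |∑ q ∈ Finset.Ioc 0 ⌊u⌋₊, gs x p K q - ∑ q ∈ Finset.Ioc 0 ⌊u⌋₊, (κ - 1) * (q:ℝ)| ≤ 3 * (⌊u⌋₊ : ℝ) := by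
    have := sum_abs_le (S := Finset.Ioc 0 ⌊u⌋₊) (f := gs x p K) (g := fun q => (κ - 1) * (q:ℝ)) (c := 3) ?_
    · simpa using this
    · intro q hq
      rw [Finset.mem_Ioc] at hq
      have hq0 : (0:ℝ) < q := by exact_mod_cast hq.1
      have hqu : (q:ℝ) ≤ u := le_trans (by exact_mod_cast hq.2) a1
      apply gs_small hp hq.1
      change κ * q ≤ y / q
      rw [le_div_iff₀ hq0]
      exact nl1 hq0.le hqu k1 hu2'
  rw [← Finset.mul_sum, sum1] at s1
  have s2 : |∑ q ∈ Finset.Ioc ⌊u⌋₊ ⌊v⌋₊, gs x p K q - ∑ q ∈ Finset.Ioc ⌊u⌋₊ ⌊v⌋₊, (y / q - (q:ℝ))| ≤ 3 * (⌊v⌋₊ : ℝ) := by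
    have := sum_abs_le (S := Finset.Ioc ⌊u⌋₊ ⌊v⌋₊) (f := gs x p K) (g := fun q => y / q - (q:ℝ)) (c := 3) ?_
    · refine this.trans ?_
      gcongr
      rw [Nat.card_Ioc]; omega
    · intro q hq
      rw [Finset.mem_Ioc] at hq
      have hq0 : (0:ℝ) < q := by exact_mod_cast (by omega : 0 < q)
      have hqu : u ≤ q := le_trans a2 (by exact_mod_cast hq.1)
      have hqv : (q:ℝ) ≤ v := le_trans (by exact_mod_cast hq.2) b1
      apply gs_large hp (by omega)
      · change y / q ≤ κ * q
        rw [div_le_iff₀ hq0]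
        exact nl2 (by linarith) hqu k1 hu2'
      · change (q:ℝ) ≤ y / q
        rw [le_div_iff₀ hq0]; exact nl3 hq0.le hqv hv2
  have s2' := sum2 (by linarith : 0 ≤ y) hM1 hM12
  rw [← Finset.sum_Ioc_consecutive _ (Nat.zero_le ⌊v⌋₊) hM2K, s3, add_zero,
    ← Finset.sum_Ioc_consecutive _ (Nat.zero_le ⌊u⌋₊) hM12]
  set m1 : ℝ := (⌊u⌋₊ : ℝ)
  set m2 : ℝ := (⌊v⌋₊ : ℝ)
  have y1 : y / m1 ≤ 4 * v := by
    rw [div_le_iff₀ (by linarith)]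
    exact nl4 hu2' k2 a3 huv hu1
  have y2 : y / m2 ≤ 2 * v := by
    rw [div_le_iff₀ (by linarith)]
    exact nl5 hv2 b3 (by linarith)
  have y2' : 0 ≤ y / m2 := by positivity
  have l1 := mul_le_mul_of_nonneg_left a6 (by linarith : 0 ≤ y)
  have l1' := mul_nonneg (by linarith : 0 ≤ y) a5
  have l2 := mul_le_mul_of_nonneg_left b6 (by linarith : 0 ≤ y)
  have l2' := mul_nonneg (by linarith : 0 ≤ y) b5
  rw [mul_one_div] at l1 l2
  have l3 : y * Real.log κ / 2 = y * Real.log v - y * Real.log u := by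
    rw [← mul_sub, hlogvu]; ring
  rw [mul_sub] at l1 l1' l2 l2'
  obtain ⟨q1, q1'⟩ := nl6 (by linarith) a1 a2 k1 k2 huv hu1
  obtain ⟨q2, q2'⟩ := nl7 (by linarith) b1 b2
  obtain ⟨q3, q3'⟩ := nl8 (by linarith) a1 k1 k2 huv
  have q4 : (κ - 1) * (m1 * (m1 + 1) / 2) = κ * m1 ^ 2 / 2 - m1 ^ 2 / 2 + (κ - 1) * m1 / 2 := by ring
  rw [q4] at s1
  rw [l3]
  rw [abs_le] at s1 s2 s2' ⊢
  constructor <;> linarith [s1.1, s1.2, s2.1, s2.2, s2'.1, s2'.2]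

end TA

namespace TA

open Classical in
/-- pairs for given p and residue -/
noncomputable def Np (x : ℝ) (p s : ℕ) : Finset (ℕ × ℕ) :=
  ((Finset.Ioc 0 ⌊Real.sqrt x⌋₊) ×ˢ (Finset.Ioc 0 ⌊Real.sqrt x⌋₊)).filter
    (fun z => Rg x p z.1 z.2 ∧ z.1.Prime ∧ z.2.Prime ∧ z.1 % p = s ∧ z.2 % p = s)

lemma mem_Np {x : ℝ} {p s : ℕ} (hp : 3 ≤ p) {z : ℕ × ℕ} : z ∈ Np x p s ↔
    Rg x p z.1 z.2 ∧ z.1.Prime ∧ z.2.Prime ∧ z.1 % p = s ∧ z.2 % p = s := by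
  classical
  unfold Np
  rw [Finset.mem_filter, Finset.mem_product, Finset.mem_Ioc, Finset.mem_Ioc]
  refine ⟨fun h => h.2, fun h => ⟨?_, h⟩⟩
  obtain ⟨h1, h2, h3⟩ := Rg_bound hp h.1
  have h4 := h.1.1
  have h5 := Nat.le_floor h2
  omega

lemma q_gt {x : ℝ} {p s q r : ℕ} (hp : p.Prime) (hp3 : 3 ≤ p) (hs : s = 1 ∨ s = p - 1) (hR : Rg x p q r) (hq : q.Prime)
    (hqs : q % p = s) : p < q := by
  by_contra hle
  rcases Nat.lt_or_ge q p with h | h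
  · rw [Nat.mod_eq_of_lt h] at hqs
    rcases hs with h1 | h1
    · rw [hqs, h1] at hq; exact Nat.not_prime_one hq
    · have hodd := hp.eq_two_or_odd
      have hqo := hq.eq_two_or_odd
      have hq2 : q = 2 := by omega
      obtain ⟨h2, h3, h4⟩ := hR
      subst hq2
      have := (kap hp3).2
      have h5 : (2:ℝ) < r := by exact_mod_cast h2
      norm_num at h4
      linarith
  · have : q = p := by omega
    rw [this, Nat.mod_self] at hqs
    omega

lemma Np_card {x : ℝ} {p s : ℕ} (hp : p.Prime) (hp3 : 3 ≤ p) (hs : s = 1 ∨ s = p - 1) (hx : 0 ≤ x) :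
    ((Np x p s).card : ℝ) ≤ 3 * x / p ^ 4 := by
  have hp' : (3:ℝ) ≤ p := by exact_mod_cast hp3
  set v := Real.sqrt (x / p) with hv
  have hv0 : 0 ≤ v := Real.sqrt_nonneg _
  have hv2 : v ^ 2 = x / p := Real.sq_sqrt (by positivity)
  have hcard : (Np x p s).card ≤ ((Finset.Ioc 0 ⌊v / p⌋₊) ×ˢ (Finset.Ioc 0 ⌊v / (p * (p - 2))⌋₊)).card := by
    apply Finset.card_le_card_of_injOn (fun z => (z.1 / p, (z.2 - z.1) / p))
    · intro z hz
      obtain ⟨hR, hq, hr, hqs, hrs⟩ := (mem_Np hp3).mp hz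
      have hpq := q_gt hp hp3 hs hR hq hqs
      obtain ⟨b1, b2, b3⟩ := Rg_bound hp3 hR
      obtain ⟨r1, r2, r3⟩ := hR
      have hdvd : p ∣ z.2 - z.1 := (Nat.modEq_iff_dvd' r1.le).mp (hqs.trans hrs.symm)
      simp only [Finset.coe_product, Set.mem_prod, Finset.mem_coe, Finset.mem_Ioc]
      refine ⟨⟨Nat.div_pos hpq.le (by omega), ?_⟩, ⟨Nat.div_pos (Nat.le_of_dvd (by omega) hdvd) (by omega), ?_⟩⟩
      · apply Nat.le_floor
        refine Nat.cast_div_le.trans ?_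
        gcongr
      · apply Nat.le_floor
        refine Nat.cast_div_le.trans ?_
        rw [mul_comm, ← div_div]
        gcongr
        rw [Nat.cast_sub r1.le, le_div_iff₀ (by linarith)]
        rw [div_mul_eq_mul_div, lt_div_iff₀ (by linarith)] at r3
        have : (z.1 : ℝ) ≤ v := b3
        nlinarith
    · intro z hz w hw hzw
      obtain ⟨hR, hq, hr, hqs, hrs⟩ := (mem_Np hp3).mp hz
      obtain ⟨hR', hq', hr', hqs', hrs'⟩ := (mem_Np hp3).mp hw
      have hdvd : p ∣ z.2 - z.1 := (Nat.modEq_iff_dvd' hR.1.le).mp (hqs.trans hrs.symm)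
      have hdvd' : p ∣ w.2 - w.1 := (Nat.modEq_iff_dvd' hR'.1.le).mp (hqs'.trans hrs'.symm)
      simp only [Prod.mk.injEq] at hzw
      obtain ⟨e1, e2⟩ := hzw
      have a1 := Nat.div_add_mod z.1 p
      have a2 := Nat.div_add_mod w.1 p
      have e3 : z.1 = w.1 := by rw [← a1, ← a2, e1, hqs, hqs']
      have a3 := Nat.mul_div_cancel' hdvd
      have a4 := Nat.mul_div_cancel' hdvd'
      have e4 : z.2 - z.1 = w.2 - w.1 := by rw [← a3, ← a4, e2]
      have := hR.1
      have := hR'.1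
      ext
      · exact e3
      · omega
  have h1 : ((Np x p s).card : ℝ) ≤ (v / p) * (v / (p * (p - 2))) := by
    refine (Nat.cast_le.mpr hcard).trans ?_
    rw [Finset.card_product, Nat.card_Ioc, Nat.card_Ioc, Nat.sub_zero, Nat.sub_zero]
    push_cast
    have hb : 0 ≤ v / (p * ((p:ℝ) - 2)) := div_nonneg hv0 (mul_nonneg (by linarith) (by linarith))
    have := Nat.floor_le hb
    have := Nat.floor_le (by positivity : 0 ≤ v / p)
    gcongr
  refine h1.trans ?_
  have h2 : (v / p) * (v / (p * (p - 2))) = x / (p ^ 3 * (p - 2)) := by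
    have : (p:ℝ) - 2 ≠ 0 := by linarith
    have e : (v / p) * (v / (p * (p - 2))) = v ^ 2 / (p ^ 2 * (p - 2)) := by field_simp
    rw [e, hv2]
    field_simp
  rw [h2]
  have hp2 : (0:ℝ) < p - 2 := by linarith
  rw [div_le_div_iff₀ (by positivity) (by positivity)]
  have : (p:ℝ) ^ 4 ≤ 3 * (p ^ 3 * (p - 2)) := by
    have : (p:ℝ) ^ 3 * p ≤ p ^ 3 * (3 * (p - 2)) := by gcongr; linarith
    linarith
  calc x * (p:ℝ) ^ 4 ≤ x * (3 * (p ^ 3 * (p - 2))) := by gcongr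
    _ = _ := by ring

open Classical in
/-- index set of triples -/
noncomputable def Tri (x : ℝ) : Finset (Σ _ : ℕ, ℕ × ℕ) :=
  ((Finset.Ioc 2 ⌊x⌋₊).filter Nat.Prime).sigma (fun p => Np x p 1 ∪ Np x p (p - 1))

lemma triple_inj {p q r p' q' r' : ℕ} (hp : p.Prime) (hq : q.Prime) (hr : r.Prime) (hp' : p'.Prime) (hq' : q'.Prime) (hr' : r'.Prime)
    (h1 : p < q) (h2 : q < r) (h1' : p' < q') (h2' : q' < r') (h : p * q * r = p' * q' * r') : p = p' ∧ q = q' ∧ r = r' := by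
  have hd : ∀ {s a b c : ℕ}, s.Prime → a.Prime → b.Prime → c.Prime → s ∣ a * b * c → s = a ∨ s = b ∨ s = c := by
    intro s a b c hs ha hb hc hd
    rcases hs.dvd_mul.mp hd with h | h
    · rcases hs.dvd_mul.mp h with h | h
      · exact Or.inl ((Nat.prime_dvd_prime_iff_eq hs ha).mp h)
      · exact Or.inr (Or.inl ((Nat.prime_dvd_prime_iff_eq hs hb).mp h))
    · exact Or.inr (Or.inr ((Nat.prime_dvd_prime_iff_eq hs hc).mp h))
  have a1 := hd hp hp' hq' hr' (h ▸ (dvd_mul_of_dvd_left (dvd_mul_right _ _) _))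
  have a2 := hd hq hp' hq' hr' (h ▸ (dvd_mul_of_dvd_left (dvd_mul_left _ _) _))
  have a3 := hd hr hp' hq' hr' (h ▸ (dvd_mul_left _ _))
  omega

lemma Tcount_eq {x : ℝ} (hx : 0 ≤ x) : Tcount x = ∑ p ∈ (Finset.Ioc 2 ⌊x⌋₊).filter Nat.Prime, ((Np x p 1).card + (Np x p (p - 1)).card) := by
  classical
  have hT : (Tri x).card = ∑ p ∈ (Finset.Ioc 2 ⌊x⌋₊).filter Nat.Prime, ((Np x p 1).card + (Np x p (p - 1)).card) := by
    unfold Tri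
    rw [Finset.card_sigma]
    apply Finset.sum_congr rfl
    intro p hp
    rw [Finset.mem_filter, Finset.mem_Ioc] at hp
    apply Finset.card_union_of_disjoint
    rw [Finset.disjoint_left]
    intro z h1 h2
    have a1 := ((mem_Np (by omega)).mp h1).2.2.2.1
    have a2 := ((mem_Np (by omega)).mp h2).2.2.2.1
    omega
  have hmem : ∀ t : (Σ _ : ℕ, ℕ × ℕ), t ∈ Tri x ↔ (t.1.Prime ∧ 3 ≤ t.1 ∧ t.1 ≤ ⌊x⌋₊) ∧ Rg x t.1 t.2.1 t.2.2 ∧ t.2.1.Prime ∧ t.2.2.Prime ∧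
      ((t.2.1 % t.1 = 1 ∧ t.2.2 % t.1 = 1) ∨ (t.2.1 % t.1 = t.1 - 1 ∧ t.2.2 % t.1 = t.1 - 1)) := by
    intro t
    unfold Tri
    rw [Finset.mem_sigma, Finset.mem_filter, Finset.mem_Ioc, Finset.mem_union]
    constructor
    · rintro ⟨⟨⟨h1, h2⟩, h3⟩, h4⟩
      rw [mem_Np (by omega), mem_Np (by omega)] at h4
      exact ⟨⟨h3, h1, h2⟩, by tauto⟩
    · rintro ⟨⟨h3, h1, h2⟩, h4⟩
      refine ⟨⟨⟨h1, h2⟩, h3⟩, ?_⟩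
      rw [mem_Np (by omega), mem_Np (by omega)]
      tauto
  rw [← hT]
  unfold Tcount
  have hgt : ∀ t ∈ Tri x, t.1 < t.2.1 := by
    intro t ht
    obtain ⟨⟨h1, h2, h3⟩, h4, h5, h6, h7⟩ := (hmem t).mp ht
    rcases h7 with h7 | h7
    · exact q_gt h1 h2 (Or.inl rfl) h4 h5 h7.1
    · exact q_gt h1 h2 (Or.inr rfl) h4 h5 h7.1
  rw [← Set.ncard_coe_finset (Tri x)]
  symm
  apply Set.ncard_congr (fun t _ => t.1 * t.2.1 * t.2.2)
  · intro t ht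
    have hg := hgt t ht
    obtain ⟨⟨h1, h2, h3⟩, h4, h5, h6, h7⟩ := (hmem t).mp ht
    exact ⟨t.1, t.2.1, t.2.2, h1, h5, h6, h2, hg, h4.1, rfl, h4.2.1, h4.2.2, h7⟩
  · intro t w ht hw h
    have hg := hgt t ht
    have hg' := hgt w hw
    obtain ⟨⟨h1, h2, h3⟩, h4, h5, h6, h7⟩ := (hmem t).mp ht
    obtain ⟨⟨h1', h2', h3'⟩, h4', h5', h6', h7'⟩ := (hmem w).mp hw
    obtain ⟨e1, e2, e3⟩ := triple_inj h1 h5 h6 h1' h5' h6' hg h4.1 hg' h4'.1 h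
    obtain ⟨t1, t2, t3⟩ := t
    obtain ⟨w1, w2, w3⟩ := w
    simp only at e1 e2 e3
    subst e1 e2 e3
    rfl
  · rintro n ⟨p, q, r, hp, hq, hr, hp3, hpq, hqr, rfl, hn, hrk, hmod⟩
    refine ⟨⟨p, (q, r)⟩, ?_, rfl⟩
    rw [Finset.mem_coe, hmem]
    refine ⟨⟨hp, hp3, ?_⟩, ⟨hqr, hn, hrk⟩, hq, hr, hmod⟩
    apply Nat.le_floor
    refine le_trans ?_ hn
    have : p ≤ p * q * r := by
      rw [mul_assoc]
      exact Nat.le_mul_of_pos_right _ (Nat.mul_pos hq.pos hr.pos)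
    exact_mod_cast this

end TA

namespace TA

/-- weighted count -/
noncomputable def Wt (x : ℝ) (p s : ℕ) : ℝ := ∑ z ∈ Np x p s, Real.log z.1 * Real.log z.2

open Classical in
lemma Wt_eq (x : ℝ) (p s : ℕ) : ∑ q ∈ Finset.Ioc 0 ⌊Real.sqrt x⌋₊, ∑ r ∈ Finset.Ioc 0 ⌊Real.sqrt x⌋₊,
    (if Rg x p q r then lw p s q * lw p s r else 0) = Wt x p s := by
  unfold Wt Np
  rw [Finset.sum_filter, Finset.sum_product]
  refine Finset.sum_congr rfl fun q _ => Finset.sum_congr rfl fun r _ => ?_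
  unfold lw
  by_cases h1 : Rg x p q r <;> by_cases h2 : q.Prime <;> by_cases h3 : r.Prime <;>
    by_cases h4 : q % p = s <;> by_cases h5 : r % p = s <;> simp [h1, h2, h3, h4, h5]

lemma Rg_c1 {x : ℝ} {p : ℕ} : ∀ q a b d, a ≤ b → b ≤ d → Rg x p q a → Rg x p q d → Rg x p q b := by
  rintro q a b d hab hbd ⟨a1, a2, a3⟩ ⟨d1, d2, d3⟩
  have hbd' : (b:ℝ) ≤ d := by exact_mod_cast hbd
  refine ⟨by omega, le_trans ?_ d2, by linarith⟩
  exact_mod_cast Nat.mul_le_mul_left _ hbd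

lemma Rg_c2 {x : ℝ} {p : ℕ} (hp : 3 ≤ p) : ∀ r a b d, a ≤ b → b ≤ d → Rg x p a r → Rg x p d r → Rg x p b r := by
  rintro r a b d hab hbd ⟨a1, a2, a3⟩ ⟨d1, d2, d3⟩
  have hab' : (a:ℝ) ≤ b := by exact_mod_cast hab
  have hk := (kap hp).1
  refine ⟨by omega, le_trans ?_ d2, lt_of_lt_of_le a3 ?_⟩
  · exact_mod_cast Nat.mul_le_mul_right _ (Nat.mul_le_mul_left _ hbd)
  · gcongr

lemma sqrt_small {x : ℝ} (hx : 0 < x) (hX : 0 < Real.log x) : Real.sqrt x ≤ 48 * x / Real.log x ^ 3 := by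
  have h := exp_neg_le_pow (y := Real.log x / 2) (by positivity) 3
  have h1 : Real.sqrt x = x * Real.exp (-(Real.log x / 2)) := by
    have : x = Real.sqrt x * Real.sqrt x := (Real.mul_self_sqrt hx.le).symm
    have h2 : Real.sqrt x = Real.exp (Real.log x / 2) := by
      rw [Real.sqrt_eq_rpow, Real.rpow_def_of_pos hx]; congr 1; ring
    have h3 : Real.exp (Real.log x / 2) * Real.exp (-(Real.log x / 2)) = 1 := by
      rw [← Real.exp_add]; simp
    calc Real.sqrt x = Real.sqrt x * (Real.exp (Real.log x / 2) * Real.exp (-(Real.log x / 2))) := by rw [h3, mul_one]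
      _ = (Real.sqrt x * Real.sqrt x) * Real.exp (-(Real.log x / 2)) := by rw [← h2]; ring
      _ = _ := by rw [← this]
  rw [h1]
  calc x * Real.exp (-(Real.log x / 2)) ≤ x * (((3).factorial : ℝ) / (Real.log x / 2) ^ 3) := by gcongr
    _ = 48 * x / Real.log x ^ 3 := by
      have : ((3).factorial : ℝ) = 6 := by norm_num [Nat.factorial]
      rw [this]; field_simp; norm_num

lemma alg1 {C0 v X c K x : ℝ} (hC : 0 < C0) (hv : 0 ≤ v) (hX : 1 ≤ X) (hc0 : 0 ≤ c) (hc : c ≤ 1) (hK0 : 0 ≤ K) (hK : K ≤ v) (hvx : v * v = x) :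
    C0 * v / X ^ 3 * (2 * c * K + C0 * v / X ^ 3) ≤ C0 * (2 + C0) * x / X ^ 3 := by
  have h1 : C0 * v / X ^ 3 ≤ C0 * v := by
    apply div_le_self (by positivity); exact one_le_pow₀ hX
  have h2 : c * K ≤ 1 * v := by gcongr
  calc C0 * v / X ^ 3 * (2 * c * K + C0 * v / X ^ 3) ≤ C0 * v / X ^ 3 * (2 * v + C0 * v) := by
        gcongr
        linarith
    _ = C0 * (2 + C0) * (v * v) / X ^ 3 := by ring
    _ = _ := by rw [hvx]

lemma x_big {x : ℝ} (hx : 0 < x) (hX : 8 ≤ Real.log x) : 4 * Real.log x ≤ x := by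
  have h := Real.quadratic_le_exp_of_nonneg (x := Real.log x) (by linarith)
  rw [Real.exp_log hx] at h
  nlinarith

lemma Wt_est : ∃ C : ℝ, 0 < C ∧ ∀ x : ℝ, 408 ≤ Real.log x → 0 < x → ∀ p : ℕ, p.Prime → 3 ≤ p → (p : ℝ) ≤ Real.log x →
    ∀ s : ℕ, 0 < s → s < p →
    |Wt x p s - (1 / ((p:ℝ) - 1)) ^ 2 * (x / p * Real.log (((p:ℝ) - 1) / ((p:ℝ) - 2)) / 2)| ≤ C * x / Real.log x ^ 3 := by
  classical
  obtain ⟨C0, hC0, H⟩ := lw_interval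
  refine ⟨C0 * (2 + C0) + 4800, by positivity, ?_⟩
  intro x hX hx p hp hp3 hpX s hs0 hsp
  have hp' : (3:ℝ) ≤ p := by exact_mod_cast hp3
  have hp0 : (0:ℝ) < p := by linarith
  have hc0 : 0 ≤ 1 / ((p:ℝ) - 1) := div_nonneg zero_le_one (by linarith)
  have hc1 : 1 / ((p:ℝ) - 1) ≤ 1 := by rw [div_le_one (by linarith)]; linarith
  have hd := double (l := lw p s) (lw_nonneg p s) (c := 1 / ((p:ℝ) - 1)) hc0 (K := ⌊Real.sqrt x⌋₊)
    (H x hX hx p hp hpX s hs0 hsp) (fun q r => Rg x p q r) Rg_c1 (Rg_c2 hp3)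
  rw [Wt_eq] at hd
  have hy : 4 ≤ x / p := by
    rw [le_div_iff₀ hp0]
    have := x_big hx (by linarith)
    linarith
  have hl := lattice hp3 hy
  have hv := alg1 (X := Real.log x) hC0 (Real.sqrt_nonneg x) (by linarith) hc0 hc1 (Nat.cast_nonneg ⌊Real.sqrt x⌋₊)
    (Nat.floor_le (Real.sqrt_nonneg x)) (Real.mul_self_sqrt hx.le)
  have hs := sqrt_small hx (by linarith)
  have hgs : ∑ q ∈ Finset.Ioc 0 ⌊Real.sqrt x⌋₊, ∑ r ∈ Finset.Ioc 0 ⌊Real.sqrt x⌋₊, (if Rg x p q r then (1:ℝ) else 0)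
    = ∑ q ∈ Finset.Ioc 0 ⌊Real.sqrt x⌋₊, gs x p ⌊Real.sqrt x⌋₊ q := by
    refine Finset.sum_congr rfl fun q _ => ?_
    unfold gs
    rfl
  rw [hgs] at hd
  set G := ∑ q ∈ Finset.Ioc 0 ⌊Real.sqrt x⌋₊, gs x p ⌊Real.sqrt x⌋₊ q
  set c := 1 / ((p:ℝ) - 1)
  set L := x / p * Real.log (((p:ℝ) - 1) / ((p:ℝ) - 2)) / 2
  have hcl : |c ^ 2 * G - c ^ 2 * L| ≤ 100 * Real.sqrt x := by
    rw [← mul_sub, abs_mul, abs_of_nonneg (by positivity)]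
    have : c ^ 2 ≤ 1 := pow_le_one₀ hc0 hc1
    calc c ^ 2 * |G - L| ≤ 1 * |G - L| := by gcongr
      _ ≤ _ := by rw [one_mul]; exact hl
  have e : (C0 * (2 + C0) + 4800) * x / Real.log x ^ 3 = C0 * (2 + C0) * x / Real.log x ^ 3 + 100 * (48 * x / Real.log x ^ 3) := by ring
  rw [e]
  refine (abs_sub_le _ (c ^ 2 * G) _).trans ?_
  gcongr
  · exact hd.trans hv
  · linarith

lemma Np_logs {x : ℝ} {p s : ℕ} (hp : 3 ≤ p) (hx : 1 ≤ x) {z : ℕ × ℕ} (hz : z ∈ Np x p s) :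
    4 * (Real.log z.1 * Real.log z.2) ≤ Real.log x ^ 2 := by
  obtain ⟨hR, hq, hr, _, _⟩ := (mem_Np hp).mp hz
  have h1 : (1:ℝ) ≤ z.1 := by exact_mod_cast hq.one_lt.le
  have h2 : (1:ℝ) ≤ z.2 := by exact_mod_cast hr.one_lt.le
  have h3 : Real.log z.1 + Real.log z.2 ≤ Real.log x := by
    rw [← Real.log_mul (by linarith) (by linarith)]
    apply Real.log_le_log (by positivity)
    refine le_trans ?_ hR.2.1
    rw [mul_assoc, Nat.cast_mul p, Nat.cast_mul]
    have : (1:ℝ) ≤ p := by exact_mod_cast (by omega : 1 ≤ p)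
    exact le_mul_of_one_le_left (by positivity) this
  have h4 := Real.log_nonneg h1
  have h5 := Real.log_nonneg h2
  have h6 : (Real.log z.1 + Real.log z.2) ^ 2 ≤ Real.log x ^ 2 := by gcongr
  have h7 := sq_nonneg (Real.log z.1 - Real.log z.2)
  linarith

lemma card_lower {x : ℝ} {p s : ℕ} (hp : 3 ≤ p) (hx : 1 ≤ x) : 4 * Wt x p s ≤ Real.log x ^ 2 * (Np x p s).card := by
  unfold Wt
  rw [Finset.mul_sum]
  calc _ ≤ ∑ z ∈ Np x p s, Real.log x ^ 2 := Finset.sum_le_sum fun z hz => Np_logs hp hx hz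
    _ = _ := by rw [Finset.sum_const, nsmul_eq_mul, mul_comm]

lemma alg2 {X L n W : ℝ} (hX : 0 < X) (hL : 16 * L ≤ X) (hn : 0 ≤ n) (hL0 : 0 ≤ L) (hm : (X / 2 - 2 * L) ^ 2 * n ≤ W) :
    n ≤ 4 * W / X ^ 2 + 64 * L * W / X ^ 3 := by
  have e1 : (X / 2 - 2 * L) ^ 2 * n = X ^ 2 / 4 * n - 2 * X * L * n + 4 * L ^ 2 * n := by ring
  have e2 : 0 ≤ 4 * L ^ 2 * n := by positivity
  have e3 : 2 * X * L * n ≤ X ^ 2 / 8 * n := by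
    have : 2 * X * L ≤ X ^ 2 / 8 := by nlinarith
    gcongr
  have e4 : X ^ 2 * n ≤ 8 * W := by linarith
  have e5 : X ^ 2 * n ≤ 4 * W + 8 * X * L * n := by linarith
  have e6 : X ^ 3 * n ≤ 4 * W * X + 64 * L * W := by
    have a : X ^ 3 * n = X * (X ^ 2 * n) := by ring
    have b : X * (X ^ 2 * n) ≤ X * (4 * W + 8 * X * L * n) := by gcongr
    have c : 8 * L * (X ^ 2 * n) ≤ 8 * L * (8 * W) := by gcongr
    linarith
  have e7 : 4 * W / X ^ 2 + 64 * L * W / X ^ 3 = (4 * W * X + 64 * L * W) / X ^ 3 := by field_simp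
  rw [e7, le_div_iff₀ (by positivity)]
  linarith

lemma card_upper {x : ℝ} {p s : ℕ} (hp : 3 ≤ p) (hx : 0 < x) (hX : 1 ≤ Real.log x) (hL : 16 * Real.log (Real.log x) ≤ Real.log x) :
    ((Np x p s).card : ℝ) ≤ 4 * Wt x p s / Real.log x ^ 2 + 64 * Real.log (Real.log x) * Wt x p s / Real.log x ^ 3 + 2 * x / Real.log x ^ 4 := by
  classical
  set X := Real.log x with hXd
  set L := Real.log X with hLd
  set y := Real.sqrt x / X ^ 2 with hy
  have hX0 : 0 < X := by linarith
  have hL0 : 0 ≤ L := Real.log_nonneg hX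
  have hs0 : 0 < Real.sqrt x := Real.sqrt_pos.mpr hx
  have hy0 : 0 < y := by positivity
  have hlogy : Real.log y = X / 2 - 2 * L := by
    rw [hy, Real.log_div (by positivity) (by positivity), Real.log_sqrt hx.le, Real.log_pow]
    push_cast; ring
  rw [← Finset.card_filter_add_card_filter_not (s := Np x p s) (fun z : ℕ × ℕ => y ≤ z.1)]
  push_cast
  have h1 : (((Np x p s).filter (fun z : ℕ × ℕ => y ≤ z.1)).card : ℝ) ≤ 4 * Wt x p s / X ^ 2 + 64 * L * Wt x p s / X ^ 3 := by
    apply alg2 hX0 hL (Nat.cast_nonneg _) hL0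
    rw [mul_comm, ← nsmul_eq_mul, ← Finset.sum_const]
    unfold Wt
    have hm : 0 ≤ X / 2 - 2 * L := by linarith
    refine (Finset.sum_le_sum (g := fun z => Real.log z.1 * Real.log z.2) ?_).trans ?_
    · intro z hz
      rw [Finset.mem_filter] at hz
      have hR := ((mem_Np hp).mp hz.1).1
      have a1 : Real.log y ≤ Real.log z.1 := Real.log_le_log hy0 hz.2
      have a2 : Real.log y ≤ Real.log z.2 := Real.log_le_log hy0 (hz.2.trans (by exact_mod_cast hR.1.le))
      rw [hlogy] at a1 a2
      rw [sq]
      gcongr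
    · apply Finset.sum_le_sum_of_subset_of_nonneg (Finset.filter_subset _ _)
      intro z _ _
      exact mul_nonneg (Real.log_natCast_nonneg _) (Real.log_natCast_nonneg _)
  have h2 : (((Np x p s).filter (fun z : ℕ × ℕ => ¬ y ≤ z.1)).card : ℝ) ≤ 2 * x / X ^ 4 := by
    have hsub : (Np x p s).filter (fun z : ℕ × ℕ => ¬ y ≤ z.1) ⊆ (Finset.Ioc 0 ⌊y⌋₊) ×ˢ (Finset.Ioc 0 ⌊2 * y⌋₊) := by
      intro z hz
      rw [Finset.mem_filter] at hz
      obtain ⟨hR, hq, hr, _, _⟩ := (mem_Np hp).mp hz.1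
      rw [Finset.mem_product, Finset.mem_Ioc, Finset.mem_Ioc]
      have hlt : (z.1:ℝ) ≤ y := (not_le.mp hz.2).le
      refine ⟨⟨hq.pos, Nat.le_floor hlt⟩, ⟨hr.pos, Nat.le_floor ?_⟩⟩
      have h3 := hR.2.2
      have hk := (kap hp).2
      have h1 : (1:ℝ) ≤ z.1 := by exact_mod_cast hq.one_lt.le
      have : (((p:ℝ) - 1) / ((p:ℝ) - 2)) * ((z.1:ℝ) - 1) ≤ 2 * ((z.1:ℝ) - 1) := by
        apply mul_le_mul_of_nonneg_right hk (by linarith)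
      linarith
    refine (Nat.cast_le.mpr (Finset.card_le_card hsub)).trans ?_
    rw [Finset.card_product, Nat.card_Ioc, Nat.card_Ioc, Nat.sub_zero, Nat.sub_zero]
    push_cast
    have f1 := Nat.floor_le hy0.le
    have f2 := Nat.floor_le (by positivity : 0 ≤ 2 * y)
    calc (⌊y⌋₊ : ℝ) * ⌊2 * y⌋₊ ≤ y * (2 * y) := by gcongr
      _ = 2 * (Real.sqrt x * Real.sqrt x) / X ^ 4 := by rw [hy]; field_simp
      _ = _ := by rw [Real.mul_self_sqrt hx.le]
  linarith

end TA

namespace TA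

lemma tail4 {X : ℝ} (hX : 2 ≤ X) (S : Finset ℕ) (hS : ∀ n ∈ S, X < n) : ∑ n ∈ S, 1 / (n:ℝ) ^ 4 ≤ 8 / X ^ 3 := by
  set A := ⌊X⌋₊ with hA
  obtain ⟨f1, f2, f3, f4, _⟩ := floor_log (by linarith : 1 ≤ X)
  have hA0 : A ≠ 0 := by
    intro h
    rw [← hA, h] at f4
    norm_num at f4
  have hA1 : (0:ℝ) < A := by linarith
  have hAn : ∀ n ∈ S, A < n := fun n hn => (Nat.floor_lt (by linarith)).mpr (hS n hn)
  have hsub : S ⊆ Finset.Ioc A (A + S.sup id) := by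
    intro n hn
    rw [Finset.mem_Ioc]
    exact ⟨hAn n hn, le_trans (Finset.le_sup (f := id) hn) (by omega)⟩
  calc ∑ n ∈ S, 1 / (n:ℝ) ^ 4 ≤ ∑ n ∈ S, 1 / (A:ℝ) ^ 2 * ((n:ℝ) ^ 2)⁻¹ := by
        apply Finset.sum_le_sum
        intro n hn
        have h : (A:ℝ) ≤ n := by exact_mod_cast (hAn n hn).le
        have h0 : (0:ℝ) < n := by linarith
        rw [← one_div, div_mul_div_comm, mul_one]
        apply one_div_le_one_div_of_le (by positivity)
        calc (A:ℝ) ^ 2 * (n:ℝ) ^ 2 ≤ (n:ℝ) ^ 2 * (n:ℝ) ^ 2 := by gcongr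
          _ = _ := by ring
    _ ≤ ∑ n ∈ Finset.Ioc A (A + S.sup id), 1 / (A:ℝ) ^ 2 * ((n:ℝ) ^ 2)⁻¹ := by
        apply Finset.sum_le_sum_of_subset_of_nonneg hsub
        intros; positivity
    _ = 1 / (A:ℝ) ^ 2 * ∑ n ∈ Finset.Ioc A (A + S.sup id), ((n:ℝ) ^ 2)⁻¹ := by rw [Finset.mul_sum]
    _ ≤ 1 / (A:ℝ) ^ 2 * (A:ℝ)⁻¹ := by
        gcongr
        have := sum_Ioc_inv_sq_le_sub (α := ℝ) hA0 (Nat.le_add_right A (S.sup id))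
        have h2 : (0:ℝ) ≤ ((A + S.sup id : ℕ) : ℝ)⁻¹ := by positivity
        linarith
    _ = 1 / (A:ℝ) ^ 3 := by field_simp
    _ ≤ 1 / (X / 2) ^ 3 := by gcongr
    _ = 8 / X ^ 3 := by field_simp; norm_num

/-- term of the constant -/
noncomputable def fp (n : ℕ) : ℝ := (1 / ((n : ℝ) * ((n : ℝ) - 1) ^ 2)) * Real.log (((n : ℝ) - 1) / ((n : ℝ) - 2))

lemma fp_bd {n : ℕ} (hn : 3 ≤ n) : 0 ≤ fp n ∧ fp n ≤ 7 * (1 / (n:ℝ) ^ 4) := by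
  have hn' : (3:ℝ) ≤ n := by exact_mod_cast hn
  obtain ⟨k1, k2⟩ := kap hn
  have hl0 := Real.log_nonneg k1.le
  have hl : Real.log (((n : ℝ) - 1) / ((n : ℝ) - 2)) ≤ 3 / n := by
    refine (Real.log_le_sub_one_of_pos (by linarith)).trans ?_
    have : ((n : ℝ) - 1) / ((n : ℝ) - 2) - 1 = 1 / ((n:ℝ) - 2) := by
      have : (n:ℝ) - 2 ≠ 0 := by linarith
      field_simp; ring
    rw [this, div_le_div_iff₀ (by linarith) (by linarith)]
    linarith
  unfold fp
  refine ⟨by positivity, ?_⟩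
  calc (1 / ((n : ℝ) * ((n : ℝ) - 1) ^ 2)) * Real.log (((n : ℝ) - 1) / ((n : ℝ) - 2))
      ≤ (1 / ((n:ℝ) * (2 / 3 * n) ^ 2)) * (3 / n) := by
        gcongr
        linarith
    _ = 27 / 4 * (1 / (n:ℝ) ^ 4) := by field_simp; norm_num
    _ ≤ _ := by gcongr; norm_num

open Classical in
/-- indicator form -/
noncomputable def gp (n : ℕ) : ℝ := if n.Prime ∧ 3 ≤ n then fp n else 0

lemma gp_bd (n : ℕ) : 0 ≤ gp n ∧ gp n ≤ 7 * (1 / (n:ℝ) ^ 4) := by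
  unfold gp
  split_ifs with h
  · exact fp_bd h.2
  · exact ⟨le_rfl, by positivity⟩

lemma C1_eq : C1 = 4 * ∑' n, gp n := by
  unfold C1
  congr 1
  have := tsum_subtype {p : ℕ | p.Prime ∧ 3 ≤ p} fp
  refine Eq.trans ?_ (this.trans ?_)
  · rfl
  · refine tsum_congr fun n => ?_
    unfold gp
    rw [Set.indicator_apply]
    rfl

lemma gp_summable : Summable gp := by
  have h : Summable (fun n : ℕ => 7 * (1 / (n:ℝ) ^ 4)) :=
    (Real.summable_one_div_nat_pow.mpr (by norm_num)).mul_left 7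
  exact Summable.of_nonneg_of_le (fun n => (gp_bd n).1) (fun n => (gp_bd n).2) h

/-- small primes -/
noncomputable def Ms (X : ℝ) : Finset ℕ := (Finset.Ioc 2 ⌊X⌋₊).filter Nat.Prime

lemma mem_Ms {X : ℝ} (hX : 0 ≤ X) {p : ℕ} : p ∈ Ms X ↔ p.Prime ∧ 3 ≤ p ∧ (p:ℝ) ≤ X := by
  unfold Ms
  rw [Finset.mem_filter, Finset.mem_Ioc, Nat.le_floor_iff hX]
  constructor
  · rintro ⟨⟨a, b⟩, c⟩; exact ⟨c, a, b⟩
  · rintro ⟨c, a, b⟩; exact ⟨⟨a, b⟩, c⟩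

lemma Ms_card {X : ℝ} (hX : 0 ≤ X) : ((Ms X).card : ℝ) ≤ X := by
  have h1 : (Ms X).card ≤ ⌊X⌋₊ := by
    unfold Ms
    refine (Finset.card_filter_le _ _).trans ?_
    rw [Nat.card_Ioc]; omega
  exact (Nat.cast_le.mpr h1).trans (Nat.floor_le hX)

lemma C1_tail {X : ℝ} (hX : 2 ≤ X) : ∑ p ∈ Ms X, fp p ≤ C1 / 4 ∧ C1 / 4 ≤ ∑ p ∈ Ms X, fp p + 56 / X ^ 3 := by
  classical
  have hX0 : 0 ≤ X := by linarith
  have hC : C1 / 4 = ∑' n, gp n := by rw [C1_eq]; ring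
  have hs : ∑ p ∈ Ms X, fp p = ∑ p ∈ Ms X, gp p := by
    refine Finset.sum_congr rfl fun p hp => ?_
    rw [mem_Ms hX0] at hp
    unfold gp
    rw [if_pos ⟨hp.1, hp.2.1⟩]
  rw [hC, hs]
  refine ⟨gp_summable.sum_le_tsum _ (fun n _ => (gp_bd n).1), ?_⟩
  apply gp_summable.tsum_le_of_sum_le
  intro u
  have h1 : ∑ n ∈ u, gp n ≤ ∑ n ∈ u ∪ Ms X, gp n :=
    Finset.sum_le_sum_of_subset_of_nonneg Finset.subset_union_left (fun n _ _ => (gp_bd n).1)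
  refine h1.trans ?_
  rw [← Finset.sum_sdiff (Finset.subset_union_right : Ms X ⊆ u ∪ Ms X), add_comm]
  gcongr
  have h2 : ∑ n ∈ (u ∪ Ms X) \ Ms X, gp n ≤ ∑ n ∈ ((u ∪ Ms X) \ Ms X).filter (fun n : ℕ => X < n), 7 * (1 / (n:ℝ) ^ 4) := by
    rw [Finset.sum_filter]
    apply Finset.sum_le_sum
    intro n hn
    split_ifs with h
    · exact (gp_bd n).2
    · rw [Finset.mem_sdiff, mem_Ms hX0] at hn
      unfold gp
      rw [if_neg]
      intro h'
      exact hn.2 ⟨h'.1, h'.2, not_lt.mp h⟩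
  refine h2.trans ?_
  rw [← Finset.mul_sum]
  have := tail4 hX (((u ∪ Ms X) \ Ms X).filter (fun n : ℕ => X < n)) (fun n hn => (Finset.mem_filter.mp hn).2)
  calc _ ≤ 7 * (8 / X ^ 3) := by gcongr
    _ = _ := by ring

/-- two-class count -/
noncomputable def Nc (x : ℝ) (p : ℕ) : ℝ := ((Np x p 1).card : ℝ) + ((Np x p (p - 1)).card : ℝ)

/-- two-class weight -/
noncomputable def Wc (x : ℝ) (p : ℕ) : ℝ := Wt x p 1 + Wt x p (p - 1)

lemma T_split {x : ℝ} (hx : 0 < x) (hX : 8 ≤ Real.log x) : ∑ p ∈ Ms (Real.log x), Nc x p ≤ Tcount x ∧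
    (Tcount x : ℝ) ≤ ∑ p ∈ Ms (Real.log x), Nc x p + 48 * x / Real.log x ^ 3 := by
  have hXx : Real.log x ≤ x := by have := x_big hx hX; linarith
  have hT : (Tcount x : ℝ) = ∑ p ∈ Ms x, Nc x p := by
    rw [Tcount_eq hx.le]
    unfold Ms Nc
    push_cast
    rfl
  have hsub : Ms (Real.log x) ⊆ Ms x := by
    intro p hp
    rw [mem_Ms (by linarith)] at hp ⊢
    exact ⟨hp.1, hp.2.1, hp.2.2.trans hXx⟩
  have hnn : ∀ p, 0 ≤ Nc x p := fun p => by unfold Nc; positivity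
  rw [hT]
  refine ⟨Finset.sum_le_sum_of_subset_of_nonneg hsub (fun p _ _ => hnn p), ?_⟩
  rw [← Finset.sum_sdiff hsub, add_comm]
  gcongr
  have hmem : ∀ p ∈ Ms x \ Ms (Real.log x), p.Prime ∧ 3 ≤ p ∧ Real.log x < p := by
    intro p hp
    rw [Finset.mem_sdiff, mem_Ms hx.le, mem_Ms (by linarith)] at hp
    refine ⟨hp.1.1, hp.1.2.1, ?_⟩
    by_contra h
    exact hp.2 ⟨hp.1.1, hp.1.2.1, not_lt.mp h⟩
  calc ∑ p ∈ Ms x \ Ms (Real.log x), Nc x p ≤ ∑ p ∈ Ms x \ Ms (Real.log x), (6 * x) * (1 / (p:ℝ) ^ 4) := by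
        apply Finset.sum_le_sum
        intro p hp
        obtain ⟨a, b, c⟩ := hmem p hp
        have h1 := Np_card a b (Or.inl rfl) hx.le
        have h2 := Np_card a b (Or.inr rfl) hx.le
        unfold Nc
        have e : (6 * x) * (1 / (p:ℝ) ^ 4) = 3 * x / p ^ 4 + 3 * x / p ^ 4 := by ring
        rw [e]
        gcongr
    _ = (6 * x) * ∑ p ∈ Ms x \ Ms (Real.log x), 1 / (p:ℝ) ^ 4 := by rw [Finset.mul_sum]
    _ ≤ (6 * x) * (8 / Real.log x ^ 3) := by
        gcongr
        exact tail4 (by linarith) _ (fun p hp => (hmem p hp).2.2)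
    _ = _ := by ring

lemma S_est : ∃ C : ℝ, 0 < C ∧ ∀ x : ℝ, 408 ≤ Real.log x → 0 < x →
    |∑ p ∈ Ms (Real.log x), Wc x p - x * ∑ p ∈ Ms (Real.log x), fp p| ≤ C * x / Real.log x ^ 2 := by
  obtain ⟨C, hC, H⟩ := Wt_est
  refine ⟨2 * C, by positivity, ?_⟩
  intro x hX hx
  have hX0 : 0 ≤ Real.log x := by linarith
  have hX1 : 0 < Real.log x := by linarith
  rw [Finset.mul_sum, ← Finset.sum_sub_distrib]
  refine (Finset.abs_sum_le_sum_abs _ _).trans ?_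
  calc ∑ p ∈ Ms (Real.log x), |Wc x p - x * fp p| ≤ ∑ p ∈ Ms (Real.log x), 2 * (C * x / Real.log x ^ 3) := by
        apply Finset.sum_le_sum
        intro p hp
        obtain ⟨a, b, c⟩ := (mem_Ms hX0).mp hp
        have h1 := H x hX hx p a b c 1 (by omega) (by omega)
        have h2 := H x hX hx p a b c (p - 1) (by omega) (by omega)
        have hp' : (3:ℝ) ≤ p := by exact_mod_cast b
        have e : (1 / ((p:ℝ) - 1)) ^ 2 * (x / p * Real.log (((p:ℝ) - 1) / ((p:ℝ) - 2)) / 2) = x * fp p / 2 := by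
          unfold fp
          have : (p:ℝ) - 1 ≠ 0 := by linarith
          field_simp
        rw [e] at h1 h2
        have e2 : Wc x p - x * fp p = (Wt x p 1 - x * fp p / 2) + (Wt x p (p - 1) - x * fp p / 2) := by unfold Wc; ring
        rw [e2]
        refine (abs_add_le _ _).trans ?_
        linarith
    _ = (Ms (Real.log x)).card * (2 * (C * x / Real.log x ^ 3)) := by rw [Finset.sum_const, nsmul_eq_mul]
    _ ≤ Real.log x * (2 * (C * x / Real.log x ^ 3)) := by
        gcongr
        exact Ms_card hX0
    _ = _ := by field_simp

lemma N_est {x : ℝ} (hx : 0 < x) (hX : 8 ≤ Real.log x) (hL : 16 * Real.log (Real.log x) ≤ Real.log x) :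
    4 * (∑ p ∈ Ms (Real.log x), Wc x p) / Real.log x ^ 2 ≤ ∑ p ∈ Ms (Real.log x), Nc x p ∧
    ∑ p ∈ Ms (Real.log x), Nc x p ≤ 4 * (∑ p ∈ Ms (Real.log x), Wc x p) / Real.log x ^ 2
      + 64 * Real.log (Real.log x) * (∑ p ∈ Ms (Real.log x), Wc x p) / Real.log x ^ 3 + 4 * x / Real.log x ^ 3 := by
  have hX0 : 0 ≤ Real.log x := by linarith
  have hX1 : 0 < Real.log x := by linarith
  have hx1 : 1 ≤ x := by have := x_big hx hX; linarith
  constructor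
  · rw [div_le_iff₀ (by positivity), Finset.mul_sum, Finset.sum_mul]
    apply Finset.sum_le_sum
    intro p hp
    obtain ⟨a, b, c⟩ := (mem_Ms hX0).mp hp
    have h1 := card_lower (s := 1) b hx1
    have h2 := card_lower (s := p - 1) b hx1
    unfold Wc Nc
    linarith
  · calc ∑ p ∈ Ms (Real.log x), Nc x p ≤ ∑ p ∈ Ms (Real.log x), (4 * Wc x p / Real.log x ^ 2
          + 64 * Real.log (Real.log x) * Wc x p / Real.log x ^ 3 + 4 * x / Real.log x ^ 4) := by
          apply Finset.sum_le_sum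
          intro p hp
          obtain ⟨a, b, c⟩ := (mem_Ms hX0).mp hp
          have h1 := card_upper (s := 1) b hx (by linarith) hL
          have h2 := card_upper (s := p - 1) b hx (by linarith) hL
          unfold Wc Nc
          refine (add_le_add h1 h2).trans (le_of_eq ?_)
          ring
      _ = 4 * (∑ p ∈ Ms (Real.log x), Wc x p) / Real.log x ^ 2
          + 64 * Real.log (Real.log x) * (∑ p ∈ Ms (Real.log x), Wc x p) / Real.log x ^ 3
          + (Ms (Real.log x)).card * (4 * x / Real.log x ^ 4) := by
          rw [Finset.sum_add_distrib, Finset.sum_add_distrib, Finset.sum_const, nsmul_eq_mul, Finset.mul_sum, Finset.mul_sum,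
            Finset.sum_div, Finset.sum_div]
      _ ≤ 4 * (∑ p ∈ Ms (Real.log x), Wc x p) / Real.log x ^ 2
          + 64 * Real.log (Real.log x) * (∑ p ∈ Ms (Real.log x), Wc x p) / Real.log x ^ 3
          + Real.log x * (4 * x / Real.log x ^ 4) := by
          gcongr
          exact Ms_card hX0
      _ = _ := by
          congr 1
          field_simp

/-- final algebra -/
lemma final_alg {T N S x F c1 X L C : ℝ} (hx : 0 < x) (hX : 2 ≤ X) (hL : 1 ≤ L) (hC : 0 < C)
    (t1 : N ≤ T) (t2 : T ≤ N + 48 * x / X ^ 3) (s : |S - x * F| ≤ C * x / X ^ 2)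
    (n1 : 4 * S / X ^ 2 ≤ N) (n2 : N ≤ 4 * S / X ^ 2 + 64 * L * S / X ^ 3 + 4 * x / X ^ 3)
    (f1 : F ≤ c1 / 4) (f2 : c1 / 4 ≤ F + 56 / X ^ 3) (hc : 0 ≤ c1) :
    |T - c1 * x / X ^ 2| ≤ (52 + 16 * c1 + 64 * C + 4 * C + 224) * x * L / X ^ 3 := by
  have hX0 : 0 < X := by linarith
  set Y := x / X ^ 3 with hY
  have hY0 : 0 < Y := by positivity
  have hYL : Y ≤ Y * L := le_mul_of_one_le_right hY0.le hL
  obtain ⟨s1, s2⟩ := abs_le.mp s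
  have hinv : 1 / X ≤ 1 := by rw [div_le_one hX0]; linarith
  have hpow2 : C * x / X ^ 2 ≤ C * x := div_le_self (by positivity) (one_le_pow₀ (by linarith))
  -- bound of S
  have hS : S ≤ x * (c1 / 4 + C) := by
    have : x * F ≤ x * (c1 / 4) := by gcongr
    linarith
  have b1 : 64 * L * S / X ^ 3 ≤ (16 * c1 + 64 * C) * (Y * L) := by
    calc 64 * L * S / X ^ 3 ≤ 64 * L * (x * (c1 / 4 + C)) / X ^ 3 := by gcongr
      _ = _ := by rw [hY]; ring
  have b2 : |4 * S / X ^ 2 - 4 * (x * F) / X ^ 2| ≤ 4 * C * Y := by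
    have e : 4 * S / X ^ 2 - 4 * (x * F) / X ^ 2 = (4 / X ^ 2) * (S - x * F) := by ring
    rw [e, abs_mul, abs_of_pos (by positivity)]
    calc 4 / X ^ 2 * |S - x * F| ≤ 4 / X ^ 2 * (C * x / X ^ 2) := by gcongr
      _ = 4 * C * Y * (1 / X) := by rw [hY]; field_simp
      _ ≤ 4 * C * Y * 1 := by gcongr
      _ = _ := mul_one _
  have b3 : 4 * (x * F) / X ^ 2 ≤ c1 * x / X ^ 2 := by
    have : 4 * (x * F) ≤ c1 * x := by
      have : x * F ≤ x * (c1 / 4) := by gcongr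
      linarith
    gcongr
  have b4 : c1 * x / X ^ 2 ≤ 4 * (x * F) / X ^ 2 + 224 * Y := by
    have h1 : x * (c1 / 4) ≤ x * (F + 56 / X ^ 3) := by gcongr
    have h2 : c1 * x ≤ 4 * (x * F) + 224 * Y := by
      have : x * (F + 56 / X ^ 3) = x * F + 56 * Y := by rw [hY]; ring
      linarith
    calc c1 * x / X ^ 2 ≤ (4 * (x * F) + 224 * Y) / X ^ 2 := by gcongr
      _ = 4 * (x * F) / X ^ 2 + 224 * Y / X ^ 2 := by ring
      _ ≤ _ := by
        gcongr
        exact div_le_self (by positivity) (one_le_pow₀ (by linarith))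
  obtain ⟨c2, c3⟩ := abs_le.mp b2
  have d1 : 48 * x / X ^ 3 = 48 * Y := by rw [hY]; ring
  have d2 : 4 * x / X ^ 3 = 4 * Y := by rw [hY]; ring
  have d3 : (52 + 16 * c1 + 64 * C + 4 * C + 224) * x * L / X ^ 3 = 52 * (Y * L) + (16 * c1 + 64 * C) * (Y * L) + 4 * C * (Y * L) + 224 * (Y * L) := by
    rw [hY]; ring
  have d4 : 4 * C * Y ≤ 4 * C * (Y * L) := by gcongr
  have d5 : 0 ≤ (16 * c1 + 64 * C) * (Y * L) := by positivity
  have d6 : 0 < 4 * C * (Y * L) := by positivity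
  rw [d1] at t2
  rw [d2] at n2
  rw [d3, abs_le]
  constructor <;> linarith

end TA

theorem Tcount_asymptotic :
    ∃ C > (0 : ℝ), ∃ x₀ : ℝ, ∀ x ≥ x₀,
      |(Tcount x : ℝ) - C1 * x / (Real.log x) ^ 2| ≤
        C * x * Real.log (Real.log x) / (Real.log x) ^ 3 := by
  obtain ⟨C, hC, hS⟩ := TA.S_est
  have hC1 : 0 ≤ C1 := by
    have h := (TA.C1_tail (X := 2) le_rfl).1
    have : 0 ≤ ∑ p ∈ TA.Ms 2, TA.fp p :=
      Finset.sum_nonneg fun p hp => (TA.fp_bd ((TA.mem_Ms (by norm_num)).mp hp).2.1).1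
    linarith
  have hev : ∀ᶠ x : ℝ in atTop, 0 < x ∧ 408 ≤ Real.log x ∧ 16 * Real.log (Real.log x) ≤ Real.log x ∧ 1 ≤ Real.log (Real.log x) := by
    have hl := Real.tendsto_log_atTop
    have h1 := Real.isLittleO_log_id_atTop.comp_tendsto hl
    have h2 := h1.bound (show (0:ℝ) < 1 / 16 by norm_num)
    filter_upwards [eventually_gt_atTop 0, hl.eventually_ge_atTop 408, h2, (hl.comp hl).eventually_ge_atTop 1] with x a b c d
    refine ⟨a, b, ?_, d⟩
    simp only [Function.comp, id, Real.norm_eq_abs] at c d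
    rw [abs_of_nonneg (by linarith), abs_of_nonneg (by linarith)] at c
    linarith
  obtain ⟨x₀, hx₀⟩ := eventually_atTop.mp hev
  refine ⟨52 + 16 * C1 + 64 * C + 4 * C + 224, by positivity, x₀, fun x hx => ?_⟩
  obtain ⟨a, b, c, d⟩ := hx₀ x hx
  obtain ⟨t1, t2⟩ := TA.T_split a (by linarith)
  obtain ⟨n1, n2⟩ := TA.N_est a (by linarith) c
  obtain ⟨f1, f2⟩ := TA.C1_tail (X := Real.log x) (by linarith)
  exact TA.final_alg a (by linarith) d hC t1 t2 (hS x b a) n1 n2 f1 f2 hC1
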